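/- Let χ : ℝ → ℝ be a smooth compactly supported function that is equal to 1 in a neighbourhood of 0, and fix one of the two signs ±. There exists a constant C > 0 such that for every pair (q, r) ∈ {(4,∞), (∞,2)}, every T > 0, every μ ∈ (0,1], every ε ∈ (0,1] and every continuous map G from [0,T] into the Schwartz functions on ℝ, the function u(t,x) = ∫₀ᵗ (e^{±((t−s)/ε) ∂ₓ/√(1+μD²/3)} ∂ₓ G(s))(x) ds satisfies ‖u‖_{L^{q}(0,T; L^{r}(ℝ))} ≤ C (ε/μ)^{(1/2)(1 − 1/r)} ( ‖|D|^{1/2 + 1/(2r)} χ(√μ|D|) G‖_{L^{4/3}(0,T; L¹(ℝ))} + ‖(1 − χ(√μ|D|)) (√μ|D|)^{2(1 − 1/r)} ∂ₓ G‖_{L^{4/3}(0,T; L¹(ℝ))} ), with the convention 1/∞ = 0. -/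

import Mathlib

open MeasureTheory Real Complex
open scoped ENNReal

/-- One-dimensional Fourier transform with the convention
`f̂(ξ) = (2π)^{-1/2} ∫ e^{-i x ξ} f(x) dx`. -/
noncomputable def ft1 (f : ℝ → ℂ) (ξ : ℝ) : ℂ :=
  (((2 * π) ^ (-(1 : ℝ) / 2) : ℝ) : ℂ) * ∫ x : ℝ, Complex.exp (-Complex.I * (x * ξ : ℝ)) * f x

/-- One-dimensional Fourier multiplier `m(D) f (x) = (2π)^{-1/2} ∫ e^{i x ξ} m(ξ) f̂(ξ) dξ`. -/
noncomputable def fmult1 (m : ℝ → ℂ) (f : ℝ → ℂ) (x : ℝ) : ℂ :=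
  (((2 * π) ^ (-(1 : ℝ) / 2) : ℝ) : ℂ) *
    ∫ ξ : ℝ, Complex.exp (Complex.I * (x * ξ : ℝ)) * m ξ * ft1 f ξ

/-- Symbol `e^{σ i τ ξ (1 + μ ξ²/3)^{-1/2}}` of the free propagator
`e^{σ τ ∂ₓ/√(1+μD²/3)}` of the linearized 1D classical Boussinesq system (`σ = ±1`). -/
noncomputable def prop1 (σ τ μ : ℝ) (ξ : ℝ) : ℂ :=
  Complex.exp (Complex.I * ((σ * τ * ξ / Real.sqrt (1 + μ * ξ ^ 2 / 3) : ℝ) : ℂ))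

/-- `L^q` norm in time on `(0,T)` of an `ℝ≥0∞`-valued function (used for mixed
space-time norms `L^q(0,T;L^r)`), with the usual `essSup` convention for `q = ∞`. -/
noncomputable def timeLp (q : ℝ≥0∞) (T : ℝ) (g : ℝ → ℝ≥0∞) : ℝ≥0∞ :=
  if q = ⊤ then essSup g (MeasureTheory.volume.restrict (Set.Ioo 0 T))
  else (∫⁻ t in Set.Ioo 0 T, g t ^ q.toReal) ^ (1 / q.toReal)

/-- integration by parts bound -/
lemma osc_ibp {a b : ℝ} (hab : a ≤ b) {ψ A H H' : ℝ → ℝ}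
    (hψ : ∀ x ∈ Set.Icc a b, HasDerivAt ψ (H x * A x) x)
    (hH : ∀ x ∈ Set.Icc a b, HasDerivAt H (H' x) x)
    (hA : ContinuousOn A (Set.Icc a b)) (hH' : ContinuousOn H' (Set.Icc a b))
    (h0 : ∀ x ∈ Set.Icc a b, H x ≠ 0) :
    ‖∫ x in a..b, Complex.exp (Complex.I * (ψ x : ℂ)) * (A x : ℂ)‖ ≤
      1 / |H a| + 1 / |H b| + ∫ x in a..b, |H' x| / (H x) ^ 2 := by
  have hu : Set.uIcc a b = Set.Icc a b := Set.uIcc_of_le hab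
  have hHc : ContinuousOn H (Set.Icc a b) := fun x hx => (hH x hx).continuousAt.continuousWithinAt
  have hψc : ContinuousOn ψ (Set.Icc a b) := fun x hx => (hψ x hx).continuousAt.continuousWithinAt
  have hv : ∀ x ∈ Set.uIcc a b, HasDerivAt (fun x => Complex.exp (Complex.I * (ψ x : ℂ)))
      (Complex.exp (Complex.I * (ψ x : ℂ)) * (Complex.I * ((H x * A x : ℝ) : ℂ))) x := by
    intro x hx
    rw [hu] at hx
    exact (((hψ x hx).ofReal_comp).const_mul Complex.I).cexp
  have hw : ∀ x ∈ Set.uIcc a b, HasDerivAt (fun x => (((H x)⁻¹ : ℝ) : ℂ))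
      (((-H' x / (H x) ^ 2 : ℝ)) : ℂ) x := by
    intro x hx
    rw [hu] at hx
    exact ((hH x hx).inv (h0 x hx)).ofReal_comp
  have hE : ContinuousOn (fun x => Complex.exp (Complex.I * (ψ x : ℂ))) (Set.Icc a b) := by
    fun_prop
  have hw'c : ContinuousOn (fun x => -H' x / (H x) ^ 2) (Set.Icc a b) := by
    apply ContinuousOn.div hH'.neg (hHc.pow 2)
    intro x hx; exact pow_ne_zero 2 (h0 x hx)
  have key := intervalIntegral.integral_mul_deriv_eq_deriv_mul hw hv
    (ContinuousOn.intervalIntegrable (by rw [hu]; fun_prop))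
    (ContinuousOn.intervalIntegrable (by rw [hu]; fun_prop))
  have e1 : ∫ x in a..b, Complex.exp (Complex.I * (ψ x : ℂ)) * (A x : ℂ) =
      -Complex.I * ∫ x in a..b, (((H x)⁻¹ : ℝ) : ℂ) *
        (Complex.exp (Complex.I * (ψ x : ℂ)) * (Complex.I * ((H x * A x : ℝ) : ℂ))) := by
    rw [← intervalIntegral.integral_const_mul]
    apply intervalIntegral.integral_congr
    intro x hx
    rw [hu] at hx
    have := h0 x hx
    have h1 : (H x : ℂ) ≠ 0 := by exact_mod_cast this
    simp only []
    push_cast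
    field_simp
    rw [Complex.I_sq]; ring
  rw [e1, key, norm_mul]
  have hn : ∀ x, ‖Complex.exp (Complex.I * (ψ x : ℂ))‖ = 1 := by
    intro x; rw [mul_comm]; exact Complex.norm_exp_ofReal_mul_I _
  have h2 : ‖∫ x in a..b, (((-H' x / (H x) ^ 2 : ℝ)) : ℂ) * Complex.exp (Complex.I * (ψ x : ℂ))‖ ≤
      ∫ x in a..b, |H' x| / (H x) ^ 2 := by
    refine (intervalIntegral.norm_integral_le_integral_norm hab).trans (le_of_eq ?_)
    apply intervalIntegral.integral_congr
    intro x hx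
    simp only [norm_mul, hn, Complex.norm_real, Real.norm_eq_abs, mul_one, abs_div, abs_neg, abs_pow, sq_abs]
  calc _ ≤ 1 * (‖(((H b)⁻¹ : ℝ) : ℂ) * Complex.exp (Complex.I * (ψ b : ℂ))‖ +
        ‖(((H a)⁻¹ : ℝ) : ℂ) * Complex.exp (Complex.I * (ψ a : ℂ))‖ + ∫ x in a..b, |H' x| / (H x) ^ 2) := by
        gcongr
        · simp
        · refine (norm_sub_le _ _).trans (add_le_add (norm_sub_le _ _) h2)
    _ = _ := by
        rw [norm_mul, norm_mul, hn, hn, Complex.norm_real, Complex.norm_real]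
        simp only [Real.norm_eq_abs, abs_inv]
        ring

lemma osc_trivial {a b : ℝ} (hab : a ≤ b) {ψ A : ℝ → ℝ} (hA : ∀ x ∈ Set.Icc a b, 0 ≤ A x) :
    ‖∫ x in a..b, Complex.exp (Complex.I * (ψ x : ℂ)) * (A x : ℂ)‖ ≤ ∫ x in a..b, A x := by
  refine (intervalIntegral.norm_integral_le_integral_norm hab).trans (le_of_eq ?_)
  apply intervalIntegral.integral_congr
  intro x hx
  rw [Set.uIcc_of_le hab] at hx
  have hn : ∀ x, ‖Complex.exp (Complex.I * (ψ x : ℂ))‖ = 1 := by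
    intro x; rw [mul_comm]; exact Complex.norm_exp_ofReal_mul_I _
  simp only [norm_mul, hn, Complex.norm_real, Real.norm_eq_abs, one_mul, abs_of_nonneg (hA x hx)]

lemma split_level {a b L : ℝ} (hab : a ≤ b) {H : ℝ → ℝ} (hc : ContinuousOn H (Set.Icc a b))
    (hm : AntitoneOn H (Set.Icc a b)) :
    ∃ p ∈ Set.Icc a b, (p = a ∨ ∀ x ∈ Set.Icc a p, L ≤ H x) ∧
      (p = b ∨ ∀ x ∈ Set.Icc p b, H x ≤ L) := by
  by_cases h1 : H a ≤ L
  · exact ⟨a, ⟨le_rfl, hab⟩, Or.inl rfl, Or.inr fun x hx =>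
      (hm ⟨le_rfl, hab⟩ hx hx.1).trans h1⟩
  by_cases h2 : L ≤ H b
  · exact ⟨b, ⟨hab, le_rfl⟩, Or.inr fun x hx =>
      h2.trans (hm hx ⟨hab, le_rfl⟩ hx.2), Or.inl rfl⟩
  push Not at h1 h2
  obtain ⟨p, hp, hpL⟩ := intermediate_value_Icc' hab hc ⟨h2.le, h1.le⟩
  refine ⟨p, hp, Or.inr fun x hx => ?_, Or.inr fun x hx => ?_⟩
  · rw [← hpL]; exact hm ⟨hx.1, hx.2.trans hp.2⟩ hp hx.2
  · rw [← hpL]; exact hm hp ⟨hp.1.trans hx.1, hx.2⟩ hx.1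

/-- second derivative van der Corput -/
lemma vdc {a b l : ℝ} (hab : a ≤ b) (hl : 0 < l) {ψ A H H' : ℝ → ℝ}
    (hψ : ∀ x ∈ Set.Icc a b, HasDerivAt ψ (H x * A x) x)
    (hH : ∀ x ∈ Set.Icc a b, HasDerivAt H (H' x) x)
    (hA : ContinuousOn A (Set.Icc a b)) (hH' : ContinuousOn H' (Set.Icc a b))
    (hA0 : ∀ x ∈ Set.Icc a b, 0 ≤ A x)
    (hle : ∀ x ∈ Set.Icc a b, H' x ≤ - (l * A x)) :
    ‖∫ x in a..b, Complex.exp (Complex.I * (ψ x : ℂ)) * (A x : ℂ)‖ ≤ 10 / √l := by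
  have hHc : ContinuousOn H (Set.Icc a b) := fun x hx => (hH x hx).continuousAt.continuousWithinAt
  have hψc : ContinuousOn ψ (Set.Icc a b) := fun x hx => (hψ x hx).continuousAt.continuousWithinAt
  have hneg : ∀ x ∈ Set.Icc a b, H' x ≤ 0 := fun x hx =>
    (hle x hx).trans (neg_nonpos.2 (mul_nonneg hl.le (hA0 x hx)))
  have hm : AntitoneOn H (Set.Icc a b) := by
    apply antitoneOn_of_deriv_nonpos (convex_Icc a b) hHc
    · intro x hx; rw [interior_Icc] at hx
      exact (hH x ⟨hx.1.le, hx.2.le⟩).differentiableAt.differentiableWithinAt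
    · intro x hx; rw [interior_Icc] at hx
      rw [(hH x ⟨hx.1.le, hx.2.le⟩).deriv]; exact hneg x ⟨hx.1.le, hx.2.le⟩
  set δ := √l with hδ
  have hδ0 : 0 < δ := Real.sqrt_pos.2 hl
  -- far piece
  have far : ∀ p q : ℝ, a ≤ p → p ≤ q → q ≤ b → ((∀ x ∈ Set.Icc p q, δ ≤ H x) ∨
      (∀ x ∈ Set.Icc p q, H x ≤ -δ)) →
      ‖∫ x in p..q, Complex.exp (Complex.I * (ψ x : ℂ)) * (A x : ℂ)‖ ≤ 4 / δ := by
    intro p q hap hpq hqb hs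
    have hsub : Set.Icc p q ⊆ Set.Icc a b := Set.Icc_subset_Icc hap hqb
    have habs : ∀ x ∈ Set.Icc p q, δ ≤ |H x| := by
      intro x hx
      rcases hs with h | h
      · exact (h x hx).trans (le_abs_self _)
      · have := h x hx; exact (by linarith : δ ≤ -H x).trans (neg_le_abs _)
    have h0 : ∀ x ∈ Set.Icc p q, H x ≠ 0 := by
      intro x hx h; have := habs x hx; rw [h, abs_zero] at this; linarith
    have k := osc_ibp hpq (fun x hx => hψ x (hsub hx)) (fun x hx => hH x (hsub hx))
      (hA.mono hsub) (hH'.mono hsub) h0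
    have hinv : ∀ x ∈ Set.Icc p q, 1 / |H x| ≤ 1 / δ := fun x hx =>
      one_div_le_one_div_of_le hδ0 (habs x hx)
    have e : ∫ x in p..q, |H' x| / (H x) ^ 2 = (H q)⁻¹ - (H p)⁻¹ := by
      have : ∫ x in p..q, |H' x| / (H x) ^ 2 = ∫ x in p..q, -H' x / (H x) ^ 2 := by
        apply intervalIntegral.integral_congr
        intro x hx
        rw [Set.uIcc_of_le hpq] at hx
        simp only [abs_of_nonpos (hneg x (hsub hx))]
      rw [this]
      apply intervalIntegral.integral_eq_sub_of_hasDerivAt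
      · intro x hx
        rw [Set.uIcc_of_le hpq] at hx
        exact (hH x (hsub hx)).inv (h0 x hx)
      · apply ContinuousOn.intervalIntegrable
        rw [Set.uIcc_of_le hpq]
        exact ((hH'.mono hsub).neg).div ((hHc.mono hsub).pow 2) (fun x hx => pow_ne_zero 2 (h0 x hx))
    have e2 : (H q)⁻¹ - (H p)⁻¹ ≤ 1 / |H q| + 1 / |H p| := by
      have h1 : (H q)⁻¹ ≤ 1 / |H q| := by rw [one_div, ← abs_inv]; exact le_abs_self _
      have h2 : -(H p)⁻¹ ≤ 1 / |H p| := by rw [one_div, ← abs_inv]; exact neg_le_abs _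
      linarith
    have i1 := hinv p ⟨le_rfl, hpq⟩
    have i2 := hinv q ⟨hpq, le_rfl⟩
    have : 4 / δ = 4 * (1 / δ) := by ring
    rw [this]; linarith
  have hintg : ∀ p q : ℝ, a ≤ p → p ≤ q → q ≤ b →
      IntervalIntegrable (fun x => Complex.exp (Complex.I * (ψ x : ℂ)) * (A x : ℂ)) volume p q := by
    intro p q hap hpq hqb
    apply ContinuousOn.intervalIntegrable
    rw [Set.uIcc_of_le hpq]
    have hsub : Set.Icc p q ⊆ Set.Icc a b := Set.Icc_subset_Icc hap hqb
    have := hψc.mono hsub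
    have := hA.mono hsub
    fun_prop
  obtain ⟨p, hp, hp1, hp2⟩ := split_level (L := δ) hab hHc hm
  have hsub : Set.Icc p b ⊆ Set.Icc a b := Set.Icc_subset_Icc hp.1 le_rfl
  obtain ⟨q, hq, hq1, hq2⟩ := split_level (L := -δ) hp.2 (hHc.mono hsub) (hm.mono hsub)
  have h4 : 0 ≤ 4 / δ := by positivity
  have b1 : ‖∫ x in a..p, Complex.exp (Complex.I * (ψ x : ℂ)) * (A x : ℂ)‖ ≤ 4 / δ := by
    rcases hp1 with h | h
    · rw [h]; simpa using h4
    · exact far a p le_rfl hp.1 hp.2 (Or.inl h)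
  have b3 : ‖∫ x in q..b, Complex.exp (Complex.I * (ψ x : ℂ)) * (A x : ℂ)‖ ≤ 4 / δ := by
    rcases hq2 with h | h
    · rw [h]; simpa using h4
    · exact far q b (hp.1.trans hq.1) hq.2 le_rfl (Or.inr h)
  have b2 : ‖∫ x in p..q, Complex.exp (Complex.I * (ψ x : ℂ)) * (A x : ℂ)‖ ≤ 2 / δ := by
    have h2 : 0 ≤ 2 / δ := by positivity
    rcases eq_or_lt_of_le hq.1 with h | hpq
    · rw [h]; simpa using h2
    have hpb : p ≠ b := by rintro rfl; linarith [hq.2]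
    have hs2 : Set.Icc p q ⊆ Set.Icc a b := Set.Icc_subset_Icc hp.1 hq.2
    have u1 := (hp2.resolve_left hpb) p ⟨le_rfl, hp.2⟩
    have u2 := (hq1.resolve_left hpq.ne') q ⟨hpq.le, le_rfl⟩
    refine (osc_trivial hpq.le (fun x hx => hA0 x (hs2 hx))).trans ?_
    have e1 : ∫ x in p..q, A x ≤ ∫ x in p..q, (-H' x) / l := by
      apply intervalIntegral.integral_mono_on hpq.le
      · apply ContinuousOn.intervalIntegrable
        rw [Set.uIcc_of_le hpq.le]; exact hA.mono hs2
      · apply ContinuousOn.intervalIntegrable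
        rw [Set.uIcc_of_le hpq.le]; exact ((hH'.mono hs2).neg).div_const _
      · intro x hx
        have := hle x (hs2 hx)
        rw [le_div_iff₀ hl]; linarith
    have e2 : ∫ x in p..q, (-H' x) / l = (-H q) / l - (-H p) / l := by
      apply intervalIntegral.integral_eq_sub_of_hasDerivAt
      · intro x hx
        rw [Set.uIcc_of_le hpq.le] at hx
        exact ((hH x (hs2 hx)).neg).div_const l
      · apply ContinuousOn.intervalIntegrable
        rw [Set.uIcc_of_le hpq.le]; exact ((hH'.mono hs2).neg).div_const _
    have hll : l = δ * δ := (Real.mul_self_sqrt hl.le).symm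
    have e3 : (-H q) / l - (-H p) / l ≤ 2 / δ := by
      rw [← sub_div, div_le_div_iff₀ hl hδ0, hll]
      nlinarith
    linarith
  rw [← intervalIntegral.integral_add_adjacent_intervals (hintg a p le_rfl hp.1 hp.2)
    (hintg p b hp.1 hp.2 le_rfl), ← intervalIntegral.integral_add_adjacent_intervals
    (hintg p q hp.1 hq.1 hq.2) (hintg q b (hp.1.trans hq.1) hq.2 le_rfl)]
  refine (norm_add_le _ _).trans ?_
  have := norm_add_le (∫ x in p..q, Complex.exp (Complex.I * (ψ x : ℂ)) * (A x : ℂ))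
    (∫ x in q..b, Complex.exp (Complex.I * (ψ x : ℂ)) * (A x : ℂ))
  have e : 10 / δ = 4 / δ + 2 / δ + 4 / δ := by ring
  rw [e]; linarith

/-- weights -/
lemma osc_weight {a b B : ℝ} (hab : a ≤ b) {ψ W W' : ℝ → ℝ}
    (hψ : ContinuousOn ψ (Set.Icc a b))
    (hW : ∀ x ∈ Set.Icc a b, HasDerivAt W (W' x) x)
    (hW' : ContinuousOn W' (Set.Icc a b))
    (hB : ∀ x ∈ Set.Icc a b, ‖∫ t in x..b, Complex.exp (Complex.I * (ψ t : ℂ))‖ ≤ B) :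
    ‖∫ x in a..b, Complex.exp (Complex.I * (ψ x : ℂ)) * (W x : ℂ)‖ ≤
      B * (|W a| + ∫ x in a..b, |W' x|) := by
  have hB0 : 0 ≤ B := (norm_nonneg _).trans (hB a ⟨le_rfl, hab⟩)
  have hu : Set.uIcc a b = Set.Icc a b := Set.uIcc_of_le hab
  -- extend ψ continuously
  set ψ' : ℝ → ℝ := Set.IccExtend hab ((Set.Icc a b).domRestrict ψ) with hψ'
  have hψ'c : Continuous ψ' := (continuousOn_iff_continuous_domRestrict.1 hψ).Icc_extend'
  have heq : ∀ x ∈ Set.Icc a b, ψ' x = ψ x := fun x hx => by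
    rw [hψ', Set.IccExtend_of_mem hab _ hx]; rfl
  set E : ℝ → ℂ := fun x => Complex.exp (Complex.I * (ψ' x : ℂ)) with hE
  have hEc : Continuous E := by fun_prop
  have hF : ∀ x, HasDerivAt (fun x => - ∫ t in x..b, E t) (E x) x := by
    intro x
    have := (intervalIntegral.integral_hasDerivAt_left (hEc.intervalIntegrable x b)
      hEc.aestronglyMeasurable.stronglyMeasurableAtFilter hEc.continuousAt).neg
    rw [neg_neg] at this
    exact this
  have hFc : Continuous (fun x => - ∫ t in x..b, E t) :=
    continuous_iff_continuousAt.2 fun x => (hF x).continuousAt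
  have hWc : ContinuousOn W (Set.Icc a b) := fun x hx => (hW x hx).continuousAt.continuousWithinAt
  have key := intervalIntegral.integral_mul_deriv_eq_deriv_mul (a := a) (b := b)
    (u := fun x => (W x : ℂ)) (u' := fun x => (W' x : ℂ))
    (fun x hx => (hW x (hu ▸ hx)).ofReal_comp) (fun x _ => hF x)
    (ContinuousOn.intervalIntegrable (by rw [hu]; fun_prop))
    (hEc.intervalIntegrable _ _)
  have e1 : ∫ x in a..b, Complex.exp (Complex.I * (ψ x : ℂ)) * (W x : ℂ) =
      ∫ x in a..b, (W x : ℂ) * E x := by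
    apply intervalIntegral.integral_congr
    intro x hx
    rw [hu] at hx
    simp only [hE, heq x hx]; ring
  have hBE : ∀ x ∈ Set.Icc a b, ‖∫ t in x..b, E t‖ ≤ B := by
    intro x hx
    have : ∫ t in x..b, E t = ∫ t in x..b, Complex.exp (Complex.I * (ψ t : ℂ)) := by
      apply intervalIntegral.integral_congr
      intro t ht
      rw [Set.uIcc_of_le hx.2] at ht
      simp only [hE, heq t ⟨hx.1.trans ht.1, ht.2⟩]
    rw [this]; exact hB x hx
  have e2 : ‖∫ x in a..b, (W' x : ℂ) * (-∫ t in x..b, E t)‖ ≤ B * ∫ x in a..b, |W' x| := by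
    refine (intervalIntegral.norm_integral_le_integral_norm hab).trans ?_
    rw [← intervalIntegral.integral_const_mul]
    apply intervalIntegral.integral_mono_on hab
    · apply ContinuousOn.intervalIntegrable; rw [hu]
      exact ((Complex.continuous_ofReal.comp_continuousOn hW').mul hFc.continuousOn).norm
    · apply ContinuousOn.intervalIntegrable; rw [hu]; fun_prop
    · intro x hx
      rw [norm_mul, norm_neg, Complex.norm_real, Real.norm_eq_abs, mul_comm]
      gcongr
      exact hBE x hx
  rw [e1, key]
  simp only [intervalIntegral.integral_same, neg_zero, mul_zero, zero_sub]
  refine (norm_sub_le _ _).trans ?_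
  rw [mul_add]
  refine add_le_add ?_ e2
  rw [norm_neg, norm_mul, norm_neg, Complex.norm_real, Real.norm_eq_abs, mul_comm]
  gcongr
  exact hBE a ⟨le_rfl, hab⟩

noncomputable def sw (x : ℝ) : ℝ := √(1 + x ^ 2 / 3)
noncomputable def phs (x : ℝ) : ℝ := x / sw x

lemma sw_sq (x : ℝ) : sw x ^ 2 = 1 + x ^ 2 / 3 := Real.sq_sqrt (by positivity)
lemma sw_pos (x : ℝ) : 0 < sw x := Real.sqrt_pos.2 (by positivity)
lemma sw_one_le (x : ℝ) : 1 ≤ sw x := by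
  have := sw_sq x; have := sw_pos x; nlinarith [sq_nonneg x]
lemma sw_deriv (x : ℝ) : HasDerivAt sw (x / (3 * sw x)) x := by
  have h : HasDerivAt (fun x : ℝ => 1 + x ^ 2 / 3) (2 * x / 3) x := by
    have := ((hasDerivAt_pow 2 x).div_const 3).const_add 1
    simpa using this
  have := h.sqrt (by positivity)
  refine HasDerivAt.congr_deriv (f := sw) this ?_
  have := sw_pos x
  change _ / (2 * sw x) = _
  field_simp
@[fun_prop]
lemma sw_cont : Continuous sw := by unfold sw; fun_prop
lemma phs_deriv (x : ℝ) : HasDerivAt phs (1 / sw x ^ 3) x := by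
  have := (hasDerivAt_id x).div (sw_deriv x) (sw_pos x).ne'
  refine HasDerivAt.congr_deriv (f := phs) this ?_
  have h := sw_pos x
  have := sw_sq x
  simp only [id]
  field_simp
  linarith
lemma phs_deriv2 (x : ℝ) : HasDerivAt (fun x => 1 / sw x ^ 3) (- x / sw x ^ 5) x := by
  have h := sw_pos x
  have := ((sw_deriv x).pow 3).inv (pow_ne_zero 3 h.ne')
  simp only [one_div]
  refine HasDerivAt.congr_deriv (f := fun x => (sw x ^ 3)⁻¹) this ?_
  simp only [Pi.pow_apply]; push_cast; field_simp
lemma phs_cont : Continuous phs :=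
  continuous_iff_continuousAt.2 fun x => (phs_deriv x).continuousAt
lemma psi_deriv (τ κ x : ℝ) : HasDerivAt (fun x => τ * (phs x + κ * x)) (τ * (1 / sw x ^ 3 + κ)) x := by
  simpa using (((phs_deriv x).add ((hasDerivAt_id x).const_mul κ)).const_mul τ)
lemma dpsi_deriv (τ κ x : ℝ) : HasDerivAt (fun x => τ * (1 / sw x ^ 3 + κ)) (τ * (- x / sw x ^ 5)) x := by
  simpa using (((phs_deriv2 x).add_const κ).const_mul τ)

/-- middle -/
lemma osc_mid {a b : ℝ} (ha : 0 < a) (hab : a ≤ b) {W W' : ℝ → ℝ}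
    (hW : ∀ x ∈ Set.Icc a b, HasDerivAt W (W' x) x)
    (hW' : ContinuousOn W' (Set.Icc a b)) :
    ∃ C : ℝ, 0 ≤ C ∧ ∀ τ κ : ℝ, 0 < τ →
      ‖∫ x in a..b, Complex.exp (Complex.I * ((τ * (phs x + κ * x) : ℝ) : ℂ)) * (W x : ℂ)‖ ≤ C / √τ := by
  set l := a / sw b ^ 5 with hl
  have hl0 : 0 < l := by have := sw_pos b; positivity
  have hI : 0 ≤ ∫ x in a..b, |W' x| := intervalIntegral.integral_nonneg hab (fun x _ => abs_nonneg _)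
  refine ⟨10 / √l * (|W a| + ∫ x in a..b, |W' x|), by positivity, fun τ κ hτ => ?_⟩
  have hpc : Continuous (fun x => τ * (phs x + κ * x)) :=
    continuous_iff_continuousAt.2 fun x => (psi_deriv τ κ x).continuousAt
  have := osc_weight (B := 10 / √(l * τ)) hab (ψ := fun x => τ * (phs x + κ * x)) hpc.continuousOn hW hW' ?_
  · refine this.trans (le_of_eq ?_)
    rw [Real.sqrt_mul hl0.le]
    have := Real.sqrt_pos.2 hl0
    have := Real.sqrt_pos.2 hτ
    field_simp
  · intro x hx
    have := vdc (l := l * τ) hx.2 (by positivity) (ψ := fun x => τ * (phs x + κ * x)) (A := fun _ => 1)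
      (H := fun x => τ * (1 / sw x ^ 3 + κ)) (H' := fun x => τ * (- x / sw x ^ 5))
      (fun x _ => by simpa using psi_deriv τ κ x) (fun x _ => dpsi_deriv τ κ x)
      continuousOn_const ?_ (fun _ _ => zero_le_one) ?_
    · simpa using this
    · have : ∀ x, sw x ^ 5 ≠ 0 := fun x => pow_ne_zero 5 (sw_pos x).ne'
      have := sw_cont
      fun_prop (disch := (intros; exact pow_ne_zero _ (sw_pos _).ne'))
    · intro y hy
      have h1 : sw y ≤ sw b := by
        unfold sw; apply Real.sqrt_le_sqrt
        have : 0 ≤ y := ha.le.trans (hx.1.trans hy.1)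
        have := hy.2; gcongr
      have h2 : l ≤ y / sw y ^ 5 := by
        rw [hl]
        have := sw_pos y
        have hay : a ≤ y := hx.1.trans hy.1
        have : 0 ≤ y := ha.le.trans hay
        gcongr
      have : τ * (-y / sw y ^ 5) = - (y / sw y ^ 5 * τ) := by ring
      rw [this]
      have := mul_le_mul_of_nonneg_right h2 hτ.le
      linarith

lemma low_alg {x κ : ℝ} (hx0 : 0 < x) (hx1 : x ≤ 1) (hκ : -1 ≤ κ) :
    - x / sw x ^ 5 - (1 / sw x ^ 3 + κ) / (2 * x) ≤ - (1 / 10 * x) := by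
  have h1 := sw_one_le x
  have hs := sw_sq x
  set s := sw x
  have h2 : s ≤ 6 / 5 := by nlinarith
  have hs0 : 0 < s := by linarith
  have key : 0 ≤ (1 / s ^ 5 - 1 / 10) * (2 * x ^ 2) - (1 - 1 / s ^ 3) := by
    have hx2 : x ^ 2 = 3 * (s ^ 2 - 1) := by linarith
    rw [hx2]
    have : (1 / s ^ 5 - 1 / 10) * (2 * (3 * (s ^ 2 - 1))) - (1 - 1 / s ^ 3) =
      (s - 1) / s ^ 5 * (6 * (s + 1) * (1 - s ^ 5 / 10) - (s ^ 2 + s + 1) * s ^ 2) := by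
      field_simp; ring
    rw [this]
    apply mul_nonneg (by apply div_nonneg <;> [linarith; positivity])
    have h5 : s ^ 5 ≤ (6 / 5) ^ 5 := by gcongr
    have h22 : s ^ 2 ≤ (6 / 5) ^ 2 := by gcongr
    have : (s ^ 2 + s + 1) * s ^ 2 ≤ ((6/5) ^ 2 + 6/5 + 1) * (6/5) ^ 2 := by gcongr
    have h7 : (7:ℝ) / 10 ≤ 1 - s ^ 5 / 10 := by norm_num at h5; linarith
    have : 6 * (1 + 1) * (7 / 10) ≤ 6 * (s + 1) * (1 - s ^ 5 / 10) := by gcongr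
    norm_num at *; linarith
  have e : - x / s ^ 5 - (1 / s ^ 3 + κ) / (2 * x) + 1 / 10 * x =
      - ((1 / s ^ 5 - 1 / 10) * (2 * x ^ 2) - (1 - 1 / s ^ 3) + (1 + κ)) / (2 * x) := by
    field_simp; ring
  have : - ((1 / s ^ 5 - 1 / 10) * (2 * x ^ 2) - (1 - 1 / s ^ 3) + (1 + κ)) / (2 * x) ≤ 0 := by
    apply div_nonpos_of_nonpos_of_nonneg <;> linarith
  linarith

lemma low_alg2 {x κ : ℝ} (hx0 : 0 < x) (hx1 : x ≤ 1) (hκ : κ < -1) :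
    x ^ 2 / 7 ≤ -(1 / sw x ^ 3 + κ) := by
  have h1 := sw_one_le x
  have hs := sw_sq x
  set s := sw x
  have h2 : s ≤ 6 / 5 := by nlinarith
  have hs0 : 0 < s := by linarith
  have h3 : x ^ 2 / 7 ≤ s - 1 := by nlinarith
  have h4 : s - 1 ≤ 1 - 1 / s ^ 3 := by
    have : 1 - 1 / s ^ 3 - (s - 1) = (s - 1) * (s ^ 2 + s + 1 - s ^ 3) / s ^ 3 := by
      field_simp; ring
    have : 0 ≤ (s - 1) * (s ^ 2 + s + 1 - s ^ 3) / s ^ 3 := by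
      apply div_nonneg _ (by positivity)
      apply mul_nonneg (by linarith)
      nlinarith
    linarith
  linarith

lemma low_H_deriv (τ κ : ℝ) {x : ℝ} (hx : 0 < x) :
    HasDerivAt (fun x => τ * (1 / sw x ^ 3 + κ) / √x)
      (τ * ((- x / sw x ^ 5 - (1 / sw x ^ 3 + κ) / (2 * x)) / √x)) x := by
  have := (dpsi_deriv τ κ x).div (Real.hasDerivAt_sqrt hx.ne') (Real.sqrt_pos.2 hx).ne'
  refine HasDerivAt.congr_deriv (f := fun x => τ * (1 / sw x ^ 3 + κ) / √x) this ?_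
  have h1 := Real.sqrt_pos.2 hx
  have h2 := sw_pos x
  have h3 := Real.sq_sqrt hx.le
  set r := √x
  rw [← h3]
  field_simp

lemma osc_low1 : ∃ C : ℝ, 0 ≤ C ∧ ∀ τ κ : ℝ, 0 < τ →
      ‖∫ x in (0:ℝ)..1, Complex.exp (Complex.I * ((τ * (phs x + κ * x) : ℝ) : ℂ)) * ((√x : ℝ) : ℂ)‖ ≤ C / √τ := by
  refine ⟨100, by norm_num, fun τ κ hτ => ?_⟩
  have hpc : Continuous (fun x => τ * (phs x + κ * x)) :=
    continuous_iff_continuousAt.2 fun x => (psi_deriv τ κ x).continuousAt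
  have hst := Real.sqrt_pos.2 hτ
  have triv : ∀ ρ : ℝ, 0 ≤ ρ → ‖∫ x in (0:ℝ)..ρ, Complex.exp (Complex.I * ((τ * (phs x + κ * x) : ℝ) : ℂ)) * ((√x : ℝ) : ℂ)‖ ≤ ρ * √ρ := by
    intro ρ hρ
    refine (osc_trivial (ψ := fun x => τ * (phs x + κ * x)) hρ (fun x _ => Real.sqrt_nonneg x)).trans ?_
    have : ∫ x in (0:ℝ)..ρ, √x ≤ ∫ x in (0:ℝ)..ρ, √ρ := by
      apply intervalIntegral.integral_mono_on hρ
      · exact Real.continuous_sqrt.intervalIntegrable _ _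
      · exact continuous_const.intervalIntegrable _ _
      · intro x hx; exact Real.sqrt_le_sqrt hx.2
    simpa using this
  by_cases h1 : τ ≤ 1
  · refine (triv 1 zero_le_one).trans ?_
    rw [le_div_iff₀ hst]
    have : √τ ≤ 1 := Real.sqrt_le_one.2 h1
    simp; linarith
  push Not at h1
  obtain ⟨ρ, hρ0, hρ1, hρ⟩ : ∃ ρ : ℝ, 0 < ρ ∧ ρ ≤ 1 ∧ ρ * √ρ = 1 / √τ := by
    refine ⟨τ ^ (-(1/3) : ℝ), by positivity, Real.rpow_le_one_of_one_le_of_nonpos h1.le (by norm_num), ?_⟩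
    rw [Real.sqrt_eq_rpow, Real.sqrt_eq_rpow, ← Real.rpow_mul hτ.le, ← Real.rpow_add hτ, one_div (τ ^ _),
      ← Real.rpow_neg hτ.le]
    norm_num
  have hcont : Continuous fun x : ℝ => Complex.exp (Complex.I * ((τ * (phs x + κ * x) : ℝ) : ℂ)) * ((√x : ℝ) : ℂ) := by
    have := phs_cont
    fun_prop
  rw [← intervalIntegral.integral_add_adjacent_intervals (hcont.intervalIntegrable 0 ρ) (hcont.intervalIntegrable ρ 1)]
  refine (norm_add_le _ _).trans ?_
  have t := triv ρ hρ0.le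
  rw [hρ] at t
  have hpos : ∀ x ∈ Set.Icc ρ 1, 0 < x := fun x hx => hρ0.trans_le hx.1
  have hψ : ∀ x ∈ Set.Icc ρ 1, HasDerivAt (fun x => τ * (phs x + κ * x))
      (τ * (1 / sw x ^ 3 + κ) / √x * √x) x := by
    intro x hx
    have := Real.sqrt_pos.2 (hpos x hx)
    rw [div_mul_cancel₀ _ this.ne']
    exact psi_deriv τ κ x
  have hH'c : ContinuousOn (fun x => τ * ((- x / sw x ^ 5 - (1 / sw x ^ 3 + κ) / (2 * x)) / √x)) (Set.Icc ρ 1) := by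
    have h5 : ∀ x, sw x ^ 5 ≠ 0 := fun x => pow_ne_zero 5 (sw_pos x).ne'
    have h3 : ∀ x, sw x ^ 3 ≠ 0 := fun x => pow_ne_zero 3 (sw_pos x).ne'
    have := sw_cont
    have h6 : ∀ x ∈ Set.Icc ρ 1, √x ≠ 0 := fun x hx => (Real.sqrt_pos.2 (hpos x hx)).ne'
    have h7 : ∀ x ∈ Set.Icc ρ 1, 2 * x ≠ 0 := fun x hx => by have := hpos x hx; positivity
    apply ContinuousOn.mul continuousOn_const
    apply ContinuousOn.div _ (Real.continuous_sqrt.continuousOn) h6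
    apply ContinuousOn.sub
    · fun_prop (disch := (intros; exact pow_ne_zero _ (sw_pos _).ne'))
    · apply ContinuousOn.div _ (by fun_prop) h7
      fun_prop (disch := (intros; exact pow_ne_zero _ (sw_pos _).ne'))
  rcases le_or_gt (-1) κ with hκ | hκ
  · have := vdc (l := τ * (1 / 10)) hρ1 (by positivity) hψ (fun x hx => low_H_deriv τ κ (hpos x hx))
      Real.continuous_sqrt.continuousOn hH'c (fun x _ => Real.sqrt_nonneg x) (by
        intro x hx
        have hx0 := hpos x hx
        have h := low_alg hx0 hx.2 hκ
        have hsx := Real.sqrt_pos.2 hx0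
        rw [mul_assoc, ← mul_neg]
        apply mul_le_mul_of_nonneg_left _ hτ.le
        rw [div_le_iff₀ hsx]
        have : 1 / 10 * √x * √x = 1/10 * x := by rw [mul_assoc, Real.mul_self_sqrt hx0.le]
        linarith)
    have h10 : 10 / √(τ * (1 / 10)) ≤ 99 / √τ := by
      rw [Real.sqrt_mul hτ.le, div_le_div_iff₀ (by positivity) hst]
      have : (1/9 : ℝ) ≤ √(1/10) := Real.le_sqrt_of_sq_le (by norm_num)
      nlinarith
    have : (100:ℝ) / √τ = 1 / √τ + 99 / √τ := by ring
    linarith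
  · have hg : ∀ x ∈ Set.Icc ρ 1, x ^ 2 / 7 ≤ -(1 / sw x ^ 3 + κ) := fun x hx =>
      low_alg2 (hpos x hx) hx.2 hκ
    have hg0 : ∀ x ∈ Set.Icc ρ 1, 0 < -(1 / sw x ^ 3 + κ) := fun x hx => by
      have := hg x hx; have := hpos x hx; have : 0 < x ^ 2 / 7 := by positivity
      linarith
    have := osc_ibp hρ1 hψ (fun x hx => low_H_deriv τ κ (hpos x hx))
      Real.continuous_sqrt.continuousOn hH'c (by
        intro x hx
        have := hg0 x hx
        have := Real.sqrt_pos.2 (hpos x hx)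
        apply div_ne_zero _ this.ne'
        apply mul_ne_zero hτ.ne'
        linarith)
    have hHinv : ∀ x ∈ Set.Icc ρ 1, 1 / |τ * (1 / sw x ^ 3 + κ) / √x| ≤ 7 / √τ := by
      intro x hx
      have hx0 := hpos x hx
      have hsx := Real.sqrt_pos.2 hx0
      have h0 := hg0 x hx
      have : |τ * (1 / sw x ^ 3 + κ) / √x| = τ * -(1 / sw x ^ 3 + κ) / √x := by
        rw [abs_div, abs_mul, abs_of_pos hτ, abs_of_pos hsx, abs_of_neg (by linarith)]
      rw [this]
      have h2 : √τ / 7 ≤ τ * -(1 / sw x ^ 3 + κ) / √x := by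
        rw [le_div_iff₀ hsx]
        have h3 : x ^ 2 / 7 * τ ≤ -(1 / sw x ^ 3 + κ) * τ := mul_le_mul_of_nonneg_right (hg x hx) hτ.le
        have h4 : 1 / √τ ≤ x * √x := by
          rw [← hρ]; exact mul_le_mul hx.1 (Real.sqrt_le_sqrt hx.1) (Real.sqrt_nonneg _) hx0.le
        rw [div_le_iff₀ hst] at h4
        have h5 := Real.mul_self_sqrt hτ.le
        have h6 := Real.mul_self_sqrt hx0.le
        have : √τ * √x ≤ x ^ 2 * τ := by
          calc √τ * √x = √τ * √x * 1 := by ring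
            _ ≤ √τ * √x * (x * √x * √τ) := by gcongr
            _ = x * (√x * √x) * (√τ * √τ) := by ring
            _ = x ^ 2 * τ := by rw [h5, h6]; ring
        linarith
      calc _ ≤ 1 / (√τ / 7) := one_div_le_one_div_of_le (by positivity) h2
        _ = _ := by field_simp
    have hI : ∫ x in ρ..1, |τ * ((- x / sw x ^ 5 - (1 / sw x ^ 3 + κ) / (2 * x)) / √x)| /
        (τ * (1 / sw x ^ 3 + κ) / √x) ^ 2 ≤ 40 / √τ := by
      have e : ∀ x ∈ Set.uIcc ρ 1, HasDerivAt (fun x => -(40 / τ) * (1 / (x * √x))) ((60 / τ) * (1 / (x ^ 2 * √x))) x := by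
        intro x hx
        rw [Set.uIcc_of_le hρ1] at hx
        have hx0 := hpos x hx
        have hsx := Real.sqrt_pos.2 hx0
        have := (((hasDerivAt_id x).mul (Real.hasDerivAt_sqrt hx0.ne')).inv (by simp; constructor <;> positivity)).const_mul (-(40 / τ))
        simp only [one_div]
        refine HasDerivAt.congr_deriv (f := fun x => -(40 / τ) * ((x * √x)⁻¹)) this ?_
        have h3 := Real.sq_sqrt hx0.le
        simp only [Pi.mul_apply, id]
        set r := √x
        rw [← h3]
        field_simp; ring
      have hci : ContinuousOn (fun x : ℝ => (60 / τ) * (1 / (x ^ 2 * √x))) (Set.uIcc ρ 1) := by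
        rw [Set.uIcc_of_le hρ1]
        apply ContinuousOn.mul continuousOn_const
        apply ContinuousOn.div continuousOn_const
        · have := Real.continuous_sqrt; fun_prop
        · intro x hx; have hx0 := hpos x hx
          have hsx := Real.sqrt_pos.2 hx0; positivity
      have hle : ∫ x in ρ..1, |τ * ((- x / sw x ^ 5 - (1 / sw x ^ 3 + κ) / (2 * x)) / √x)| /
        (τ * (1 / sw x ^ 3 + κ) / √x) ^ 2 ≤ ∫ x in ρ..1, (60 / τ) * (1 / (x ^ 2 * √x)) := by
        apply intervalIntegral.integral_mono_on hρ1 _ hci.intervalIntegrable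
        · intro x hx
          have hx0 := hpos x hx
          have hsx := Real.sqrt_pos.2 hx0
          have h0 := hg0 x hx
          have h1 := hg x hx
          have hs1 := sw_one_le x
          obtain ⟨g, hgdef⟩ : ∃ g, g = -(1 / sw x ^ 3 + κ) := ⟨_, rfl⟩
          have e1 : 1 / sw x ^ 3 + κ = - g := by rw [hgdef]; ring
          rw [e1]
          rw [← hgdef] at h0 h1
          have b1 : |τ * ((-x / sw x ^ 5 - -g / (2 * x)) / √x)| ≤ τ * ((x + g / (2 * x)) / √x) := by
            rw [abs_mul, abs_of_pos hτ, abs_div, abs_of_pos hsx]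
            gcongr
            have : 0 < g / (2 * x) := by positivity
            have h5 : x / sw x ^ 5 ≤ x := div_le_self hx0.le (one_le_pow₀ hs1)
            have h6 : 0 < x / sw x ^ 5 := by have := sw_pos x; positivity
            rw [abs_le]
            have hg2 : -g / (2 * x) = - (g / (2 * x)) := neg_div _ _
            have hx2 : -x / sw x ^ 5 = - (x / sw x ^ 5) := neg_div _ _
            rw [hg2, hx2]
            constructor <;> linarith
          calc _ ≤ τ * ((x + g / (2 * x)) / √x) / (τ * -g / √x) ^ 2 := by gcongr
            _ = (1 / τ) * (√x * (x / g ^ 2 + 1 / (2 * x * g))) := by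
              field_simp
            _ ≤ (1 / τ) * (√x * (x / (x ^ 2 / 7) ^ 2 + 1 / (2 * x * (x ^ 2 / 7)))) := by gcongr
            _ = (1 / τ) * (√x * √x * (105 / 2) / (x ^ 3 * √x)) := by field_simp; ring
            _ = (1 / τ) * (x * (105 / 2) / (x ^ 3 * √x)) := by rw [Real.mul_self_sqrt hx0.le]
            _ ≤ (1 / τ) * (x * 60 / (x ^ 3 * √x)) := by gcongr; norm_num
            _ = _ := by field_simp
        · apply ContinuousOn.intervalIntegrable
          rw [Set.uIcc_of_le hρ1]
          apply ContinuousOn.div hH'c.abs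
          · have : ContinuousOn (fun x => τ * (1 / sw x ^ 3 + κ) / √x) (Set.Icc ρ 1) :=
              fun x hx => (low_H_deriv τ κ (hpos x hx)).continuousAt.continuousWithinAt
            exact this.pow 2
          · intro x hx
            have := hg0 x hx
            have h := Real.sqrt_pos.2 (hpos x hx)
            apply pow_ne_zero
            apply div_ne_zero _ h.ne'
            apply mul_ne_zero hτ.ne'
            linarith
      rw [intervalIntegral.integral_eq_sub_of_hasDerivAt e hci.intervalIntegrable, hρ] at hle
      refine hle.trans ?_
      have h5 := Real.mul_self_sqrt hτ.le
      have : 40 / τ * √τ = 40 / √τ := by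
        rw [div_mul_eq_mul_div, div_eq_div_iff hτ.ne' hst.ne', mul_assoc, h5]
      simp
      have : 0 < 40 / τ := by positivity
      linarith
    have i1 := hHinv ρ ⟨le_rfl, hρ1⟩
    have i2 := hHinv 1 ⟨hρ1, le_rfl⟩
    have e : (100:ℝ) / √τ = 1 / √τ + (7 / √τ + 7 / √τ + 40 / √τ) + 45 / √τ := by ring
    have : 0 < 45 / √τ := by positivity
    linarith

lemma sw_le {x : ℝ} (hx : 3 ≤ x) : sw x ≤ x := by
  have := sw_sq x; have := sw_pos x
  nlinarith

lemma high_H_deriv (τ κ x : ℝ) :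
    HasDerivAt (fun x => τ * (1 / sw x ^ 3 + κ) * x ^ 2)
      (τ * (- x ^ 3 / sw x ^ 5 + 2 * x * (1 / sw x ^ 3 + κ))) x := by
  have := (dpsi_deriv τ κ x).mul (hasDerivAt_pow 2 x)
  refine HasDerivAt.congr_deriv (f := fun x => τ * (1 / sw x ^ 3 + κ) * x ^ 2) this ?_
  push_cast
  ring

lemma hasDerivAt_neg_inv {x : ℝ} (hx : 0 < x) : HasDerivAt (fun x : ℝ => -(1 / x)) (1 / x ^ 2) x := by
  have := (hasDerivAt_inv hx.ne').neg
  simp only [one_div]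
  refine HasDerivAt.congr_deriv (f := fun x => -x⁻¹) this ?_
  simp

lemma cont_inv_sq {a b : ℝ} (ha : 0 < a) : ContinuousOn (fun x : ℝ => 1 / x ^ 2) (Set.Icc a b) := by
  apply ContinuousOn.div continuousOn_const (by fun_prop)
  intro x hx; have := ha.trans_le hx.1; positivity

lemma integral_inv_sq {a b : ℝ} (ha : 0 < a) (hab : a ≤ b) :
    ∫ x in a..b, 1 / x ^ 2 = 1 / a - 1 / b := by
  rw [intervalIntegral.integral_eq_sub_of_hasDerivAt (f := fun x : ℝ => -(1 / x))]
  · ring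
  · intro x hx; rw [Set.uIcc_of_le hab] at hx; exact hasDerivAt_neg_inv (ha.trans_le hx.1)
  · apply ContinuousOn.intervalIntegrable
    rw [Set.uIcc_of_le hab]
    exact cont_inv_sq ha

lemma osc_high3 {τ κ N : ℝ} (hτ : 0 < τ) (hN : 3 ≤ N) (hNτ : N ≤ √τ) :
    ‖∫ x in (3:ℝ)..N, Complex.exp (Complex.I * ((τ * (phs x + κ * x) : ℝ) : ℂ)) * ((1 / x ^ 2 : ℝ) : ℂ)‖ ≤ 30 / √τ := by
  have hst := Real.sqrt_pos.2 hτ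
  have hpos : ∀ x ∈ Set.Icc 3 N, 0 < x := fun x hx => by linarith [hx.1]
  have hψ : ∀ x ∈ Set.Icc 3 N, HasDerivAt (fun x => τ * (phs x + κ * x))
      (τ * (1 / sw x ^ 3 + κ) * x ^ 2 * (1 / x ^ 2)) x := by
    intro x hx
    have := hpos x hx
    have e : τ * (1 / sw x ^ 3 + κ) * x ^ 2 * (1 / x ^ 2) = τ * (1 / sw x ^ 3 + κ) := by field_simp
    rw [e]
    exact psi_deriv τ κ x
  have hH'c : ContinuousOn (fun x => τ * (- x ^ 3 / sw x ^ 5 + 2 * x * (1 / sw x ^ 3 + κ))) (Set.Icc 3 N) := by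
    fun_prop (disch := (intros; exact pow_ne_zero _ (sw_pos _).ne'))
  rcases le_or_gt κ 0 with hκ | hκ
  · have := vdc (l := τ * (1 / 9)) hN (by positivity) hψ (fun x _ => high_H_deriv τ κ x)
      (cont_inv_sq (by norm_num)) hH'c (fun x _ => by positivity) (by
        intro x hx
        have hx0 := hpos x hx
        have hs0 := sw_pos x
        have hs1 := sw_le hx.1
        have hs := sw_sq x
        rw [mul_assoc τ (1 / 9), ← mul_neg]
        apply mul_le_mul_of_nonneg_left _ hτ.le
        have h1 : - x ^ 3 / sw x ^ 5 + 2 * x * (1 / sw x ^ 3 + κ) ≤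
            - x ^ 3 / sw x ^ 5 + 2 * x * (1 / sw x ^ 3 + 0) := by gcongr
        have h2 : - x ^ 3 / sw x ^ 5 + 2 * x * (1 / sw x ^ 3 + 0) = x * (2 * sw x ^ 2 - x ^ 2) / sw x ^ 5 := by
          field_simp; ring
        have h3 : x * (2 * sw x ^ 2 - x ^ 2) / sw x ^ 5 ≤ x * (- (x ^ 2 / 9)) / sw x ^ 5 := by
          gcongr
          rw [hs]; nlinarith [hx.1]
        have h4 : x * (- (x ^ 2 / 9)) / sw x ^ 5 = - (x ^ 3 / 9 / sw x ^ 5) := by ring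
        have h5 : x ^ 3 / 9 / x ^ 5 ≤ x ^ 3 / 9 / sw x ^ 5 := by gcongr
        have h6 : x ^ 3 / 9 / x ^ 5 = 1 / 9 * (1 / x ^ 2) := by field_simp
        linarith)
    refine this.trans (le_of_eq ?_)
    have : √(1/9 : ℝ) = 1 / 3 := by
      rw [show (1/9 : ℝ) = (1/3) ^ 2 by norm_num]; exact Real.sqrt_sq (by norm_num)
    rw [Real.sqrt_mul hτ.le, this]
    field_simp; norm_num
  · have hg : ∀ x ∈ Set.Icc 3 N, 1 / sw x ^ 3 ≤ 1 / sw x ^ 3 + κ := fun x hx => by linarith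
    have hg0 : ∀ x ∈ Set.Icc 3 N, 0 < 1 / sw x ^ 3 + κ := fun x hx => by
      have := sw_pos x; positivity
    have hne : ∀ x ∈ Set.Icc 3 N, τ * (1 / sw x ^ 3 + κ) * x ^ 2 ≠ 0 := by
      intro x hx
      have := hg0 x hx
      have := hpos x hx
      positivity
    have := osc_ibp hN hψ (fun x _ => high_H_deriv τ κ x)
      (cont_inv_sq (by norm_num)) hH'c hne
    have hHinv : ∀ x ∈ Set.Icc 3 N, 1 / |τ * (1 / sw x ^ 3 + κ) * x ^ 2| ≤ 1 / √τ := by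
      intro x hx
      have hx0 := hpos x hx
      have h0 := hg0 x hx
      have hs0 := sw_pos x
      rw [abs_of_pos (by positivity)]
      apply one_div_le_one_div_of_le hst
      have h1 : τ * (1 / x ^ 3) * x ^ 2 ≤ τ * (1 / sw x ^ 3 + κ) * x ^ 2 := by
        gcongr
        refine le_trans ?_ (hg x hx)
        have := sw_le hx.1
        gcongr
      refine le_trans ?_ h1
      have : τ * (1 / x ^ 3) * x ^ 2 = τ / x := by field_simp
      rw [this, le_div_iff₀ hx0]
      have : x ≤ √τ := hx.2.trans hNτ
      nlinarith [Real.mul_self_sqrt hτ.le]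
    have hI : ∫ x in (3:ℝ)..N, |τ * (- x ^ 3 / sw x ^ 5 + 2 * x * (1 / sw x ^ 3 + κ))| /
        (τ * (1 / sw x ^ 3 + κ) * x ^ 2) ^ 2 ≤ 3 / √τ := by
      have hle : ∫ x in (3:ℝ)..N, |τ * (- x ^ 3 / sw x ^ 5 + 2 * x * (1 / sw x ^ 3 + κ))| /
        (τ * (1 / sw x ^ 3 + κ) * x ^ 2) ^ 2 ≤ ∫ x in (3:ℝ)..N, 3 / τ := by
        apply intervalIntegral.integral_mono_on hN _ (continuous_const.intervalIntegrable _ _)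
        · intro x hx
          have hx0 := hpos x hx
          have h0 := hg0 x hx
          have h1 := hg x hx
          have hs0 := sw_pos x
          have hsx := sw_le hx.1
          obtain ⟨g, hgdef⟩ : ∃ g, g = (1 / sw x ^ 3 + κ) := ⟨_, rfl⟩
          rw [← hgdef] at h0 h1 ⊢
          obtain ⟨s, hsdef⟩ : ∃ s, s = sw x := ⟨_, rfl⟩
          rw [← hsdef] at h1 hs0 hsx ⊢
          have b1 : |τ * (- x ^ 3 / s ^ 5 + 2 * x * g)| ≤ τ * (x ^ 3 / s ^ 5 + 2 * x * g) := by
            rw [abs_mul, abs_of_pos hτ]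
            gcongr
            have e1 : 0 < x ^ 3 / s ^ 5 := by positivity
            have e2 : 0 < 2 * x * g := by positivity
            rw [neg_div, abs_le]
            constructor <;> linarith
          calc _ ≤ τ * (x ^ 3 / s ^ 5 + 2 * x * g) / (τ * g * x ^ 2) ^ 2 := by gcongr
            _ = (1 / τ) * (1 / (x * s ^ 5 * g ^ 2) + 2 / (x ^ 3 * g)) := by field_simp
            _ ≤ (1 / τ) * (1 / (x * s ^ 5 * (1 / s ^ 3) ^ 2) + 2 / (x ^ 3 * (1 / s ^ 3))) := by gcongr
            _ = (1 / τ) * (s / x + 2 * (s / x) ^ 3) := by field_simp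
            _ ≤ (1 / τ) * (1 + 2 * 1 ^ 3) := by
              have : s / x ≤ 1 := (div_le_one hx0).2 hsx
              gcongr
            _ = _ := by ring
        · apply ContinuousOn.intervalIntegrable
          rw [Set.uIcc_of_le hN]
          apply ContinuousOn.div hH'c.abs
          · have : ContinuousOn (fun x => τ * (1 / sw x ^ 3 + κ) * x ^ 2) (Set.Icc 3 N) :=
              fun x hx => (high_H_deriv τ κ x).continuousAt.continuousWithinAt
            exact this.pow 2
          · intro x hx
            exact pow_ne_zero 2 (hne x hx)
      refine hle.trans ?_
      simp only [intervalIntegral.integral_const, smul_eq_mul]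
      calc (N - 3) * (3 / τ) ≤ √τ * (3 / τ) := by gcongr; linarith
        _ = 3 / √τ := by
          rw [mul_div_assoc', div_eq_div_iff hτ.ne' hst.ne']
          nlinarith [Real.mul_self_sqrt hτ.le]
    have i1 := hHinv 3 ⟨le_rfl, hN⟩
    have i2 := hHinv N ⟨hN, le_rfl⟩
    have e : (30:ℝ) / √τ = (1 / √τ + 1 / √τ + 3 / √τ) + 25 / √τ := by ring
    have : 0 < 25 / √τ := by positivity
    linarith

lemma osc_high_fin {c : ℝ} (hc : 0 < c) (hc1 : c ≤ 3) : ∃ C : ℝ, 0 ≤ C ∧ ∀ τ κ M : ℝ, 0 < τ → 3 ≤ M →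
      ‖∫ x in c..M, Complex.exp (Complex.I * ((τ * (phs x + κ * x) : ℝ) : ℂ)) * ((1 / x ^ 2 : ℝ) : ℂ)‖ ≤ C / √τ := by
  obtain ⟨C, hC, h⟩ := osc_mid (W := fun x => 1 / x ^ 2) (W' := fun x => -2 / x ^ 3) hc hc1 (by
    intro x hx
    have hx0 := hc.trans_le hx.1
    have := (hasDerivAt_pow 2 x).inv (by positivity)
    simp only [one_div]
    refine HasDerivAt.congr_deriv (f := fun x => (x^2)⁻¹) this ?_
    push_cast; field_simp) (by
    apply ContinuousOn.div continuousOn_const (by fun_prop)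
    intro x hx; have := hc.trans_le hx.1; positivity)
  refine ⟨C + 31, by linarith, fun τ κ M hτ hM => ?_⟩
  have hst := Real.sqrt_pos.2 hτ
  have hintg : ∀ p q : ℝ, 0 < p → p ≤ q →
      IntervalIntegrable (fun x : ℝ => Complex.exp (Complex.I * ((τ * (phs x + κ * x) : ℝ) : ℂ)) * ((1 / x ^ 2 : ℝ) : ℂ)) volume p q := by
    intro p q hp hpq
    apply ContinuousOn.intervalIntegrable
    rw [Set.uIcc_of_le hpq]
    apply ContinuousOn.mul
    · have := phs_cont
      fun_prop
    · exact Complex.continuous_ofReal.comp_continuousOn (cont_inv_sq hp)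
  have hm := h τ κ hτ
  have htr : ∀ p q : ℝ, 0 < p → p ≤ q →
      ‖∫ x in p..q, Complex.exp (Complex.I * ((τ * (phs x + κ * x) : ℝ) : ℂ)) * ((1 / x ^ 2 : ℝ) : ℂ)‖ ≤ 1 / p := by
    intro p q hp hpq
    refine (osc_trivial (ψ := fun x => τ * (phs x + κ * x)) hpq (fun x _ => by positivity)).trans ?_
    rw [integral_inv_sq hp hpq]
    have : 0 < 1 / q := by have := hp.trans_le hpq; positivity
    linarith
  have hb : ‖∫ x in (3:ℝ)..M, Complex.exp (Complex.I * ((τ * (phs x + κ * x) : ℝ) : ℂ)) * ((1 / x ^ 2 : ℝ) : ℂ)‖ ≤ 31 / √τ := by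
    have h31 : (31 : ℝ) / √τ = 30 / √τ + 1 / √τ := by ring
    have h30 : 0 < 30 / √τ := by positivity
    have h1 : 0 < 1 / √τ := by positivity
    rcases le_or_gt 3 (√τ) with h3 | h3
    · rcases le_or_gt M (√τ) with h4 | h4
      · have := osc_high3 (κ := κ) hτ hM h4
        linarith
      · rw [← intervalIntegral.integral_add_adjacent_intervals (hintg 3 (√τ) (by norm_num) h3)
          (hintg (√τ) M hst h4.le)]
        refine (norm_add_le _ _).trans ?_
        have := osc_high3 (κ := κ) hτ h3 le_rfl
        have := htr (√τ) M hst h4.le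
        linarith
    · have e1 := htr 3 M (by norm_num) hM
      have : 1 / 3 ≤ 1 / √τ := one_div_le_one_div_of_le hst h3.le
      linarith
  rw [← intervalIntegral.integral_add_adjacent_intervals (hintg c 3 hc hc1) (hintg 3 M (by norm_num) hM)]
  refine (norm_add_le _ _).trans ?_
  rw [add_div]
  exact add_le_add hm hb

lemma integrableOn_inv_sq {c : ℝ} (hc : 0 < c) : IntegrableOn (fun x : ℝ => 1 / x ^ 2) (Set.Ioi c) := by
  have := integrableOn_Ioi_rpow_of_lt (a := -2) (by norm_num) hc
  refine this.congr_fun (fun x hx => ?_) measurableSet_Ioi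
  have : (0:ℝ) < x := hc.trans hx
  simp only [Real.rpow_neg this.le, one_div, Real.rpow_two]

lemma osc_high {c : ℝ} (hc : 0 < c) (hc1 : c ≤ 3) : ∃ C : ℝ, 0 ≤ C ∧ ∀ τ κ : ℝ, 0 < τ →
      ‖∫ x in Set.Ioi c, Complex.exp (Complex.I * ((τ * (phs x + κ * x) : ℝ) : ℂ)) * ((1 / x ^ 2 : ℝ) : ℂ)‖ ≤ C / √τ := by
  obtain ⟨C, hC, h⟩ := osc_high_fin hc hc1
  refine ⟨C, hC, fun τ κ hτ => ?_⟩
  have hi : IntegrableOn (fun x : ℝ => Complex.exp (Complex.I * ((τ * (phs x + κ * x) : ℝ) : ℂ)) * ((1 / x ^ 2 : ℝ) : ℂ)) (Set.Ioi c) := by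
    apply Integrable.bdd_mul (c := 1) (integrableOn_inv_sq hc).ofReal
    · have := phs_cont
      apply Continuous.aestronglyMeasurable
      fun_prop
    · refine Filter.Eventually.of_forall fun x => ?_
      rw [mul_comm]; exact (Complex.norm_exp_ofReal_mul_I _).le
  have ht := intervalIntegral_tendsto_integral_Ioi c hi Filter.tendsto_id
  refine le_of_tendsto ht.norm ?_
  filter_upwards [Filter.eventually_ge_atTop 3] with M hM
  exact h τ κ M hτ hM

lemma osc_low {b : ℝ} (hb : 1 ≤ b) : ∃ C : ℝ, 0 ≤ C ∧ ∀ τ κ : ℝ, 0 < τ →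
      ‖∫ x in (0:ℝ)..b, Complex.exp (Complex.I * ((τ * (phs x + κ * x) : ℝ) : ℂ)) * ((√x : ℝ) : ℂ)‖ ≤ C / √τ := by
  obtain ⟨C1, hC1, h1⟩ := osc_low1
  obtain ⟨C2, hC2, h2⟩ := osc_mid (W := fun x => √x) (W' := fun x => 1 / (2 * √x)) zero_lt_one hb (by
    intro x hx
    exact Real.hasDerivAt_sqrt (by linarith [hx.1] : 0 < x).ne') (by
    apply ContinuousOn.div continuousOn_const (by have := Real.continuous_sqrt; fun_prop)
    intro x hx; have := Real.sqrt_pos.2 (by linarith [hx.1] : 0 < x); positivity)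
  refine ⟨C1 + C2, by linarith, fun τ κ hτ => ?_⟩
  have hcont : Continuous fun x : ℝ => Complex.exp (Complex.I * ((τ * (phs x + κ * x) : ℝ) : ℂ)) * ((√x : ℝ) : ℂ) := by
    have := phs_cont
    fun_prop
  rw [← intervalIntegral.integral_add_adjacent_intervals (hcont.intervalIntegrable 0 1) (hcont.intervalIntegrable 1 b)]
  refine (norm_add_le _ _).trans ?_
  rw [add_div]
  exact add_le_add (h1 τ κ hτ) (h2 τ κ hτ)

lemma phs_neg (x : ℝ) : phs (-x) = - phs x := by
  unfold phs sw; simp [neg_div]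

lemma half_kernel {S : Set ℝ} {w : ℝ → ℝ} {C : ℝ}
    (hJ : ∀ τ κ : ℝ, 0 < τ →
      ‖∫ x in S, Complex.exp (Complex.I * ((τ * (phs x + κ * x) : ℝ) : ℂ)) * (w x : ℂ)‖ ≤ C / √τ)
    (τ y : ℝ) (hτ : τ ≠ 0) :
    ‖∫ x in S, Complex.exp (Complex.I * ((τ * phs x + y * x : ℝ) : ℂ)) * (w x : ℂ)‖ ≤ C / √|τ| := by
  rcases lt_or_gt_of_ne hτ with h | h
  · have := hJ (-τ) (y / τ) (by linarith)
    rw [abs_of_neg h]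
    refine le_trans (le_of_eq ?_) this
    rw [← RCLike.norm_conj, ← integral_conj]
    congr 1
    apply integral_congr_ae
    refine Filter.Eventually.of_forall fun x => ?_
    simp only [map_mul, ← Complex.exp_conj, Complex.conj_I, Complex.conj_ofReal]
    congr 2
    have : -τ * (phs x + y / τ * x) = - (τ * phs x + y * x) := by field_simp
    rw [this]
    push_cast; ring
  · have := hJ τ (y / τ) h
    rw [abs_of_pos h]
    refine le_trans (le_of_eq ?_) this
    congr 1
    apply integral_congr_ae
    refine Filter.Eventually.of_forall fun x => ?_
    simp only []
    have : τ * (phs x + y / τ * x) = (τ * phs x + y * x) := by field_simp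
    rw [this]

lemma exp_bdd_integrable {g : ℝ → ℂ} {r : ℝ → ℝ} (hr : Continuous r) (hg : Integrable g) :
    Integrable (fun x => Complex.exp (Complex.I * (r x : ℂ)) * g x) := by
  apply Integrable.bdd_mul (c := 1) hg
  · apply Continuous.aestronglyMeasurable
    fun_prop
  · refine Filter.Eventually.of_forall fun x => ?_
    rw [mul_comm]; exact (Complex.norm_exp_ofReal_mul_I _).le

lemma full_kernel {S : Set ℝ} (hS : MeasurableSet S) {w : ℝ → ℝ} {C : ℝ} (hw : IntegrableOn w S)
    (hJ : ∀ τ κ : ℝ, 0 < τ →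
      ‖∫ x in S, Complex.exp (Complex.I * ((τ * (phs x + κ * x) : ℝ) : ℂ)) * (w x : ℂ)‖ ≤ C / √τ)
    (α β : ℝ) (hα : |α| ≤ 1) (hβ : |β| ≤ 1)
    (τ y : ℝ) (hτ : τ ≠ 0) :
    ‖∫ x, Complex.exp (Complex.I * ((τ * phs x + y * x : ℝ) : ℂ)) *
      ((α * S.indicator w x + β * S.indicator w (-x) : ℝ) : ℂ)‖ ≤ 2 * C / √|τ| := by
  have hwi : Integrable (S.indicator w) := (integrable_indicator_iff hS).2 hw
  have hc : ∀ τ y : ℝ, Continuous (fun x => τ * phs x + y * x) := by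
    intro τ y; have := phs_cont; fun_prop
  have e1 : ∀ τ y : ℝ, ∫ x, Complex.exp (Complex.I * ((τ * phs x + y * x : ℝ) : ℂ)) * ((S.indicator w x : ℝ) : ℂ) =
      ∫ x in S, Complex.exp (Complex.I * ((τ * phs x + y * x : ℝ) : ℂ)) * (w x : ℂ) := by
    intro τ y
    rw [← integral_indicator hS]
    congr 1; ext x
    by_cases hx : x ∈ S <;> simp [hx]
  have i1 : ∀ τ y : ℝ, Integrable (fun x => Complex.exp (Complex.I * ((τ * phs x + y * x : ℝ) : ℂ)) * ((S.indicator w x : ℝ) : ℂ)) :=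
    fun τ y => exp_bdd_integrable (hc τ y) hwi.ofReal
  have e2 : ∀ x, Complex.exp (Complex.I * ((τ * phs x + y * x : ℝ) : ℂ)) *
      ((α * S.indicator w x + β * S.indicator w (-x) : ℝ) : ℂ) =
      α * (Complex.exp (Complex.I * ((τ * phs x + y * x : ℝ) : ℂ)) * ((S.indicator w x : ℝ) : ℂ)) +
      β * (Complex.exp (Complex.I * (((-τ) * phs (-x) + (-y) * (-x) : ℝ) : ℂ)) * ((S.indicator w (-x) : ℝ) : ℂ)) := by
    intro x
    rw [phs_neg]
    have : (-τ) * - phs x + (-y) * (-x) = τ * phs x + y * x := by ring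
    rw [this]
    push_cast; ring
  simp_rw [e2]
  rw [integral_add ((i1 τ y).const_mul _) (((i1 (-τ) (-y)).comp_neg).const_mul _),
    integral_const_mul, integral_const_mul,
    integral_neg_eq_self (fun x => Complex.exp (Complex.I * (((-τ) * phs x + (-y) * x : ℝ) : ℂ)) * ((S.indicator w x : ℝ) : ℂ)) volume,
    e1, e1]
  have k1 := half_kernel hJ τ y hτ
  have k2 := half_kernel hJ (-τ) (-y) (neg_ne_zero.2 hτ)
  rw [abs_neg] at k2
  refine (norm_add_le _ _).trans ?_
  rw [norm_mul, norm_mul, Complex.norm_real, Complex.norm_real, Real.norm_eq_abs, Real.norm_eq_abs]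
  have : 2 * C / √|τ| = 1 * (C / √|τ|) + 1 * (C / √|τ|) := by ring
  rw [this]
  gcongr

/-- rescaling -/
lemma scaled_kernel {a : ℝ → ℝ} {C : ℝ}
    (h : ∀ τ y : ℝ, τ ≠ 0 → ‖∫ x, Complex.exp (Complex.I * ((τ * phs x + y * x : ℝ) : ℂ)) *
      ((a x : ℝ) : ℂ)‖ ≤ C / √|τ|) {μ : ℝ} (hμ : 0 < μ) (θ y : ℝ) (hθ : θ ≠ 0) :
    ‖∫ ξ : ℝ, Complex.exp (Complex.I * ((θ * (ξ / √(1 + μ * ξ ^ 2 / 3)) + y * ξ : ℝ) : ℂ)) *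
      ((a (√μ * ξ) : ℝ) : ℂ)‖ ≤ C / (√√μ * √|θ|) := by
  have hsm := Real.sqrt_pos.2 hμ
  have hssm := Real.sqrt_pos.2 hsm
  have e : ∀ ξ : ℝ, Complex.exp (Complex.I * ((θ * (ξ / √(1 + μ * ξ ^ 2 / 3)) + y * ξ : ℝ) : ℂ)) *
      ((a (√μ * ξ) : ℝ) : ℂ) = (fun x => Complex.exp (Complex.I * (((θ / √μ) * phs x + (y / √μ) * x : ℝ) : ℂ)) *
      ((a x : ℝ) : ℂ)) (√μ * ξ) := by
    intro ξ
    simp only []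
    have h1 : sw (√μ * ξ) = √(1 + μ * ξ ^ 2 / 3) := by
      unfold sw; rw [mul_pow, Real.sq_sqrt hμ.le]
    have : (θ / √μ) * phs (√μ * ξ) + (y / √μ) * (√μ * ξ) = θ * (ξ / √(1 + μ * ξ ^ 2 / 3)) + y * ξ := by
      unfold phs; rw [h1]; field_simp
    rw [this]
  rw [integral_congr_ae (Filter.Eventually.of_forall e), Measure.integral_comp_mul_left (fun x => Complex.exp (Complex.I * (((θ / √μ) * phs x + (y / √μ) * x : ℝ) : ℂ)) *
      ((a x : ℝ) : ℂ)) (√μ), norm_smul]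
  have k := h (θ / √μ) (y / √μ) (div_ne_zero hθ hsm.ne')
  rw [Real.norm_eq_abs, abs_abs, abs_of_pos (inv_pos.2 hsm)]
  calc _ ≤ (√μ)⁻¹ * (C / √|θ / √μ|) := by gcongr
    _ = _ := by
      rw [abs_div, abs_of_pos hsm, Real.sqrt_div (abs_nonneg _)]
      have h1 : √μ = √√μ * √√μ := (Real.mul_self_sqrt hsm.le).symm
      have := Real.sqrt_pos.2 (abs_pos.2 hθ)
      rw [h1]
      have h2 : √(√√μ * √√μ) = √√μ := by rw [← h1]
      rw [h2]
      field_simp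

noncomputable def aL (b μ ξ : ℝ) : ℝ := if √μ * |ξ| ≤ b then √|ξ| else 0
noncomputable def aH (c μ ξ : ℝ) : ℝ := if c < √μ * |ξ| then 1 / (√μ * |ξ|) ^ 2 else 0

lemma ite_indicator_L (b x : ℝ) (α : ℝ) :
    (if |x| ≤ b then √|x| else 0) * (if 0 < x then 1 else α) =
    1 * (Set.Ioc 0 b).indicator (fun x => √x) x + α * (Set.Ioc 0 b).indicator (fun x => √x) (-x) := by
  rcases lt_trichotomy x 0 with h | h | h
  · have h1 : x ∉ Set.Ioc 0 b := fun hx => by linarith [hx.1]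
    rw [Set.indicator_of_notMem h1, abs_of_neg h, if_neg h.not_gt]
    by_cases hb : -x ≤ b
    · rw [if_pos hb, Set.indicator_of_mem (Set.mem_Ioc.2 ⟨by linarith, hb⟩)]; ring
    · rw [if_neg hb, Set.indicator_of_notMem (fun hx => hb hx.2)]; ring
  · subst h; simp
  · have h1 : -x ∉ Set.Ioc 0 b := fun hx => by linarith [hx.1]
    rw [Set.indicator_of_notMem h1, abs_of_pos h, if_pos h]
    by_cases hb : x ≤ b
    · rw [if_pos hb, Set.indicator_of_mem (Set.mem_Ioc.2 ⟨by linarith, hb⟩)]; ring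
    · rw [if_neg hb, Set.indicator_of_notMem (fun hx => hb hx.2)]; ring

lemma ite_indicator_H (c x : ℝ) (hc : 0 < c) :
    (if c < |x| then 1 / |x| ^ 2 else 0) =
    1 * (Set.Ioi c).indicator (fun x => 1 / x ^ 2) x + 1 * (Set.Ioi c).indicator (fun x => 1 / x ^ 2) (-x) := by
  rcases le_or_gt 0 x with h | h
  · have h1 : -x ∉ Set.Ioi c := fun hx => by have : c < -x := hx; linarith
    rw [Set.indicator_of_notMem h1, abs_of_nonneg h]
    by_cases hb : c < x
    · rw [if_pos hb, Set.indicator_of_mem (Set.mem_Ioi.2 hb)]; ring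
    · rw [if_neg hb, Set.indicator_of_notMem (by simpa using hb)]; ring
  · have h1 : x ∉ Set.Ioi c := fun hx => by have : c < x := hx; linarith
    rw [Set.indicator_of_notMem h1, abs_of_neg h]
    by_cases hb : c < -x
    · rw [if_pos hb, Set.indicator_of_mem (Set.mem_Ioi.2 hb)]; ring
    · rw [if_neg hb, Set.indicator_of_notMem (by simpa using hb)]; ring

lemma disp_low {b : ℝ} (hb : 1 ≤ b) : ∃ C : ℝ, 0 < C ∧ ∀ α : ℝ, |α| ≤ 1 → ∀ μ : ℝ, 0 < μ → ∀ θ y : ℝ, θ ≠ 0 →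
    ‖∫ ξ : ℝ, Complex.exp (Complex.I * ((θ * (ξ / √(1 + μ * ξ ^ 2 / 3)) + y * ξ : ℝ) : ℂ)) *
      ((aL b μ ξ * (if 0 < ξ then 1 else α) : ℝ) : ℂ)‖ ≤ C / (√μ * √|θ|) := by
  obtain ⟨C, hC, h⟩ := osc_low hb
  refine ⟨2 * C + 1, by linarith, fun α hα μ hμ θ y hθ => ?_⟩
  have hsm := Real.sqrt_pos.2 hμ
  have hssm := Real.sqrt_pos.2 hsm
  have hst := Real.sqrt_pos.2 (abs_pos.2 hθ)
  have k := scaled_kernel (a := fun x => (if |x| ≤ b then √|x| else 0) * (if 0 < x then 1 else α)) (C := 2 * C) ?_ hμ θ y hθ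
  · have e : ∀ ξ : ℝ, ((aL b μ ξ * (if 0 < ξ then 1 else α) : ℝ) : ℂ) = (((√√μ)⁻¹ : ℝ) : ℂ) *
        (((if |√μ * ξ| ≤ b then √|√μ * ξ| else 0) * (if 0 < √μ * ξ then 1 else α) : ℝ) : ℂ) := by
      intro ξ
      rw [← Complex.ofReal_mul]
      congr 1
      rw [← mul_assoc]
      congr 1
      · unfold aL
        rw [abs_mul, abs_of_pos hsm, Real.sqrt_mul hsm.le]
        split_ifs
        · field_simp
        · simp
      · simp only [mul_pos_iff_of_pos_left hsm]
    simp_rw [e, mul_left_comm _ (((√√μ)⁻¹ : ℝ) : ℂ)]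
    rw [integral_const_mul, norm_mul, Complex.norm_real, Real.norm_eq_abs, abs_of_pos (inv_pos.2 hssm)]
    calc _ ≤ (√√μ)⁻¹ * (2 * C / (√√μ * √|θ|)) := by gcongr
      _ = 2 * C / ((√√μ * √√μ) * √|θ|) := by field_simp
      _ = 2 * C / (√μ * √|θ|) := by rw [Real.mul_self_sqrt hsm.le]
      _ ≤ _ := by gcongr; linarith
  · intro τ y hτ
    simp_rw [ite_indicator_L]
    apply full_kernel measurableSet_Ioc _ _ 1 α (by simp) hα τ y hτ
    · exact (Real.continuous_sqrt.integrableOn_Icc).mono_set Set.Ioc_subset_Icc_self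
    · intro τ κ hτ
      have := h τ κ hτ
      rwa [intervalIntegral.integral_of_le (by linarith)] at this

lemma disp_high {c : ℝ} (hc : 0 < c) (hc1 : c ≤ 3) : ∃ C : ℝ, 0 < C ∧ ∀ μ : ℝ, 0 < μ → μ ≤ 1 → ∀ θ y : ℝ, θ ≠ 0 →
    ‖∫ ξ : ℝ, Complex.exp (Complex.I * ((θ * (ξ / √(1 + μ * ξ ^ 2 / 3)) + y * ξ : ℝ) : ℂ)) *
      ((aH c μ ξ : ℝ) : ℂ)‖ ≤ C / (√μ * √|θ|) := by
  obtain ⟨C, hC, h⟩ := osc_high hc hc1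
  refine ⟨2 * C + 1, by linarith, fun μ hμ hμ1 θ y hθ => ?_⟩
  have hsm := Real.sqrt_pos.2 hμ
  have hssm := Real.sqrt_pos.2 hsm
  have hst := Real.sqrt_pos.2 (abs_pos.2 hθ)
  have k := scaled_kernel (a := fun x => (if c < |x| then 1 / |x| ^ 2 else 0)) (C := 2 * C) ?_ hμ θ y hθ
  · have e : ∀ ξ : ℝ, aH c μ ξ = (if c < |√μ * ξ| then 1 / |√μ * ξ| ^ 2 else 0) := by
      intro ξ
      unfold aH
      rw [abs_mul, abs_of_pos hsm]
    simp_rw [e]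
    refine k.trans ?_
    have h1 : √μ ≤ √√μ := by
      apply Real.le_sqrt_of_sq_le
      have : √μ ≤ 1 := Real.sqrt_le_one.2 hμ1
      nlinarith
    gcongr
    linarith
  · intro τ y hτ
    simp_rw [ite_indicator_H c _ hc]
    exact full_kernel measurableSet_Ioi (integrableOn_inv_sq hc) h 1 1 (by simp) (by simp) τ y hτ

lemma aL_measurable (b μ : ℝ) : Measurable (aL b μ) := by
  unfold aL
  apply Measurable.ite
  · exact measurableSet_le (by fun_prop) measurable_const
  · fun_prop
  · fun_prop
lemma aL_integrable (b : ℝ) {μ : ℝ} (hμ : 0 < μ) : Integrable (aL b μ) := by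
  have hsm := Real.sqrt_pos.2 hμ
  have : aL b μ = (Set.Icc (-(b / √μ)) (b / √μ)).indicator (fun ξ => √|ξ|) := by
    ext ξ
    unfold aL
    have : √μ * |ξ| ≤ b ↔ ξ ∈ Set.Icc (-(b / √μ)) (b / √μ) := by
      rw [Set.mem_Icc, ← abs_le, le_div_iff₀ hsm, mul_comm]
    simp only [this, Set.indicator_apply]
  rw [this, integrable_indicator_iff measurableSet_Icc]
  exact Continuous.integrableOn_Icc (by fun_prop)
lemma aH_integrable {c : ℝ} (hc : 0 < c) {μ : ℝ} (hμ : 0 < μ) : Integrable (aH c μ) := by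
  have hsm := Real.sqrt_pos.2 hμ
  have h0 : Integrable ((Set.Ioi c).indicator (fun x : ℝ => 1 / x ^ 2)) :=
    (integrable_indicator_iff measurableSet_Ioi).2 (integrableOn_inv_sq hc)
  have h1 : Integrable (fun x : ℝ => (if c < |x| then 1 / |x| ^ 2 else 0)) := by
    simp_rw [ite_indicator_H c _ hc, one_mul]
    exact h0.add h0.comp_neg
  have := h1.comp_mul_left' hsm.ne'
  refine this.congr (Filter.Eventually.of_forall fun x => ?_)
  simp only [aH, abs_mul, abs_of_pos hsm]

/-- Riesz kernel of order one half -/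
noncomputable def rk (x y : ℝ) : ℝ≥0∞ := (ENNReal.ofReal |x - y|) ^ (-(1/2) : ℝ)

lemma rk_symm (x y : ℝ) : rk x y = rk y x := by unfold rk; rw [abs_sub_comm]
@[fun_prop]
lemma rk_meas : Measurable (Function.uncurry rk) := by
  unfold rk Function.uncurry; fun_prop

lemma rk_near (x R : ℝ) (hR : 0 < R) :
    ∫⁻ y in {y | |x - y| < R}, rk x y ≤ ENNReal.ofReal (4 * R ^ (1/2 : ℝ)) := by
  have hm : MeasurableSet {y : ℝ | |x - y| < R} := measurableSet_lt (by fun_prop) measurable_const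
  rw [← lintegral_indicator hm]
  have : ∀ y, ({y : ℝ | |x - y| < R}).indicator (fun y => rk x y) y =
      (fun z : ℝ => (Set.Ioo (-R) R).indicator (fun z => (ENNReal.ofReal |z|) ^ (-(1/2) : ℝ)) z) (x - y) := by
    intro y
    simp only [Set.indicator_apply, Set.mem_ofPred_eq, Set.mem_Ioo, abs_lt, rk]
  simp_rw [this]
  rw [lintegral_sub_left_eq_self (fun z : ℝ => (Set.Ioo (-R) R).indicator (fun z => (ENNReal.ofReal |z|) ^ (-(1/2) : ℝ)) z) x,
    lintegral_indicator measurableSet_Ioo]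
  have hsub : Set.Ioo (-R) R ⊆ Set.Ioc (-R) 0 ∪ Set.Ioc 0 R := by
    intro z hz
    rcases le_or_gt z 0 with h | h
    · exact Or.inl ⟨hz.1, h⟩
    · exact Or.inr ⟨h, hz.2.le⟩
  have hp : ∫⁻ z in Set.Ioc 0 R, (ENNReal.ofReal |z|) ^ (-(1/2) : ℝ) = ENNReal.ofReal (2 * R ^ (1/2 : ℝ)) := by
    have e : ∫⁻ z in Set.Ioc 0 R, (ENNReal.ofReal |z|) ^ (-(1/2) : ℝ) = ∫⁻ z in Set.Ioc 0 R, ENNReal.ofReal (z ^ (-(1/2) : ℝ)) := by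
      apply setLIntegral_congr_fun measurableSet_Ioc
      intro z hz
      simp only [abs_of_pos hz.1]
      rw [ENNReal.ofReal_rpow_of_pos hz.1]
    rw [e, ← ofReal_integral_eq_lintegral_ofReal]
    · rw [← intervalIntegral.integral_of_le hR.le, integral_rpow (Or.inl (by norm_num))]
      congr 1
      norm_num
      ring
    · have := intervalIntegral.intervalIntegrable_rpow' (a := 0) (b := R) (r := -(1/2)) (by norm_num)
      rwa [intervalIntegrable_iff_integrableOn_Ioc_of_le hR.le] at this
    · filter_upwards [ae_restrict_mem measurableSet_Ioc] with z hz
      have := hz.1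
      positivity
  have hn : ∫⁻ z in Set.Ioc (-R) 0, (ENNReal.ofReal |z|) ^ (-(1/2) : ℝ) ≤ ∫⁻ z in Set.Ioc 0 R, (ENNReal.ofReal |z|) ^ (-(1/2) : ℝ) := by
    rw [← restrict_Ioo_eq_restrict_Ioc, ← lintegral_indicator measurableSet_Ioo, ← lintegral_indicator measurableSet_Ioc,
      ← lintegral_neg_eq_self]
    apply lintegral_mono
    intro z
    simp only [Set.indicator_apply, Set.mem_Ioo, Set.mem_Ioc, abs_neg]
    by_cases h : -R < -z ∧ -z < 0
    · rw [if_pos h, if_pos ⟨by linarith [h.2], by linarith [h.1]⟩]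
    · rw [if_neg h]; exact zero_le
  calc _ ≤ ∫⁻ z in Set.Ioc (-R) 0 ∪ Set.Ioc 0 R, (ENNReal.ofReal |z|) ^ (-(1/2) : ℝ) := lintegral_mono_set hsub
    _ ≤ _ := lintegral_union_le _ _ _
    _ ≤ ENNReal.ofReal (2 * R ^ (1/2 : ℝ)) + ENNReal.ofReal (2 * R ^ (1/2 : ℝ)) := by rw [hp] at *; gcongr
    _ = _ := by rw [← ENNReal.ofReal_add (by positivity) (by positivity)]; congr 1; ring

lemma rk_far (x R : ℝ) (hR : 0 < R) :
    ∫⁻ y in {y | R ≤ |x - y|}, rk x y ^ (4:ℝ) ≤ ENNReal.ofReal (2 / R) := by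
  have hm : MeasurableSet {y : ℝ | R ≤ |x - y|} := measurableSet_le measurable_const (by fun_prop)
  rw [← lintegral_indicator hm]
  have : ∀ y, ({y : ℝ | R ≤ |x - y|}).indicator (fun y => rk x y ^ (4:ℝ)) y =
      (fun z : ℝ => ({z : ℝ | R ≤ |z|}).indicator (fun z => (ENNReal.ofReal |z|) ^ (-2 : ℝ)) z) (x - y) := by
    intro y
    simp only [Set.indicator_apply, Set.mem_ofPred_eq, rk, ← ENNReal.rpow_mul]
    norm_num
  simp_rw [this]
  have hm' : MeasurableSet {y : ℝ | R ≤ |y|} := measurableSet_le measurable_const (by fun_prop)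
  rw [lintegral_sub_left_eq_self (fun z : ℝ => ({z : ℝ | R ≤ |z|}).indicator (fun z => (ENNReal.ofReal |z|) ^ (-2 : ℝ)) z) x,
    lintegral_indicator hm']
  have hsub : {z : ℝ | R ≤ |z|} ⊆ Set.Iic (-R) ∪ Set.Ici R := by
    intro z hz
    have hz2 : R ≤ |z| := hz
    rcases le_abs'.1 hz2 with h | h
    · exact Or.inl h
    · exact Or.inr h
  have hp : ∫⁻ z in Set.Ici R, (ENNReal.ofReal |z|) ^ (-2 : ℝ) = ENNReal.ofReal (1 / R) := by
    rw [← restrict_Ioi_eq_restrict_Ici]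
    have e : ∫⁻ z in Set.Ioi R, (ENNReal.ofReal |z|) ^ (-2 : ℝ) = ∫⁻ z in Set.Ioi R, ENNReal.ofReal (z ^ (-2 : ℝ)) := by
      apply setLIntegral_congr_fun measurableSet_Ioi
      intro z hz
      have : 0 < z := hR.trans hz
      simp only [abs_of_pos this]
      rw [ENNReal.ofReal_rpow_of_pos this]
    rw [e, ← ofReal_integral_eq_lintegral_ofReal]
    · rw [integral_Ioi_rpow_of_lt (by norm_num) hR]
      congr 1
      norm_num
      rw [Real.rpow_neg_one]
    · exact integrableOn_Ioi_rpow_of_lt (by norm_num) hR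
    · filter_upwards [ae_restrict_mem measurableSet_Ioi] with z hz
      have : 0 < z := hR.trans hz
      positivity
  have hn : ∫⁻ z in Set.Iic (-R), (ENNReal.ofReal |z|) ^ (-2 : ℝ) ≤ ∫⁻ z in Set.Ici R, (ENNReal.ofReal |z|) ^ (-2 : ℝ) := by
    rw [← lintegral_indicator measurableSet_Iic, ← lintegral_indicator measurableSet_Ici,
      ← lintegral_neg_eq_self]
    apply lintegral_mono
    intro z
    simp only [Set.indicator_apply, Set.mem_Iic, Set.mem_Ici, abs_neg, neg_le_neg_iff]
    exact le_rfl
  calc _ ≤ ∫⁻ z in Set.Iic (-R) ∪ Set.Ici R, (ENNReal.ofReal |z|) ^ (-2 : ℝ) := lintegral_mono_set hsub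
    _ ≤ _ := lintegral_union_le _ _ _
    _ ≤ ENNReal.ofReal (1 / R) + ENNReal.ofReal (1 / R) := by rw [hp] at *; gcongr
    _ = _ := by rw [← ENNReal.ofReal_add (by positivity) (by positivity)]; congr 1; ring

lemma hls_aux {g : ℝ → ℝ≥0∞} (hg : Measurable g) (hg1 : ∫⁻ y, g y ^ (4/3 : ℝ) ≤ 1) (x : ℝ)
    {a : ℝ≥0∞} (ha : a ≠ ⊤) :
    a * ∫⁻ y in {y | g y ≤ a}, g y * rk x y ≤ 6 * a ^ (4/3 : ℝ) := by
  rcases eq_or_ne a 0 with rfl | ha0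
  · simp
  have hα : 0 < a.toReal := ENNReal.toReal_pos ha0 ha
  obtain ⟨α, hαdef⟩ : ∃ α, α = a.toReal := ⟨_, rfl⟩
  have haα : a = ENNReal.ofReal α := by rw [hαdef, ENNReal.ofReal_toReal ha]
  rw [← hαdef] at hα
  set R := α ^ (-(4/3) : ℝ) with hRdef
  have hR : 0 < R := by positivity
  have hmk : Measurable (fun y => rk x y) := rk_meas.comp (by fun_prop : Measurable fun y : ℝ => (x, y))
  have hm : MeasurableSet {y : ℝ | |x - y| < R} := measurableSet_lt (by fun_prop) measurable_const
  have hm' : MeasurableSet {y : ℝ | R ≤ |x - y|} := measurableSet_le measurable_const (by fun_prop)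
  have hma : MeasurableSet {y : ℝ | g y ≤ a} := measurableSet_le hg measurable_const
  have hsub : {y | g y ≤ a} ⊆ ({y | g y ≤ a} ∩ {y : ℝ | |x - y| < R}) ∪ {y : ℝ | R ≤ |x - y|} := by
    intro y hy
    rcases lt_or_ge (|x - y|) R with h | h
    · exact Or.inl ⟨hy, h⟩
    · exact Or.inr h
  have near : ∫⁻ y in {y | g y ≤ a} ∩ {y : ℝ | |x - y| < R}, g y * rk x y ≤ a * ENNReal.ofReal (4 * R ^ (1/2 : ℝ)) := by
    calc _ ≤ ∫⁻ y in {y | g y ≤ a} ∩ {y : ℝ | |x - y| < R}, a * rk x y := by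
          apply setLIntegral_mono' (hma.inter hm)
          intro y hy
          have : g y ≤ a := hy.1
          gcongr
      _ ≤ ∫⁻ y in {y : ℝ | |x - y| < R}, a * rk x y := lintegral_mono_set Set.inter_subset_right
      _ = a * ∫⁻ y in {y : ℝ | |x - y| < R}, rk x y := lintegral_const_mul _ hmk
      _ ≤ _ := by gcongr; exact rk_near x R hR
  have far : ∫⁻ y in {y : ℝ | R ≤ |x - y|}, g y * rk x y ≤ ENNReal.ofReal ((2 / R) ^ (1/4 : ℝ)) := by
    have hc : (4/3 : ℝ).HolderConjugate 4 := by
      rw [Real.holderConjugate_iff]; norm_num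
    have := ENNReal.lintegral_mul_le_Lp_mul_Lq (volume.restrict {y : ℝ | R ≤ |x - y|}) hc hg.aemeasurable hmk.aemeasurable
    refine this.trans ?_
    have h1 : (∫⁻ y in {y : ℝ | R ≤ |x - y|}, g y ^ (4/3 : ℝ)) ^ (1 / (4/3) : ℝ) ≤ 1 := by
      apply ENNReal.rpow_le_one _ (by norm_num)
      exact (setLIntegral_le_lintegral _ _).trans hg1
    have h2 : (∫⁻ y in {y : ℝ | R ≤ |x - y|}, rk x y ^ (4 : ℝ)) ^ (1 / 4 : ℝ) ≤ ENNReal.ofReal (2 / R) ^ (1/4 : ℝ) := by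
      gcongr; exact rk_far x R hR
    rw [ENNReal.ofReal_rpow_of_pos (by positivity)] at h2
    calc _ ≤ 1 * ENNReal.ofReal ((2 / R) ^ (1/4 : ℝ)) := by gcongr
      _ = _ := one_mul _
  calc a * ∫⁻ y in {y | g y ≤ a}, g y * rk x y
      ≤ a * (a * ENNReal.ofReal (4 * R ^ (1/2 : ℝ)) + ENNReal.ofReal ((2 / R) ^ (1/4 : ℝ))) := by
        gcongr
        refine (lintegral_mono_set hsub).trans ((lintegral_union_le _ _ _).trans ?_)
        gcongr
    _ = ENNReal.ofReal (α * (α * (4 * R ^ (1/2 : ℝ)) + (2 / R) ^ (1/4 : ℝ))) := by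
        rw [haα, ← ENNReal.ofReal_mul hα.le, ← ENNReal.ofReal_add (by positivity) (by positivity),
          ← ENNReal.ofReal_mul hα.le]
    _ ≤ ENNReal.ofReal (6 * α ^ (4/3 : ℝ)) := by
        apply ENNReal.ofReal_le_ofReal
        have e1 : R ^ (1/2 : ℝ) = α ^ (-(2/3) : ℝ) := by
          rw [hRdef, ← Real.rpow_mul hα.le]; norm_num
        have e2 : (2 / R) ^ (1/4 : ℝ) = 2 ^ (1/4 : ℝ) * α ^ (1/3 : ℝ) := by
          rw [div_eq_mul_inv, Real.mul_rpow (by norm_num) (by positivity), hRdef, ← Real.rpow_neg hα.le, ← Real.rpow_mul hα.le]; norm_num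
        have e3 : α * (α * α ^ (-(2/3) : ℝ)) = α ^ (4/3 : ℝ) := by
          rw [← Real.rpow_one_add' hα.le (by norm_num), ← Real.rpow_one_add' hα.le (by norm_num)]; norm_num
        have e4 : α * α ^ (1/3 : ℝ) = α ^ (4/3 : ℝ) := by
          rw [← Real.rpow_one_add' hα.le (by norm_num)]; norm_num
        have h2 : (2:ℝ) ^ (1/4 : ℝ) ≤ 2 := by
          calc (2:ℝ) ^ (1/4 : ℝ) ≤ 2 ^ (1 : ℝ) := Real.rpow_le_rpow_of_exponent_le (by norm_num) (by norm_num)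
            _ = 2 := Real.rpow_one 2
        rw [e1, e2]
        have : α * (α * (4 * α ^ (-(2/3) : ℝ)) + 2 ^ (1/4 : ℝ) * α ^ (1/3 : ℝ)) =
          4 * (α * (α * α ^ (-(2/3) : ℝ))) + 2 ^ (1/4 : ℝ) * (α * α ^ (1/3 : ℝ)) := by ring
        rw [this, e3, e4]
        have : 0 ≤ α ^ (4/3 : ℝ) := by positivity
        nlinarith
    _ = 6 * a ^ (4/3 : ℝ) := by
        rw [haα, ENNReal.ofReal_mul (by norm_num), ENNReal.ofReal_rpow_of_pos hα]; norm_num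

lemma hls_norm {f g : ℝ → ℝ≥0∞} (hf : Measurable f) (hg : Measurable g)
    (hf1 : ∫⁻ y, f y ^ (4/3 : ℝ) ≤ 1) (hg1 : ∫⁻ y, g y ^ (4/3 : ℝ) ≤ 1) :
    ∫⁻ x, ∫⁻ y, f x * g y * rk x y ≤ 12 := by
  have half : ∀ {f g : ℝ → ℝ≥0∞}, Measurable f → Measurable g → ∫⁻ y, f y ^ (4/3 : ℝ) ≤ 1 →
      ∫⁻ y, g y ^ (4/3 : ℝ) ≤ 1 →
      ∫⁻ x, ∫⁻ y, ({y | g y ≤ f x}).indicator (fun y => f x * g y * rk x y) y ≤ 6 := by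
    intro f g hf hg hf1 hg1
    have hfin : ∀ᵐ x, f x ^ (4/3 : ℝ) < ⊤ := ae_lt_top (by fun_prop) (hf1.trans_lt ENNReal.one_lt_top).ne
    calc _ ≤ ∫⁻ x, 6 * f x ^ (4/3 : ℝ) := by
          apply lintegral_mono_ae
          filter_upwards [hfin] with x hx
          have hx' : f x ≠ ⊤ := by
            intro h; rw [h, ENNReal.top_rpow_of_pos (by norm_num)] at hx; exact lt_irrefl _ hx
          have hmk : Measurable (fun y => rk x y) := rk_meas.comp (by fun_prop : Measurable fun y : ℝ => (x, y))
          rw [lintegral_indicator (measurableSet_le hg measurable_const)]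
          simp_rw [mul_assoc]
          rw [lintegral_const_mul _ (show Measurable (fun y => g y * rk x y) from hg.mul hmk)]
          exact hls_aux hg hg1 x hx'
      _ = 6 * ∫⁻ x, f x ^ (4/3 : ℝ) := lintegral_const_mul _ (by fun_prop)
      _ ≤ 6 * 1 := by gcongr
      _ = 6 := mul_one _
  have hmeas : Measurable (Function.uncurry fun x y => f x * g y * rk x y) := by
    have := rk_meas
    unfold Function.uncurry at *
    fun_prop
  have hmI : Measurable (Function.uncurry fun x y => ({y | g y ≤ f x}).indicator (fun y => f x * g y * rk x y) y) := by
    have : (Function.uncurry fun x y => ({y | g y ≤ f x}).indicator (fun y => f x * g y * rk x y) y) =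
      ({p : ℝ × ℝ | g p.2 ≤ f p.1}).indicator (Function.uncurry fun x y => f x * g y * rk x y) := by
      ext p; simp [Function.uncurry, Set.indicator_apply]
    rw [this]
    exact hmeas.indicator (measurableSet_le (by fun_prop) (by fun_prop))
  have hmI2 : Measurable (Function.uncurry fun x y => ({x | f x ≤ g y}).indicator (fun x => g y * f x * rk y x) x) := by
    have : (Function.uncurry fun x y => ({x | f x ≤ g y}).indicator (fun x => g y * f x * rk y x) x) =
      ({p : ℝ × ℝ | f p.1 ≤ g p.2}).indicator (Function.uncurry fun x y => f x * g y * rk x y) := by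
      ext p; simp [Function.uncurry, Set.indicator_apply, rk_symm p.2 p.1, mul_comm (g p.2)]
    rw [this]
    exact hmeas.indicator (measurableSet_le (by fun_prop) (by fun_prop))
  calc _ ≤ ∫⁻ x, ∫⁻ y, (({y | g y ≤ f x}).indicator (fun y => f x * g y * rk x y) y +
        ({x | f x ≤ g y}).indicator (fun x => g y * f x * rk y x) x) := by
        apply lintegral_mono; intro x
        apply lintegral_mono; intro y
        simp only [Set.indicator_apply, Set.mem_ofPred_eq]
        rcases le_total (g y) (f x) with h | h
        · rw [if_pos h]; exact le_self_add
        · rw [if_pos h, rk_symm y x, mul_comm (g y)]; exact le_add_self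
    _ = (∫⁻ x, ∫⁻ y, ({y | g y ≤ f x}).indicator (fun y => f x * g y * rk x y) y) +
        ∫⁻ x, ∫⁻ y, ({x | f x ≤ g y}).indicator (fun x => g y * f x * rk y x) x := by
        rw [← lintegral_add_left (show Measurable (fun x => ∫⁻ y, ({y | g y ≤ f x}).indicator (fun y => f x * g y * rk x y) y) from hmI.lintegral_prod_right')]
        congr 1; ext x
        rw [lintegral_add_left]
        · exact hmI.comp (by fun_prop : Measurable fun y : ℝ => (x, y))
    _ ≤ 6 + 6 := by
        gcongr
        · exact half hf hg hf1 hg1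
        · rw [lintegral_lintegral_swap hmI2.aemeasurable]
          exact half hg hf hg1 hf1
    _ = 12 := by norm_num

/-- Hardy-Littlewood-Sobolev, bilinear form -/
lemma hls {f g : ℝ → ℝ≥0∞} (hf : Measurable f) (hg : Measurable g) :
    ∫⁻ x, ∫⁻ y, f x * g y * rk x y ≤
      12 * ((∫⁻ y, f y ^ (4/3 : ℝ)) ^ (3/4 : ℝ) * (∫⁻ y, g y ^ (4/3 : ℝ)) ^ (3/4 : ℝ)) := by
  set A := ∫⁻ y, f y ^ (4/3 : ℝ) with hA
  set B := ∫⁻ y, g y ^ (4/3 : ℝ) with hB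
  have hz : ∀ {f : ℝ → ℝ≥0∞}, Measurable f → ∫⁻ y, f y ^ (4/3 : ℝ) = 0 → ∀ᵐ x, f x = 0 := by
    intro f hf h
    rw [lintegral_eq_zero_iff (by fun_prop)] at h
    filter_upwards [h] with x hx
    rcases ENNReal.rpow_eq_zero_iff.1 hx with h | h
    · exact h.1
    · exact absurd h.2 (by norm_num)
  rcases eq_or_ne A 0 with hA0 | hA0
  · have : ∫⁻ x, ∫⁻ y, f x * g y * rk x y = 0 := by
      rw [← lintegral_zero (μ := (volume : Measure ℝ))]
      apply lintegral_congr_ae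
      filter_upwards [hz hf hA0] with x hx
      simp [hx]
    rw [this]; exact zero_le
  rcases eq_or_ne B 0 with hB0 | hB0
  · have : ∫⁻ x, ∫⁻ y, f x * g y * rk x y = 0 := by
      rw [← lintegral_zero (μ := (volume : Measure ℝ))]
      congr 1; ext x
      rw [← lintegral_zero (μ := (volume : Measure ℝ))]
      apply lintegral_congr_ae
      filter_upwards [hz hg hB0] with x hx
      simp [hx]
    rw [this]; exact zero_le
  have hpos : ∀ {A : ℝ≥0∞}, A ≠ 0 → A ^ (3/4 : ℝ) ≠ 0 := by
    intro A h; simp [ENNReal.rpow_eq_zero_iff, h]; intro _; norm_num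
  rcases eq_or_ne A ⊤ with hAt | hAt
  · rw [hAt, ENNReal.top_rpow_of_pos (by norm_num), ENNReal.top_mul (hpos hB0), ENNReal.mul_top (by norm_num)]
    exact le_top
  rcases eq_or_ne B ⊤ with hBt | hBt
  · rw [hBt, ENNReal.top_rpow_of_pos (by norm_num), ENNReal.mul_top (hpos hA0), ENNReal.mul_top (by norm_num)]
    exact le_top
  have hfin : ∀ {A : ℝ≥0∞}, A ≠ ⊤ → A ^ (3/4 : ℝ) ≠ ⊤ := fun h => ENNReal.rpow_ne_top_of_nonneg (by norm_num) h
  have hn : ∀ {f : ℝ → ℝ≥0∞} {A : ℝ≥0∞}, Measurable f → A = ∫⁻ y, f y ^ (4/3 : ℝ) → A ≠ 0 → A ≠ ⊤ →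
      ∫⁻ y, ((A ^ (3/4 : ℝ))⁻¹ * f y) ^ (4/3 : ℝ) ≤ 1 := by
    intro f A hf h h0 ht
    simp_rw [ENNReal.mul_rpow_of_nonneg _ _ (by norm_num : (0:ℝ) ≤ 4/3)]
    rw [lintegral_const_mul _ (by fun_prop), ← h, ← ENNReal.rpow_neg, ← ENNReal.rpow_mul]
    norm_num
    rw [ENNReal.rpow_neg_one, ENNReal.inv_mul_cancel h0 ht]
  have key := hls_norm (f := fun x => (A ^ (3/4 : ℝ))⁻¹ * f x) (g := fun x => (B ^ (3/4 : ℝ))⁻¹ * g x)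
    (by fun_prop) (by fun_prop) (hn hf hA hA0 hAt) (hn hg hB hB0 hBt)
  have hP0 : A ^ (3/4 : ℝ) * B ^ (3/4 : ℝ) ≠ 0 := mul_ne_zero (hpos hA0) (hpos hB0)
  have hPt : A ^ (3/4 : ℝ) * B ^ (3/4 : ℝ) ≠ ⊤ := ENNReal.mul_ne_top (hfin hAt) (hfin hBt)
  have e : ∫⁻ x, ∫⁻ y, ((A ^ (3/4 : ℝ))⁻¹ * f x) * ((B ^ (3/4 : ℝ))⁻¹ * g y) * rk x y =
      (A ^ (3/4 : ℝ) * B ^ (3/4 : ℝ))⁻¹ * ∫⁻ x, ∫⁻ y, f x * g y * rk x y := by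
    have hne : (A ^ (3/4 : ℝ) * B ^ (3/4 : ℝ))⁻¹ ≠ ⊤ := ENNReal.inv_ne_top.2 hP0
    rw [← lintegral_const_mul' _ _ hne]
    congr 1; ext x
    rw [← lintegral_const_mul' _ _ hne]
    congr 1; ext y
    rw [ENNReal.mul_inv (Or.inl (hpos hA0)) (Or.inr (hpos hB0))]
    ring
  rw [e] at key
  calc _ = (A ^ (3/4 : ℝ) * B ^ (3/4 : ℝ)) * ((A ^ (3/4 : ℝ) * B ^ (3/4 : ℝ))⁻¹ * ∫⁻ x, ∫⁻ y, f x * g y * rk x y) := by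
        rw [← mul_assoc, ENNReal.mul_inv_cancel hP0 hPt, one_mul]
    _ ≤ (A ^ (3/4 : ℝ) * B ^ (3/4 : ℝ)) * 12 := by gcongr
    _ = _ := mul_comm _ _

lemma hls_L4 {F : ℝ → ℝ≥0∞} (hF : Measurable F) (T : ℝ) :
    (∫⁻ t in Set.Ioo 0 T, (∫⁻ s, F s * rk t s) ^ (4:ℝ)) ^ (1/4 : ℝ) ≤
      12 * (∫⁻ s, F s ^ (4/3 : ℝ)) ^ (3/4 : ℝ) := by
  set v : ℝ → ℝ≥0∞ := fun t => ∫⁻ s, F s * rk t s with hv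
  have hvm : Measurable v := by
    have : Measurable (Function.uncurry fun t s => F s * rk t s) := by
      have := rk_meas
      unfold Function.uncurry at *
      fun_prop
    exact this.lintegral_prod_right'
  set N := 12 * (∫⁻ s, F s ^ (4/3 : ℝ)) ^ (3/4 : ℝ) with hN
  have key : ∀ n : ℕ, ∫⁻ t in Set.Ioo 0 T, (min (v t) n) ^ (4:ℝ) ≤ N ^ (4:ℝ) := by
    intro n
    set w : ℝ → ℝ≥0∞ := (Set.Ioo 0 T).indicator (fun t => min (v t) n) with hw
    have hwm : Measurable w := by
      apply Measurable.indicator _ measurableSet_Ioo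
      fun_prop
    have e0 : ∫⁻ t in Set.Ioo 0 T, (min (v t) n) ^ (4:ℝ) = ∫⁻ t, w t ^ (4:ℝ) := by
      rw [← lintegral_indicator measurableSet_Ioo]
      congr 1; ext t
      simp only [hw, Set.indicator_apply]
      split_ifs <;> simp
    rw [e0]
    set X := ∫⁻ t, w t ^ (4:ℝ) with hX
    have hXt : X ≠ ⊤ := by
      rw [← e0]
      apply ne_of_lt
      calc _ ≤ ∫⁻ t in Set.Ioo 0 T, (n : ℝ≥0∞) ^ (4:ℝ) := by
            apply lintegral_mono; intro t; simp only []; gcongr; exact min_le_right _ _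
        _ = (n : ℝ≥0∞) ^ (4:ℝ) * volume (Set.Ioo 0 T) := by rw [setLIntegral_const]
        _ < ⊤ := by
            apply ENNReal.mul_lt_top
            · exact (ENNReal.rpow_ne_top_of_nonneg (by norm_num) (ENNReal.natCast_ne_top n)).lt_top
            · simp
    have h1 : X ≤ ∫⁻ x, ∫⁻ y, w x ^ (3:ℝ) * F y * rk x y := by
      apply lintegral_mono; intro t
      simp_rw [mul_assoc]
      have hmk : Measurable (fun s => rk t s) := rk_meas.comp (by fun_prop : Measurable fun y : ℝ => (t, y))
      rw [lintegral_const_mul _ (show Measurable (fun s => F s * rk t s) from hF.mul hmk)]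
      have : w t ^ (4:ℝ) = w t ^ (3:ℝ) * w t := by
        rw [show (4:ℝ) = 3 + 1 by norm_num, ENNReal.rpow_add_of_nonneg _ _ (by norm_num) (by norm_num), ENNReal.rpow_one]
      rw [this]
      gcongr
      simp only [hw, Set.indicator_apply]
      split_ifs
      · exact min_le_left _ _
      · exact zero_le
    have h2 := h1.trans (hls (f := fun x => w x ^ (3:ℝ)) (by fun_prop) hF)
    have e3 : ∀ y, (w y ^ (3:ℝ)) ^ (4/3 : ℝ) = w y ^ (4:ℝ) := by
      intro y; rw [← ENNReal.rpow_mul]; norm_num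
    simp_rw [e3] at h2
    rw [← hX] at h2
    have h3 : X ≤ X ^ (3/4 : ℝ) * N := by
      refine h2.trans (le_of_eq ?_)
      rw [hN]; ring
    rcases eq_or_ne X 0 with h0 | h0
    · rw [h0]; exact zero_le
    have h4 : X ^ (1/4 : ℝ) ≤ N := by
      have hp0 : X ^ (3/4 : ℝ) ≠ 0 := by simp [ENNReal.rpow_eq_zero_iff, h0]; intro _; norm_num
      have hpt : X ^ (3/4 : ℝ) ≠ ⊤ := ENNReal.rpow_ne_top_of_nonneg (by norm_num) hXt
      have e5 : X = X ^ (3/4 : ℝ) * X ^ (1/4 : ℝ) := by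
        rw [← ENNReal.rpow_add_of_nonneg _ _ (by norm_num) (by norm_num)]; norm_num
      rw [e5] at h3
      nth_rewrite 2 [← e5] at h3
      exact (ENNReal.mul_le_mul_iff_right hp0 hpt).1 h3
    calc X = (X ^ (1/4 : ℝ)) ^ (4:ℝ) := by rw [← ENNReal.rpow_mul]; norm_num
      _ ≤ N ^ (4:ℝ) := by gcongr
  have hsup : ∫⁻ t in Set.Ioo 0 T, v t ^ (4:ℝ) ≤ N ^ (4:ℝ) := by
    have : ∀ t, v t ^ (4:ℝ) = ⨆ n : ℕ, (min (v t) n) ^ (4:ℝ) := by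
      intro t
      have hm : Monotone fun n : ℕ => (min (v t) n) ^ (4:ℝ) := by
        intro n m hnm
        have : (n : ℝ≥0∞) ≤ m := by exact_mod_cast hnm
        simp only []
        gcongr
      have h1 : Filter.Tendsto (fun n : ℕ => (min (v t) n) ^ (4:ℝ)) Filter.atTop (nhds ((min (v t) ⊤) ^ (4:ℝ))) := by
        have := (tendsto_const_nhds (x := v t)).min ENNReal.tendsto_nat_nhds_top
        exact (ENNReal.continuous_rpow_const.tendsto _).comp this
      rw [min_eq_left le_top] at h1
      exact tendsto_nhds_unique h1 (tendsto_atTop_iSup hm)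
    simp_rw [this]
    rw [lintegral_iSup]
    · exact iSup_le key
    · intro n; fun_prop
    · intro n m hnm t
      have : (n : ℝ≥0∞) ≤ m := by exact_mod_cast hnm
      simp only []
      gcongr
  calc _ ≤ (N ^ (4:ℝ)) ^ (1/4 : ℝ) := by gcongr
    _ = N := by rw [← ENNReal.rpow_mul]; norm_num

open scoped FourierTransform in
lemma plancherel_ae {W : ℝ → ℂ} (h1 : Integrable W) (h2 : MemLp W 2 volume) :
    eLpNorm (𝓕 W) 2 volume = eLpNorm W 2 volume := by
  set w : Lp ℂ 2 (volume : Measure ℝ) := h2.toLp W with hw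
  have hww : w =ᵐ[volume] W := h2.coeFn_toLp
  have hc : Continuous (𝓕 W) := VectorFourier.fourierIntegral_continuous Real.continuous_fourierChar
    (innerSL ℝ).continuous₂ h1
  have hae : ∀ᵐ x, (𝓕 w : Lp ℂ 2 (volume : Measure ℝ)) x = 𝓕 W x := by
    apply ae_eq_of_integral_contDiff_smul_eq
    · exact (Lp.memLp _).locallyIntegrable (by norm_num)
    · exact hc.locallyIntegrable
    intro g hg hgc
    have hgd : ContDiff ℝ (⊤ : ℕ∞) (fun x => (g x : ℂ)) := Complex.ofRealCLM.contDiff.comp hg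
    have hgcc : HasCompactSupport (fun x => (g x : ℂ)) := hgc.comp_left (g := fun x : ℝ => (x:ℂ)) (by simp)
    set φ : SchwartzMap ℝ ℂ := hgcc.toSchwartzMap hgd with hφ
    have e1 := congrArg (fun T => T φ) (Lp.fourier_toTemperedDistribution_eq w)
    simp only [Lp.toTemperedDistribution_apply, TemperedDistribution.fourier_apply] at e1
    have eφ : ∀ x, φ x = (g x : ℂ) := fun x => rfl
    have e2 : ∫ x, (𝓕 φ) x • w x = ∫ x, (𝓕 (φ : ℝ → ℂ)) x • W x := by
      apply integral_congr_ae
      filter_upwards [hww] with x hx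
      rw [hx]; rfl
    have e3 : ∫ x, (𝓕 (φ : ℝ → ℂ)) x • W x = ∫ x, φ x • 𝓕 W x := by
      have := VectorFourier.integral_fourierIntegral_smul_eq_flip (μ := volume) (L := innerₗ ℝ) Real.continuous_fourierChar
        continuous_inner φ.integrable h1
      rw [flip_innerₗ] at this
      exact this
    rw [e2, e3] at e1
    simp only [eφ] at e1
    exact e1.symm
  have := Lp.norm_fourier_eq w
  rw [Lp.norm_def, Lp.norm_def, ENNReal.toReal_eq_toReal_iff' (Lp.eLpNorm_ne_top _) (Lp.eLpNorm_ne_top _),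
    eLpNorm_congr_ae hae, eLpNorm_congr_ae hww] at this
  exact this

/-- unnormalised inverse Fourier integral -/
noncomputable def ift (W : ℝ → ℂ) (x : ℝ) : ℂ := ∫ ξ : ℝ, cexp (I * ((x * ξ : ℝ) : ℂ)) * W ξ

/-- normalisation constant -/
noncomputable def kc : ℝ := (2 * π) ^ (-(1 : ℝ) / 2)

lemma kc_pos : 0 < kc := by unfold kc; positivity

lemma kc_sq : kc * kc = (2 * π)⁻¹ := by
  unfold kc
  rw [← Real.rpow_add (by positivity)]
  norm_num
  rw [Real.rpow_neg_one]
  simp [mul_comm]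

open scoped FourierTransform in
lemma ift_eq (W : ℝ → ℂ) (x : ℝ) : ift W x = 𝓕 W (-(2 * π)⁻¹ * x) := by
  rw [Real.fourier_real_eq_integral_exp_smul]
  unfold ift
  congr 1; ext ξ
  rw [smul_eq_mul]
  congr 2
  have : -2 * π * ξ * (-(2 * π)⁻¹ * x) = x * ξ := by field_simp
  rw [this, mul_comm]

lemma ift_cont {W : ℝ → ℂ} (h1 : Integrable W) : Continuous (ift W) := by
  have : ift W = fun x => FourierTransform.fourier W (-(2 * π)⁻¹ * x) := by ext x; exact ift_eq W x
  rw [this]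
  have hc : Continuous (FourierTransform.fourier W) := VectorFourier.fourierIntegral_continuous Real.continuous_fourierChar
    (innerSL ℝ).continuous₂ h1
  fun_prop

lemma lintegral_scale {f : ℝ → ℝ≥0∞} (hf : Measurable f) {a : ℝ} (ha : a ≠ 0) :
    ∫⁻ x, f (a * x) = ENNReal.ofReal |a⁻¹| * ∫⁻ x, f x := by
  have := Real.map_volume_mul_left ha
  rw [← lintegral_map hf (by fun_prop : Measurable fun x : ℝ => a * x), this]
  simp [lintegral_smul_measure]

lemma ift_L2 {W : ℝ → ℂ} (h1 : Integrable W) (h2 : MemLp W 2 volume) :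
    eLpNorm (fun x => (kc : ℂ) * ift W x) 2 volume = eLpNorm W 2 volume := by
  have hc : Continuous (FourierTransform.fourier W) := VectorFourier.fourierIntegral_continuous Real.continuous_fourierChar
    (innerSL ℝ).continuous₂ h1
  rw [← plancherel_ae h1 h2]
  rw [eLpNorm_eq_lintegral_rpow_enorm_toReal (by norm_num) (by norm_num),
    eLpNorm_eq_lintegral_rpow_enorm_toReal (by norm_num) (by norm_num)]
  congr 1
  have e : ∀ x, ‖(kc : ℂ) * ift W x‖ₑ ^ (2:ℝ≥0∞).toReal =
      ENNReal.ofReal (kc * kc) * (fun z => ‖FourierTransform.fourier W z‖ₑ ^ (2:ℝ≥0∞).toReal) (-(2 * π)⁻¹ * x) := by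
    intro x
    simp only [ENNReal.toReal_ofNat, enorm_mul]
    rw [ENNReal.mul_rpow_of_nonneg _ _ (by norm_num), ift_eq]
    congr 1
    rw [← ofReal_norm, Complex.norm_real, Real.norm_of_nonneg kc_pos.le,
      ENNReal.ofReal_rpow_of_pos kc_pos]
    norm_num [pow_two]
  simp_rw [e]
  rw [lintegral_const_mul' _ _ ENNReal.ofReal_ne_top]
  rw [lintegral_scale (f := fun z => ‖FourierTransform.fourier W z‖ₑ ^ (2:ℝ≥0∞).toReal) (by fun_prop) (by simp [Real.pi_ne_zero]), ← mul_assoc, ← ENNReal.ofReal_mul (by rw [kc_sq]; positivity), kc_sq]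
  have : (2 * π)⁻¹ * |(-(2 * π)⁻¹)⁻¹| = 1 := by
    rw [inv_neg, abs_neg, inv_inv, abs_of_pos (by positivity)]
    field_simp
  rw [this]; simp

/-- Fourier inversion -/
lemma ift_inv {h : ℝ → ℂ} (hc : Continuous h) (hi : Integrable h) (hg : Integrable (ift h)) (ξ : ℝ) :
    h ξ = ((kc * kc : ℝ) : ℂ) * ∫ x, cexp (-I * ((x * ξ : ℝ) : ℂ)) * ift h x := by
  have hF : Integrable (FourierTransform.fourier h) := by
    have : Integrable (fun x => ift h (-(2 * π) * x)) := hg.comp_mul_left' (by simp [Real.pi_ne_zero])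
    have e : (fun x => ift h (-(2 * π) * x)) = FourierTransform.fourier h := by
      ext x; rw [ift_eq]; congr 1; field_simp
    rwa [e] at this
  have := congrFun (hc.fourierInv_fourier_eq hi hF) ξ
  rw [← this, Real.fourierInv_eq']
  have e : ∀ x : ℝ, cexp (-I * ((x * ξ : ℝ) : ℂ)) * ift h x =
      (fun v : ℝ => cexp (↑(2 * π * inner ℝ v ξ) * I) • FourierTransform.fourier h v) (-(2 * π)⁻¹ * x) := by
    intro x
    simp only [smul_eq_mul]
    rw [ift_eq]
    congr 2
    have : 2 * π * inner ℝ (-(2 * π)⁻¹ * x) ξ = -(x * ξ) := by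
      simp only [RCLike.inner_apply, conj_trivial]; field_simp
    rw [this]; push_cast; ring
  simp_rw [e]
  rw [Measure.integral_comp_mul_left (fun v : ℝ => cexp (↑(2 * π * inner ℝ v ξ) * I) • FourierTransform.fourier h v), kc_sq]
  rw [inv_neg, abs_neg, inv_inv, abs_of_pos (by positivity), Complex.real_smul, ← mul_assoc]
  have : (((2 * π)⁻¹ : ℝ) : ℂ) * ((2 * π : ℝ) : ℂ) = 1 := by
    rw [← Complex.ofReal_mul, inv_mul_cancel₀ (by positivity), Complex.ofReal_one]
  rw [this, one_mul]

lemma kc_le_one : kc ≤ 1 := by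
  unfold kc
  apply Real.rpow_le_one_of_one_le_of_nonpos _ (by norm_num)
  have := Real.pi_gt_three
  linarith

lemma norm_exp_I (r : ℝ) : ‖cexp (I * (r : ℂ))‖ = 1 := by
  rw [mul_comm]; exact Complex.norm_exp_ofReal_mul_I r

lemma norm_exp_nI (r : ℝ) : ‖cexp (-I * (r : ℂ))‖ = 1 := by
  rw [show -I * (r:ℂ) = I * ((-r : ℝ) : ℂ) by push_cast; ring]; exact norm_exp_I _

/-- the L1 norm of the inverse transform -/
noncomputable def nL (h : ℝ → ℂ) : ℝ≥0∞ := eLpNorm (fun x => (kc : ℂ) * ift h x) 1 volume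

lemma nL_eq (h : ℝ → ℂ) : nL h = ENNReal.ofReal kc * ∫⁻ x, ‖ift h x‖ₑ := by
  unfold nL
  rw [eLpNorm_one_eq_lintegral_enorm, ← lintegral_const_mul' _ _ ENNReal.ofReal_ne_top]
  congr 1; ext x
  rw [enorm_mul, ← ofReal_norm (kc : ℂ), Complex.norm_real, Real.norm_of_nonneg kc_pos.le]

lemma nL_integrable {h : ℝ → ℂ} (hi : Integrable h) (hn : nL h ≠ ⊤) : Integrable (ift h) := by
  refine ⟨(ift_cont hi).aestronglyMeasurable, ?_⟩
  rw [nL_eq] at hn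
  unfold HasFiniteIntegral
  by_contra hcon
  rw [not_lt, top_le_iff] at hcon
  rw [hcon] at hn
  exact hn (ENNReal.mul_top (by simpa using kc_pos))

lemma nL_zero {h : ℝ → ℂ} (hc : Continuous h) (hi : Integrable h) (hn : nL h = 0) (ξ : ℝ) : h ξ = 0 := by
  have hg := nL_integrable hi (by rw [hn]; simp)
  rw [ift_inv hc hi hg]
  rw [nL_eq, mul_eq_zero] at hn
  rcases hn with hn | hn
  · exact absurd hn (by simpa using kc_pos)
  · rw [lintegral_eq_zero_iff (ift_cont hi).measurable.enorm] at hn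
    have : ∫ x, cexp (-I * ((x * ξ : ℝ) : ℂ)) * ift h x = ∫ x : ℝ, (0:ℂ) := by
      apply integral_congr_ae
      filter_upwards [hn] with x hx
      have : ift h x = 0 := by simpa using hx
      simp [this]
    rw [this]; simp

lemma ift_conv {A h : ℝ → ℂ} (hA : Integrable A) (hc : Continuous h) (hi : Integrable h)
    (hg : Integrable (ift h)) (x : ℝ) :
    ift (fun ξ => A ξ * h ξ) x = ((kc * kc : ℝ) : ℂ) * ∫ y, ift h y * ift A (x - y) := by
  have e1 : ∀ ξ, cexp (I * ((x * ξ : ℝ) : ℂ)) * (A ξ * h ξ) = ((kc * kc : ℝ) : ℂ) *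
      ∫ y, ift h y * (cexp (I * (((x - y) * ξ : ℝ) : ℂ)) * A ξ) := by
    intro ξ
    have : ∀ y, ift h y * (cexp (I * (((x - y) * ξ : ℝ) : ℂ)) * A ξ) =
      (cexp (I * ((x * ξ : ℝ) : ℂ)) * A ξ) * (cexp (-I * ((y * ξ : ℝ) : ℂ)) * ift h y) := by
      intro y
      have : cexp (I * (((x - y) * ξ : ℝ) : ℂ)) = cexp (I * ((x * ξ : ℝ) : ℂ)) * cexp (-I * ((y * ξ : ℝ) : ℂ)) := by
        rw [← Complex.exp_add]; congr 1; push_cast; ring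
      rw [this]; ring
    simp_rw [this]
    rw [integral_const_mul]
    nth_rewrite 1 [ift_inv hc hi hg ξ]
    ring
  unfold ift at e1 ⊢
  simp_rw [e1]
  rw [integral_const_mul]
  congr 1
  rw [integral_integral_swap]
  · congr 1; ext y
    rw [integral_const_mul]
  · have h1 : Integrable (fun p : ℝ × ℝ => A p.1 * ift h p.2) (volume.prod volume) := hA.mul_prod hg
    have h2 := h1.bdd_mul (f := fun p : ℝ × ℝ => cexp (I * (((x - p.2) * p.1 : ℝ) : ℂ))) (c := 1)
      (by apply Continuous.aestronglyMeasurable; fun_prop)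
      (Filter.Eventually.of_forall fun p => by rw [norm_exp_I])
    refine h2.congr (Filter.Eventually.of_forall fun p => ?_)
    simp only [Function.uncurry, ift]
    ring

lemma lemB {A h : ℝ → ℂ} (hA : Integrable A) {K : ℝ} (hK : 0 < K) (hAK : ∀ y, ‖ift A y‖ ≤ K)
    (hc : Continuous h) (hi : Integrable h) (x : ℝ) :
    ‖ift (fun ξ => A ξ * h ξ) x‖ₑ ≤ ENNReal.ofReal K * nL h := by
  by_cases hn : nL h = ⊤
  · rw [hn, ENNReal.mul_top (by simpa using hK)]; exact le_top
  have hg := nL_integrable hi hn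
  rw [ift_conv hA hc hi hg, nL_eq, enorm_mul]
  have h1 : ‖((kc * kc : ℝ) : ℂ)‖ₑ ≤ ENNReal.ofReal kc := by
    rw [← ofReal_norm, Complex.norm_real, Real.norm_of_nonneg (by have := kc_pos; positivity)]
    apply ENNReal.ofReal_le_ofReal
    nlinarith [kc_pos, kc_le_one]
  have h2 : ‖∫ y, ift h y * ift A (x - y)‖ₑ ≤ ENNReal.ofReal K * ∫⁻ y, ‖ift h y‖ₑ := by
    refine (enorm_integral_le_lintegral_enorm _).trans ?_
    rw [← lintegral_const_mul' _ _ ENNReal.ofReal_ne_top]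
    apply lintegral_mono
    intro y
    simp only [enorm_mul]
    rw [mul_comm]
    gcongr
    rw [← ofReal_norm]
    exact ENNReal.ofReal_le_ofReal (hAK _)
  calc _ ≤ ENNReal.ofReal kc * (ENNReal.ofReal K * ∫⁻ y, ‖ift h y‖ₑ) := by gcongr
    _ = _ := by ring

lemma h_bdd {h : ℝ → ℂ} (hc : Continuous h) (hi : Integrable h) (hg : Integrable (ift h)) :
    ∃ M, ∀ ξ, ‖h ξ‖ ≤ M := by
  refine ⟨‖((kc * kc : ℝ) : ℂ)‖ * ∫ x, ‖ift h x‖, fun ξ => ?_⟩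
  rw [ift_inv hc hi hg ξ, norm_mul]
  gcongr
  refine (norm_integral_le_integral_norm _).trans (le_of_eq ?_)
  congr 1; ext x
  rw [norm_mul, norm_exp_nI, one_mul]

lemma lemC {A h1 h2 : ℝ → ℂ} (hA : Integrable A) {K : ℝ} (hK : 0 < K) (hAK : ∀ y, ‖ift A y‖ ≤ K)
    (hc1 : Continuous h1) (hi1 : Integrable h1) (hc2 : Continuous h2) (hi2 : Integrable h2) :
    ‖∫ ξ, A ξ * h1 ξ * starRingEnd ℂ (h2 ξ)‖ₑ ≤ ENNReal.ofReal K * (nL h1 * nL h2) := by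
  by_cases hz1 : nL h1 = 0
  · simp [nL_zero hc1 hi1 hz1]
  by_cases hz2 : nL h2 = 0
  · simp [nL_zero hc2 hi2 hz2]
  by_cases hn1 : nL h1 = ⊤
  · rw [hn1, ENNReal.top_mul hz2, ENNReal.mul_top (by simpa using hK)]; exact le_top
  by_cases hn2 : nL h2 = ⊤
  · rw [hn2, ENNReal.mul_top hz1, ENNReal.mul_top (by simpa using hK)]; exact le_top
  have hg1 := nL_integrable hi1 hn1
  have hg2 := nL_integrable hi2 hn2
  obtain ⟨M, hM⟩ := h_bdd hc1 hi1 hg1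
  have hAh : Integrable (fun ξ => A ξ * h1 ξ) := by
    refine (hA.bdd_mul (f := h1) (c := M) hc1.aestronglyMeasurable (Filter.Eventually.of_forall hM)).congr
      (Filter.Eventually.of_forall fun ξ => ?_)
    exact mul_comm _ _
  have e1 : ∀ ξ, A ξ * h1 ξ * starRingEnd ℂ (h2 ξ) = ((kc * kc : ℝ) : ℂ) *
      ∫ y, starRingEnd ℂ (ift h2 y) * (cexp (I * ((y * ξ : ℝ) : ℂ)) * (A ξ * h1 ξ)) := by
    intro ξ
    have : ∀ y, starRingEnd ℂ (ift h2 y) * (cexp (I * ((y * ξ : ℝ) : ℂ)) * (A ξ * h1 ξ)) =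
        (A ξ * h1 ξ) * starRingEnd ℂ (cexp (-I * ((y * ξ : ℝ) : ℂ)) * ift h2 y) := by
      intro y
      rw [map_mul, ← Complex.exp_conj]
      have : starRingEnd ℂ (-I * ((y * ξ : ℝ) : ℂ)) = I * ((y * ξ : ℝ) : ℂ) := by
        rw [map_mul, map_neg, Complex.conj_I, Complex.conj_ofReal, neg_neg]
      rw [this]; ring
    simp_rw [this]
    rw [integral_const_mul, integral_conj]
    nth_rewrite 1 [ift_inv hc2 hi2 hg2 ξ]
    rw [map_mul, Complex.conj_ofReal]
    ring
  simp_rw [e1]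
  rw [integral_const_mul, integral_integral_swap]
  · simp_rw [integral_const_mul]
    rw [enorm_mul]
    have hk : ‖((kc * kc : ℝ) : ℂ)‖ₑ ≤ ENNReal.ofReal kc := by
      rw [← ofReal_norm, Complex.norm_real, Real.norm_of_nonneg (by have := kc_pos; positivity)]
      apply ENNReal.ofReal_le_ofReal
      nlinarith [kc_pos, kc_le_one]
    have hb : ‖∫ y, starRingEnd ℂ (ift h2 y) * ∫ ξ, (cexp (I * ((y * ξ : ℝ) : ℂ)) * (A ξ * h1 ξ))‖ₑ ≤
        (ENNReal.ofReal K * nL h1) * ∫⁻ y, ‖ift h2 y‖ₑ := by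
      refine (enorm_integral_le_lintegral_enorm _).trans ?_
      rw [← lintegral_const_mul' _ _ (ENNReal.mul_ne_top ENNReal.ofReal_ne_top hn1)]
      apply lintegral_mono
      intro y
      simp only [enorm_mul]
      rw [mul_comm]
      have := lemB hA hK hAK hc1 hi1 y
      have e : ‖starRingEnd ℂ (ift h2 y)‖ₑ = ‖ift h2 y‖ₑ := by
        rw [← ofReal_norm, RCLike.norm_conj, ofReal_norm]
      rw [e]
      unfold ift at this ⊢
      simp only [← enorm_mul] at this ⊢
      rw [enorm_mul]
      gcongr
    calc _ ≤ ENNReal.ofReal kc * ((ENNReal.ofReal K * nL h1) * ∫⁻ y, ‖ift h2 y‖ₑ) := by gcongr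
      _ = _ := by rw [nL_eq h2]; ring
  · have hconj : Integrable (fun y => starRingEnd ℂ (ift h2 y)) := by
      refine ⟨(Complex.continuous_conj.comp (ift_cont hi2)).aestronglyMeasurable, ?_⟩
      have := hg2.2
      unfold HasFiniteIntegral at this ⊢
      refine lt_of_eq_of_lt ?_ this
      congr 1; ext y
      rw [← ofReal_norm, RCLike.norm_conj, ofReal_norm]
    have h1 := hAh.mul_prod hconj
    have h2 := h1.bdd_mul (f := fun p : ℝ × ℝ => cexp (I * ((p.2 * p.1 : ℝ) : ℂ))) (c := 1)
      (by apply Continuous.aestronglyMeasurable; fun_prop)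
      (Filter.Eventually.of_forall fun p => by rw [norm_exp_I])
    refine h2.congr (Filter.Eventually.of_forall fun p => ?_)
    simp only [Function.uncurry]
    ring

/-- oscillating factor -/
noncomputable def Eo (p : ℝ → ℝ) (θ ξ : ℝ) : ℂ := cexp (I * ((θ * p ξ : ℝ) : ℂ))

lemma Eo_norm (p : ℝ → ℝ) (θ ξ : ℝ) : ‖Eo p θ ξ‖ = 1 := norm_exp_I _

lemma Eo_cont {p : ℝ → ℝ} (hp : Continuous p) : Continuous (Function.uncurry (Eo p)) := by
  unfold Eo Function.uncurry; fun_prop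

lemma rk_ofReal {D ε σ t s : ℝ} (hD : 0 < D) (hε : 0 < ε) (hσ : |σ| = 1) (hts : t ≠ s) :
    ENNReal.ofReal (D / √|σ * ((t - s) / ε)|) = ENNReal.ofReal (D * √ε) * rk t s := by
  have hpos : 0 < |t - s| := abs_pos.2 (sub_ne_zero.2 hts)
  unfold rk
  rw [ENNReal.ofReal_rpow_of_pos hpos, ← ENNReal.ofReal_mul (by positivity)]
  congr 1
  rw [abs_mul, hσ, one_mul, abs_div, abs_of_pos hε, Real.sqrt_div hpos.le, Real.rpow_neg hpos.le, ← Real.sqrt_eq_rpow]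
  have : 0 < √|t - s| := Real.sqrt_pos.2 hpos
  have : 0 < √ε := Real.sqrt_pos.2 hε
  field_simp

/-- Kernel hypothesis -/
def KB (p : ℝ → ℝ) (a : ℝ → ℂ) (D : ℝ) : Prop :=
  Integrable a ∧ 0 < D ∧ ∀ θ, θ ≠ 0 → ∀ y, ‖ift (fun ξ => Eo p θ ξ * a ξ) y‖ ≤ D / √|θ|

/-- Admissible time dependent symbols -/
def Adm (h : ℝ → ℝ → ℂ) : Prop :=
  Continuous (Function.uncurry h) ∧ ∃ B, ∀ s ξ, ‖h s ξ‖ ≤ B * (1 + ξ ^ 2)⁻¹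

lemma Eo_int {p : ℝ → ℝ} (hp : Continuous p) {a : ℝ → ℂ} (ha : Integrable a) (θ : ℝ) :
    Integrable (fun ξ => Eo p θ ξ * a ξ) := by
  refine ha.bdd_mul (c := 1) ?_ (Filter.Eventually.of_forall fun ξ => (Eo_norm p θ ξ).le)
  apply Continuous.aestronglyMeasurable
  unfold Eo; fun_prop

lemma Adm.cont {h : ℝ → ℝ → ℂ} (hh : Adm h) (s : ℝ) : Continuous (h s) :=
  hh.1.comp (by fun_prop : Continuous fun ξ : ℝ => (s, ξ))

lemma Adm.int {h : ℝ → ℝ → ℂ} (hh : Adm h) (s : ℝ) : Integrable (h s) := by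
  obtain ⟨B, hB⟩ := hh.2
  exact (integrable_inv_one_add_sq.const_mul B).mono' (hh.cont s).aestronglyMeasurable
    (Filter.Eventually.of_forall fun ξ => hB s ξ)

lemma Adm.ift_cont {h : ℝ → ℝ → ℂ} (hh : Adm h) : Continuous (fun q : ℝ × ℝ => ift (h q.1) q.2) := by
  obtain ⟨B, hB⟩ := hh.2
  unfold ift
  apply continuous_of_dominated (bound := fun ξ => B * (1 + ξ ^ 2)⁻¹)
  · intro q
    apply Continuous.aestronglyMeasurable
    have := hh.cont q.1
    fun_prop
  · intro q
    filter_upwards with ξ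
    rw [norm_mul, norm_exp_I, one_mul]; exact hB _ _
  · exact integrable_inv_one_add_sq.const_mul B
  · filter_upwards with ξ
    have : Continuous fun q : ℝ × ℝ => h q.1 ξ := hh.1.comp (by fun_prop : Continuous fun q : ℝ × ℝ => (q.1, ξ))
    exact (by fun_prop : Continuous fun q : ℝ × ℝ => cexp (I * ((q.2 * ξ : ℝ) : ℂ))).mul this

lemma Adm.nL_meas {h : ℝ → ℝ → ℂ} (hh : Adm h) : Measurable (fun s => nL (h s)) := by
  simp_rw [nL_eq]
  apply Measurable.const_mul
  have : Measurable (fun q : ℝ × ℝ => ‖ift (h q.1) q.2‖ₑ) := hh.ift_cont.measurable.enorm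
  exact this.lintegral_prod_right'

lemma S_inf {p : ℝ → ℝ} (hp : Continuous p) {a : ℝ → ℂ} {D : ℝ} (hK : KB p a D) {h : ℝ → ℝ → ℂ} (hh : Adm h)
    {ε σ t s : ℝ} (hε : 0 < ε) (hσ : |σ| = 1) (hts : t ≠ s) (x : ℝ) :
    ‖ift (fun ξ => Eo p (σ * ((t - s) / ε)) ξ * (a ξ * h s ξ)) x‖ₑ ≤
      ENNReal.ofReal (D * √ε) * (nL (h s) * rk t s) := by
  obtain ⟨ha, hD, hk⟩ := hK
  have hσ0 : σ ≠ 0 := by rintro rfl; simp at hσ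
  have hθ : σ * ((t - s) / ε) ≠ 0 := mul_ne_zero hσ0 (div_ne_zero (sub_ne_zero.2 hts) hε.ne')
  have := lemB (Eo_int hp ha (σ * ((t - s) / ε))) (K := D / √|σ * ((t - s) / ε)|)
    (div_pos hD (Real.sqrt_pos.2 (abs_pos.2 hθ))) (hk _ hθ) (hh.cont s) (hh.int s) x
  rw [rk_ofReal hD hε hσ hts] at this
  simp_rw [← mul_assoc] at this ⊢
  refine this.trans (le_of_eq ?_)
  ring

/-- bilinear version -/
lemma S_two {p : ℝ → ℝ} (hp : Continuous p) {a : ℝ → ℂ} {D : ℝ} (hK : KB p a D) {h : ℝ → ℝ → ℂ} (hh : Adm h)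
    {ε σ t s : ℝ} (hε : 0 < ε) (hσ : |σ| = 1) (hts : t ≠ s) :
    ‖∫ ξ, Eo p (σ * ((t - s) / ε)) ξ * a ξ * h s ξ * starRingEnd ℂ (h t ξ)‖ₑ ≤
      ENNReal.ofReal (D * √ε) * (nL (h s) * nL (h t) * rk t s) := by
  obtain ⟨ha, hD, hk⟩ := hK
  have hσ0 : σ ≠ 0 := by rintro rfl; simp at hσ
  have hθ : σ * ((t - s) / ε) ≠ 0 := mul_ne_zero hσ0 (div_ne_zero (sub_ne_zero.2 hts) hε.ne')
  have := lemC (Eo_int hp ha (σ * ((t - s) / ε))) (K := D / √|σ * ((t - s) / ε)|)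
    (div_pos hD (Real.sqrt_pos.2 (abs_pos.2 hθ))) (hk _ hθ) (hh.cont s) (hh.int s) (hh.cont t) (hh.int t)
  rw [rk_ofReal hD hε hσ hts] at this
  refine this.trans (le_of_eq ?_)
  ring

/-- time norm 4/3 -/
noncomputable def N43 (T : ℝ) (F : ℝ → ℝ≥0∞) : ℝ≥0∞ := (∫⁻ s in Set.Ioo 0 T, F s ^ (4/3 : ℝ)) ^ (3/4 : ℝ)

lemma N43_ind (T : ℝ) (F : ℝ → ℝ≥0∞) :
    (∫⁻ s, (Set.Ioo 0 T).indicator F s ^ (4/3 : ℝ)) ^ (3/4 : ℝ) = N43 T F := by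
  unfold N43
  rw [← lintegral_indicator measurableSet_Ioo]
  congr 2; ext s
  simp only [Set.indicator_apply]
  split_ifs
  · rfl
  · exact ENNReal.zero_rpow_of_pos (by norm_num)

lemma N43_add (T : ℝ) {F1 F2 : ℝ → ℝ≥0∞} (h1 : Measurable F1) (h2 : Measurable F2) :
    N43 T (fun s => F1 s + F2 s) ≤ N43 T F1 + N43 T F2 := by
  unfold N43
  have := ENNReal.lintegral_Lp_add_le (μ := volume.restrict (Set.Ioo 0 T)) h1.aemeasurable h2.aemeasurable (p := 4/3) (by norm_num)
  norm_num at this ⊢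
  exact this

/-- assembled estimate into L4 Linfty -/
lemma est_inf {p : ℝ → ℝ} (hp : Continuous p) {a1 a2 : ℝ → ℂ} {D : ℝ} (hK1 : KB p a1 D) (hK2 : KB p a2 D)
    {h1 h2 g : ℝ → ℝ → ℂ} (hh1 : Adm h1) (hh2 : Adm h2)
    (hi1 : ∀ s, Integrable fun ξ => a1 ξ * h1 s ξ) (hi2 : ∀ s, Integrable fun ξ => a2 ξ * h2 s ξ)
    (hg : ∀ s ξ, g s ξ = a1 ξ * h1 s ξ + a2 ξ * h2 s ξ)
    {ε σ T : ℝ} (hε : 0 < ε) (hσ : |σ| = 1) :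
    (∫⁻ t in Set.Ioo 0 T, (eLpNorm (fun x => ∫ s in (0:ℝ)..t, (kc : ℂ) *
        ift (fun ξ => Eo p (σ * ((t - s) / ε)) ξ * g s ξ) x) ⊤ volume) ^ (4:ℝ)) ^ (1/4 : ℝ) ≤
      ENNReal.ofReal (12 * (D * √ε)) * (N43 T (fun s => nL (h1 s)) + N43 T (fun s => nL (h2 s))) := by
  set F : ℝ → ℝ≥0∞ := fun s => nL (h1 s) + nL (h2 s) with hF
  have hFm : Measurable F := hh1.nL_meas.add hh2.nL_meas
  set Fi := (Set.Ioo 0 T).indicator F with hFi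
  have hFim : Measurable Fi := hFm.indicator measurableSet_Ioo
  have hb : ∀ t ∈ Set.Ioo 0 T, (eLpNorm (fun x => ∫ s in (0:ℝ)..t, (kc : ℂ) *
        ift (fun ξ => Eo p (σ * ((t - s) / ε)) ξ * g s ξ) x) ⊤ volume) ≤
        ENNReal.ofReal (D * √ε) * ∫⁻ s, Fi s * rk t s := by
    intro t ht
    rw [eLpNorm_exponent_top]
    refine essSup_le_of_ae_le _ (Filter.Eventually.of_forall fun x => ?_)
    beta_reduce
    rw [intervalIntegral.integral_of_le ht.1.le]
    refine (enorm_integral_le_lintegral_enorm _).trans ?_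
    rw [← lintegral_const_mul' _ _ ENNReal.ofReal_ne_top, ← lintegral_indicator measurableSet_Ioc]
    apply lintegral_mono_ae
    filter_upwards [compl_mem_ae_iff.2 (measure_singleton t)] with s hs
    have hst : t ≠ s := fun h => hs h.symm
    simp only [Set.indicator_apply]
    split_ifs with hmem
    swap
    · exact zero_le
    have hs' : s ∈ Set.Ioo 0 T := ⟨hmem.1, hmem.2.trans_lt ht.2⟩
    have e1 : Fi s = nL (h1 s) + nL (h2 s) := by rw [hFi, Set.indicator_of_mem hs']
    rw [e1, add_mul, mul_add]
    have e2 : ift (fun ξ => Eo p (σ * ((t - s) / ε)) ξ * g s ξ) x =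
        ift (fun ξ => Eo p (σ * ((t - s) / ε)) ξ * (a1 ξ * h1 s ξ)) x +
        ift (fun ξ => Eo p (σ * ((t - s) / ε)) ξ * (a2 ξ * h2 s ξ)) x := by
      unfold ift
      rw [← integral_add]
      · congr 1; ext ξ; simp only [hg]; ring
      · refine (Eo_int hp (hi1 s) _).bdd_mul (c := 1) ?_ (Filter.Eventually.of_forall fun ξ => (norm_exp_I _).le)
        apply Continuous.aestronglyMeasurable; fun_prop
      · refine (Eo_int hp (hi2 s) _).bdd_mul (c := 1) ?_ (Filter.Eventually.of_forall fun ξ => (norm_exp_I _).le)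
        apply Continuous.aestronglyMeasurable; fun_prop
    rw [enorm_mul, e2]
    have hk : ‖(kc : ℂ)‖ₑ ≤ 1 := by
      rw [← ofReal_norm, Complex.norm_real, Real.norm_of_nonneg kc_pos.le]
      exact ENNReal.ofReal_le_one.2 kc_le_one
    calc _ ≤ 1 * (‖ift (fun ξ => Eo p (σ * ((t - s) / ε)) ξ * (a1 ξ * h1 s ξ)) x‖ₑ +
        ‖ift (fun ξ => Eo p (σ * ((t - s) / ε)) ξ * (a2 ξ * h2 s ξ)) x‖ₑ) := by
          gcongr; exact enorm_add_le _ _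
      _ ≤ _ := by
          rw [one_mul]
          exact add_le_add (S_inf hp hK1 hh1 hε hσ hst x) (S_inf hp hK2 hh2 hε hσ hst x)
  calc _ ≤ (∫⁻ t in Set.Ioo 0 T, (ENNReal.ofReal (D * √ε) * ∫⁻ s, Fi s * rk t s) ^ (4:ℝ)) ^ (1/4 : ℝ) := by
        gcongr ?_ ^ (1/4 : ℝ)
        apply setLIntegral_mono' measurableSet_Ioo
        intro t ht
        gcongr
        exact hb t ht
    _ = ENNReal.ofReal (D * √ε) * (∫⁻ t in Set.Ioo 0 T, (∫⁻ s, Fi s * rk t s) ^ (4:ℝ)) ^ (1/4 : ℝ) := by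
        simp_rw [ENNReal.mul_rpow_of_nonneg _ _ (by norm_num : (0:ℝ) ≤ 4)]
        rw [lintegral_const_mul' _ _ (ENNReal.rpow_ne_top_of_nonneg (by norm_num) ENNReal.ofReal_ne_top),
          ENNReal.mul_rpow_of_nonneg _ _ (by norm_num : (0:ℝ) ≤ 1/4), ← ENNReal.rpow_mul]
        norm_num
    _ ≤ ENNReal.ofReal (D * √ε) * (12 * (∫⁻ s, Fi s ^ (4/3 : ℝ)) ^ (3/4 : ℝ)) := by
        gcongr; exact hls_L4 hFim T
    _ ≤ ENNReal.ofReal (D * √ε) * (12 * (N43 T (fun s => nL (h1 s)) + N43 T (fun s => nL (h2 s)))) := by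
        gcongr
        rw [hFi, N43_ind]
        exact N43_add T hh1.nL_meas hh2.nL_meas
    _ = _ := by
        rw [ENNReal.ofReal_mul (p := 12) (by norm_num)]
        norm_num
        ring

/-- time superposition -/
noncomputable def Vt (p : ℝ → ℝ) (ε σ t : ℝ) (h : ℝ → ℝ → ℂ) (ξ : ℝ) : ℂ :=
  ∫ s in (0:ℝ)..t, Eo p (σ * ((t - s) / ε)) ξ * h s ξ

lemma Eh_cont {p : ℝ → ℝ} (hp : Continuous p) {h : ℝ → ℝ → ℂ} (hh : Adm h) (ε σ t : ℝ) :
    Continuous (fun q : ℝ × ℝ => Eo p (σ * ((t - q.1) / ε)) q.2 * h q.1 q.2) := by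
  have h1 : Continuous (fun q : ℝ × ℝ => h q.1 q.2) := hh.1
  have h2 : Continuous (fun q : ℝ × ℝ => Eo p (σ * ((t - q.1) / ε)) q.2) :=
    (Eo_cont hp).comp (by fun_prop : Continuous fun q : ℝ × ℝ => (σ * ((t - q.1) / ε), q.2))
  exact h2.mul h1

lemma par_cont {k : ℝ → ℝ → ℂ} (hk : Continuous fun q : ℝ × ℝ => k q.1 q.2) (t : ℝ) :
    Continuous fun ξ => ∫ s in (0:ℝ)..t, k s ξ := by
  have hc : Continuous (Function.uncurry fun ξ s => k s ξ) :=
    Continuous.comp (g := fun q : ℝ × ℝ => k q.1 q.2) (f := fun q : ℝ × ℝ => (q.2, q.1)) hk (by fun_prop)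
  exact intervalIntegral.continuous_parametric_intervalIntegral_of_continuous' hc 0 t

lemma Vt_cont {p : ℝ → ℝ} (hp : Continuous p) {h : ℝ → ℝ → ℂ} (hh : Adm h) (ε σ t : ℝ) :
    Continuous (Vt p ε σ t h) :=
  par_cont (k := fun s ξ => Eo p (σ * ((t - s) / ε)) ξ * h s ξ) (Eh_cont hp hh ε σ t) t

lemma Vt_bound {p : ℝ → ℝ} {h : ℝ → ℝ → ℂ} (hh : Adm h) (ε σ t : ℝ) (ht : 0 < t) :
    ∃ B, 0 ≤ B ∧ ∀ ξ, ‖Vt p ε σ t h ξ‖ ≤ B * (1 + ξ ^ 2)⁻¹ := by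
  obtain ⟨B, hB⟩ := hh.2
  have hB0 : 0 ≤ B := by
    have := (norm_nonneg _).trans (hB 0 0)
    simpa using this
  refine ⟨B * t, by positivity, fun ξ => ?_⟩
  unfold Vt
  have := intervalIntegral.norm_integral_le_of_norm_le_const (a := 0) (b := t) (C := B * (1 + ξ ^ 2)⁻¹)
    (f := fun s => Eo p (σ * ((t - s) / ε)) ξ * h s ξ) (fun s _ => by rw [norm_mul, Eo_norm, one_mul]; exact hB s ξ)
  rw [sub_zero, abs_of_pos ht] at this
  refine this.trans (le_of_eq (by ring))

lemma Vt_int {p : ℝ → ℝ} (hp : Continuous p) {h : ℝ → ℝ → ℂ} (hh : Adm h) (ε σ t : ℝ) (ht : 0 < t) :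
    Integrable (Vt p ε σ t h) := by
  obtain ⟨B, hB0, hB⟩ := Vt_bound (p := p) hh ε σ t ht
  exact (integrable_inv_one_add_sq.const_mul B).mono' (Vt_cont hp hh ε σ t).aestronglyMeasurable
    (Filter.Eventually.of_forall hB)

lemma inv_one_add_sq_le_one (ξ : ℝ) : (1 + ξ ^ 2)⁻¹ ≤ 1 := inv_le_one_of_one_le₀ (by nlinarith [sq_nonneg ξ])

lemma Vt_mem {p : ℝ → ℝ} (hp : Continuous p) {h : ℝ → ℝ → ℂ} (hh : Adm h) (ε σ t : ℝ) (ht : 0 < t) :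
    MemLp (Vt p ε σ t h) 2 volume := by
  obtain ⟨B, hB0, hB⟩ := Vt_bound (p := p) hh ε σ t ht
  have hc := Vt_cont hp hh ε σ t
  rw [memLp_two_iff_integrable_sq_norm hc.aestronglyMeasurable]
  refine (integrable_inv_one_add_sq.const_mul (B ^ 2)).mono' (by fun_prop) (Filter.Eventually.of_forall fun ξ => ?_)
  rw [Real.norm_of_nonneg (by positivity)]
  calc ‖Vt p ε σ t h ξ‖ ^ 2 ≤ (B * (1 + ξ ^ 2)⁻¹) ^ 2 := by gcongr; exact hB ξ
    _ = B ^ 2 * ((1 + ξ ^ 2)⁻¹ * (1 + ξ ^ 2)⁻¹) := by ring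
    _ ≤ B ^ 2 * (1 * (1 + ξ ^ 2)⁻¹) := by gcongr; exact inv_one_add_sq_le_one ξ
    _ = _ := by ring

lemma u_eq {p : ℝ → ℝ} (hp : Continuous p) {h : ℝ → ℝ → ℂ} (hh : Adm h) (ε σ t : ℝ) (ht : 0 < t) (x : ℝ) :
    (∫ s in (0:ℝ)..t, (kc : ℂ) * ift (fun ξ => Eo p (σ * ((t - s) / ε)) ξ * h s ξ) x) =
      (kc : ℂ) * ift (Vt p ε σ t h) x := by
  obtain ⟨B, hB⟩ := hh.2
  rw [intervalIntegral.integral_const_mul]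
  congr 1
  unfold ift Vt
  simp_rw [intervalIntegral.integral_of_le ht.le]
  rw [integral_integral_swap]
  · congr 1; ext ξ
    rw [integral_const_mul]
  · have h1 : Integrable (fun q : ℝ × ℝ => (1:ℝ) * (B * (1 + q.2 ^ 2)⁻¹)) ((volume.restrict (Set.Ioc 0 t)).prod volume) :=
      (integrable_const (μ := volume.restrict (Set.Ioc 0 t)) (1:ℝ)).mul_prod (integrable_inv_one_add_sq.const_mul B)
    refine h1.mono' ?_ (Filter.Eventually.of_forall fun q => ?_)
    · apply Continuous.aestronglyMeasurable
      have := Eh_cont hp hh ε σ t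
      unfold Function.uncurry
      exact (by fun_prop : Continuous fun q : ℝ × ℝ => cexp (I * ((x * q.2 : ℝ) : ℂ))).mul this
    · simp only [Function.uncurry, norm_mul, norm_exp_I, Eo_norm, one_mul]
      exact hB _ _

lemma V_two {p : ℝ → ℝ} (hp : Continuous p) {aa : ℝ → ℝ} (ha0 : ∀ ξ, 0 ≤ aa ξ) {D : ℝ}
    (hK : KB p (fun ξ => (aa ξ : ℂ)) D) {h : ℝ → ℝ → ℂ} (hh : Adm h)
    {ε σ t T : ℝ} (hε : 0 < ε) (hσ : |σ| = 1) (ht : t ∈ Set.Ioo 0 T) :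
    ∫⁻ ξ, ENNReal.ofReal (aa ξ * ‖Vt p ε σ t h ξ‖ ^ 2) ≤
      ENNReal.ofReal (12 * (D * √ε)) * (N43 T (fun s => nL (h s)) * N43 T (fun s => nL (h s))) := by
  obtain ⟨B, hB⟩ := hh.2
  have hB0 : 0 ≤ B := by
    have := (norm_nonneg _).trans (hB 0 0)
    simpa using this
  have hB' : ∀ s ξ, ‖h s ξ‖ ≤ B := fun s ξ => (hB s ξ).trans (by
    calc B * (1 + ξ ^ 2)⁻¹ ≤ B * 1 := by gcongr; exact inv_one_add_sq_le_one ξ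
      _ = B := mul_one B)
  obtain ⟨B1, hB10, hB1⟩ := Vt_bound (p := p) hh ε σ t ht.1
  have hVb : ∀ ξ, ‖Vt p ε σ t h ξ‖ ≤ B1 := fun ξ => (hB1 ξ).trans (by
    calc B1 * (1 + ξ ^ 2)⁻¹ ≤ B1 * 1 := by gcongr; exact inv_one_add_sq_le_one ξ
      _ = B1 := mul_one B1)
  have hVc := Vt_cont hp hh ε σ t
  have haC := hK.1
  have haI : Integrable aa := by
    have := haC.re
    simpa using this
  have hintg : Integrable (fun ξ => aa ξ * ‖Vt p ε σ t h ξ‖ ^ 2) := by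
    refine (haI.bdd_mul (f := fun ξ => ‖Vt p ε σ t h ξ‖ ^ 2) (c := B1 ^ 2) (by fun_prop)
      (Filter.Eventually.of_forall fun ξ => ?_)).congr (Filter.Eventually.of_forall fun ξ => mul_comm _ _)
    rw [Real.norm_of_nonneg (by positivity)]
    gcongr; exact hVb ξ
  have hnn : 0 ≤ ∫ ξ, aa ξ * ‖Vt p ε σ t h ξ‖ ^ 2 := integral_nonneg fun ξ => mul_nonneg (ha0 ξ) (by positivity)
  rw [← ofReal_integral_eq_lintegral_ofReal hintg
    (Filter.Eventually.of_forall fun ξ => mul_nonneg (ha0 ξ) (by positivity))]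
  have e0 : ENNReal.ofReal (∫ ξ, aa ξ * ‖Vt p ε σ t h ξ‖ ^ 2) =
      ‖∫ ξ, ((aa ξ * ‖Vt p ε σ t h ξ‖ ^ 2 : ℝ) : ℂ)‖ₑ := by
    have e00 : ∫ ξ, ((aa ξ * ‖Vt p ε σ t h ξ‖ ^ 2 : ℝ) : ℂ) =
      ((∫ ξ, aa ξ * ‖Vt p ε σ t h ξ‖ ^ 2 : ℝ) : ℂ) := integral_complex_ofReal
    rw [e00, ← ofReal_norm, Complex.norm_real, Real.norm_of_nonneg hnn]
  rw [e0]
  set ν : Measure ℝ := volume.restrict (Set.Ioc 0 t) with hν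
  obtain ⟨f, hf⟩ : ∃ f : ℝ → ℝ → ℂ, f = fun s ξ => Eo p (σ * ((t - s) / ε)) ξ * h s ξ := ⟨_, rfl⟩
  have hfc : Continuous (fun q : ℝ × ℝ => f q.1 q.2) := by
    rw [hf]; exact Eh_cont hp hh ε σ t
  have e1 : ∀ ξ, ((aa ξ * ‖Vt p ε σ t h ξ‖ ^ 2 : ℝ) : ℂ) =
      ∫ z, (aa ξ : ℂ) * (f z.1 ξ * starRingEnd ℂ (f z.2 ξ)) ∂(ν.prod ν) := by
    intro ξ
    rw [integral_const_mul, integral_prod_mul (fun s => f s ξ) (fun s => starRingEnd ℂ (f s ξ)), integral_conj]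
    have : (∫ s, f s ξ ∂ν) = Vt p ε σ t h ξ := by
      unfold Vt; rw [intervalIntegral.integral_of_le ht.1.le, hf]
    rw [this, Complex.mul_conj, Complex.normSq_eq_norm_sq]
    push_cast; rfl
  simp_rw [e1]
  rw [integral_integral_swap]
  swap
  · have h1 : Integrable (fun q : ℝ × (ℝ × ℝ) => (aa q.1 : ℂ) * (1:ℂ)) (volume.prod (ν.prod ν)) :=
      haC.mul_prod (integrable_const (μ := ν.prod ν) (1:ℂ))
    have h2 := h1.bdd_mul (f := fun q : ℝ × (ℝ × ℝ) => f q.2.1 q.1 * starRingEnd ℂ (f q.2.2 q.1)) (c := B * B) ?_ ?_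
    · refine h2.congr (Filter.Eventually.of_forall fun q => ?_)
      simp only [Function.uncurry]; ring
    · apply Continuous.aestronglyMeasurable
      have c1 : Continuous fun q : ℝ × (ℝ × ℝ) => f q.2.1 q.1 :=
        Continuous.comp (g := fun q : ℝ × ℝ => f q.1 q.2) (f := fun q : ℝ × (ℝ × ℝ) => (q.2.1, q.1)) hfc (by fun_prop)
      have c2 : Continuous fun q : ℝ × (ℝ × ℝ) => f q.2.2 q.1 :=
        Continuous.comp (g := fun q : ℝ × ℝ => f q.1 q.2) (f := fun q : ℝ × (ℝ × ℝ) => (q.2.2, q.1)) hfc (by fun_prop)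
      exact c1.mul (Complex.continuous_conj.comp c2)
    · filter_upwards with q
      simp only [hf, norm_mul, RCLike.norm_conj, Eo_norm, one_mul]
      exact mul_le_mul (hB' _ _) (hB' _ _) (norm_nonneg _) hB0
  refine (enorm_integral_le_lintegral_enorm _).trans ?_
  set F : ℝ → ℝ≥0∞ := fun s => nL (h s) with hF
  have hFm : Measurable F := hh.nL_meas
  set Fi := (Set.Ioo 0 T).indicator F with hFi
  have hFim : Measurable Fi := hFm.indicator measurableSet_Ioo
  have hpt : ∀ s s', s ≠ s' → ‖∫ ξ, (aa ξ : ℂ) * (f s ξ * starRingEnd ℂ (f s' ξ))‖ₑ ≤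
      ENNReal.ofReal (D * √ε) * (F s * F s' * rk s s') := by
    intro s s' hss
    have := S_two hp hK hh hε hσ (t := s') (s := s) (fun h => hss h.symm)
    rw [rk_symm s' s] at this
    refine le_of_eq_of_le ?_ this
    congr 1
    congr 1; ext ξ
    simp only [hf, map_mul]
    have : Eo p (σ * ((s' - s) / ε)) ξ = Eo p (σ * ((t - s) / ε)) ξ * starRingEnd ℂ (Eo p (σ * ((t - s') / ε)) ξ) := by
      unfold Eo
      rw [← Complex.exp_conj, ← Complex.exp_add]
      congr 1
      rw [map_mul, Complex.conj_I, Complex.conj_ofReal]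
      push_cast; ring
    rw [this]; ring
  have hmeas : Measurable fun z : ℝ × ℝ => ENNReal.ofReal (D * √ε) * (Fi z.1 * Fi z.2 * rk z.1 z.2) := by
    have := rk_meas
    unfold Function.uncurry at this
    fun_prop
  have hae : ∀ᵐ z ∂(ν.prod ν), z.1 ≠ z.2 ∧ z.1 ∈ Set.Ioc 0 t ∧ z.2 ∈ Set.Ioc 0 t := by
    have hd : ∀ᵐ z ∂(ν.prod ν), z.1 ≠ z.2 := by
      have hm : MeasurableSet {z : ℝ × ℝ | z.1 ≠ z.2} := (measurableSet_eq_fun measurable_fst measurable_snd).compl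
      rw [Measure.ae_prod_iff_ae_ae hm]
      filter_upwards with x
      filter_upwards [compl_mem_ae_iff.2 (measure_singleton x)] with y hy
      exact fun h => hy h.symm
    have hr : ν.prod ν = (volume.prod volume).restrict (Set.Ioc 0 t ×ˢ Set.Ioc 0 t) := Measure.prod_restrict _ _
    have hm2 : ∀ᵐ z ∂(ν.prod ν), z ∈ Set.Ioc 0 t ×ˢ Set.Ioc 0 t := by
      rw [hr]; exact ae_restrict_mem (measurableSet_Ioc.prod measurableSet_Ioc)
    filter_upwards [hd, hm2] with z h1 h2
    exact ⟨h1, h2.1, h2.2⟩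
  calc _ ≤ ∫⁻ z, ENNReal.ofReal (D * √ε) * (Fi z.1 * Fi z.2 * rk z.1 z.2) ∂(ν.prod ν) := by
        apply lintegral_mono_ae
        filter_upwards [hae] with z hz
        have i1 : z.1 ∈ Set.Ioo 0 T := ⟨hz.2.1.1, hz.2.1.2.trans_lt ht.2⟩
        have i2 : z.2 ∈ Set.Ioo 0 T := ⟨hz.2.2.1, hz.2.2.2.trans_lt ht.2⟩
        rw [hFi, Set.indicator_of_mem i1, Set.indicator_of_mem i2]
        exact hpt z.1 z.2 hz.1
    _ = ∫⁻ x, ∫⁻ y, ENNReal.ofReal (D * √ε) * (Fi x * Fi y * rk x y) ∂ν ∂ν := lintegral_prod _ hmeas.aemeasurable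
    _ ≤ ∫⁻ x, ∫⁻ y, ENNReal.ofReal (D * √ε) * (Fi x * Fi y * rk x y) := by
        refine (lintegral_mono fun x => setLIntegral_le_lintegral _ _).trans (setLIntegral_le_lintegral _ _)
    _ = ENNReal.ofReal (D * √ε) * ∫⁻ x, ∫⁻ y, (Fi x * Fi y * rk x y) := by
        simp_rw [lintegral_const_mul' _ _ ENNReal.ofReal_ne_top]
    _ ≤ ENNReal.ofReal (D * √ε) * (12 * (N43 T F * N43 T F)) := by
        gcongr
        have := hls hFim hFim
        rwa [hFi, N43_ind] at this
    _ = _ := by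
        rw [ENNReal.ofReal_mul (p := 12) (by norm_num)]
        norm_num
        ring

lemma V_eLp {p : ℝ → ℝ} (hp : Continuous p) {c : ℝ → ℂ} {D : ℝ}
    (hK : KB p (fun ξ => ((‖c ξ‖ ^ 2 : ℝ) : ℂ)) D) {h : ℝ → ℝ → ℂ} (hh : Adm h)
    {ε σ t T : ℝ} (hε : 0 < ε) (hσ : |σ| = 1) (ht : t ∈ Set.Ioo 0 T) :
    eLpNorm (fun ξ => c ξ * Vt p ε σ t h ξ) 2 volume ≤
      ENNReal.ofReal ((12 * (D * √ε)) ^ (1/2 : ℝ)) * N43 T (fun s => nL (h s)) := by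
  have hD := hK.2.1
  have hεs : 0 < √ε := Real.sqrt_pos.2 hε
  have := V_two hp (fun ξ => by positivity) hK hh hε hσ ht
  rw [eLpNorm_eq_lintegral_rpow_enorm_toReal (by norm_num) (by norm_num)]
  have e : ∀ ξ, ‖c ξ * Vt p ε σ t h ξ‖ₑ ^ (2:ℝ≥0∞).toReal = ENNReal.ofReal (‖c ξ‖ ^ 2 * ‖Vt p ε σ t h ξ‖ ^ 2) := by
    intro ξ
    rw [← ofReal_norm, norm_mul, ENNReal.toReal_ofNat, ENNReal.ofReal_rpow_of_nonneg (by positivity) (by norm_num)]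
    congr 1
    rw [← mul_pow]; norm_cast
  simp_rw [e]
  rw [ENNReal.toReal_ofNat]
  calc _ ≤ (ENNReal.ofReal (12 * (D * √ε)) * (N43 T (fun s => nL (h s)) * N43 T (fun s => nL (h s)))) ^ (1/2 : ℝ) := by
        gcongr
    _ = _ := by
        rw [ENNReal.mul_rpow_of_nonneg _ _ (by norm_num), ENNReal.ofReal_rpow_of_nonneg (by positivity) (by norm_num)]
        congr 1
        rw [← pow_two, ← ENNReal.rpow_natCast, ← ENNReal.rpow_mul]
        norm_num

lemma est_two {p : ℝ → ℝ} (hp : Continuous p) {c1 c2 : ℝ → ℂ} (hc1 : Measurable c1) (hc2 : Measurable c2) {D : ℝ}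
    (hK1 : KB p (fun ξ => ((‖c1 ξ‖ ^ 2 : ℝ) : ℂ)) D) (hK2 : KB p (fun ξ => ((‖c2 ξ‖ ^ 2 : ℝ) : ℂ)) D)
    {h1 h2 g : ℝ → ℝ → ℂ} (hh1 : Adm h1) (hh2 : Adm h2) (hg : Adm g)
    (hgg : ∀ s ξ, g s ξ = c1 ξ * h1 s ξ + c2 ξ * h2 s ξ)
    {ε σ t T : ℝ} (hε : 0 < ε) (hσ : |σ| = 1) (ht : t ∈ Set.Ioo 0 T) :
    eLpNorm (fun x => ∫ s in (0:ℝ)..t, (kc : ℂ) *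
        ift (fun ξ => Eo p (σ * ((t - s) / ε)) ξ * g s ξ) x) 2 volume ≤
      ENNReal.ofReal ((12 * (D * √ε)) ^ (1/2 : ℝ)) * (N43 T (fun s => nL (h1 s)) + N43 T (fun s => nL (h2 s))) := by
  simp_rw [u_eq hp hg ε σ t ht.1]
  rw [ift_L2 (Vt_int hp hg ε σ t ht.1) (Vt_mem hp hg ε σ t ht.1)]
  have e : Vt p ε σ t g = (fun ξ => c1 ξ * Vt p ε σ t h1 ξ) + (fun ξ => c2 ξ * Vt p ε σ t h2 ξ) := by
    ext ξ
    simp only [Pi.add_apply, Vt]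
    rw [← intervalIntegral.integral_const_mul, ← intervalIntegral.integral_const_mul, ← intervalIntegral.integral_add]
    · congr 1; ext s; rw [hgg]; ring
    · apply Continuous.intervalIntegrable
      have := (Eh_cont hp hh1 ε σ t).comp (by fun_prop : Continuous fun s : ℝ => (s, ξ))
      exact continuous_const.mul this
    · apply Continuous.intervalIntegrable
      have := (Eh_cont hp hh2 ε σ t).comp (by fun_prop : Continuous fun s : ℝ => (s, ξ))
      exact continuous_const.mul this
  rw [e, mul_add]
  refine (eLpNorm_add_le ?_ ?_ (by norm_num)).trans (add_le_add (V_eLp hp hK1 hh1 hε hσ ht) (V_eLp hp hK2 hh2 hε hσ ht))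
  · exact (hc1.mul (Vt_cont hp hh1 ε σ t).measurable).aestronglyMeasurable
  · exact (hc2.mul (Vt_cont hp hh2 ε σ t).measurable).aestronglyMeasurable

lemma ft1_eq (f : SchwartzMap ℝ ℂ) (ξ : ℝ) :
    ft1 f ξ = (kc : ℂ) * (FourierTransform.fourier f : SchwartzMap ℝ ℂ) ((2 * π)⁻¹ * ξ) := by
  rw [SchwartzMap.fourier_coe, Real.fourier_real_eq_integral_exp_smul]
  unfold ft1 kc
  congr 2; ext x
  rw [smul_eq_mul]
  congr 2
  have : (π : ℂ) ≠ 0 := by exact_mod_cast Real.pi_ne_zero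
  push_cast
  field_simp

lemma fs_cont {T : ℝ} (hT : 0 < T) {G : ℝ → SchwartzMap ℝ ℂ} (hG : ContinuousOn G (Set.Icc 0 T)) :
    Continuous (fun s => (FourierTransform.fourier (G (Set.projIcc 0 T hT.le s)) : SchwartzMap ℝ ℂ)) := by
  have h1 : Continuous (fun s => G (Set.projIcc 0 T hT.le s)) :=
    (continuousOn_iff_continuous_domRestrict.1 hG).comp continuous_projIcc
  exact (SchwartzMap.fourierTransformCLM ℂ).continuous.comp h1

lemma fs_bound {T : ℝ} (hT : 0 < T) {G : ℝ → SchwartzMap ℝ ℂ} (hG : ContinuousOn G (Set.Icc 0 T)) :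
    ∃ B, 0 ≤ B ∧ ∀ s y, (1 + |y|) ^ 6 *
      ‖(FourierTransform.fourier (G (Set.projIcc 0 T hT.le s)) : SchwartzMap ℝ ℂ) y‖ ≤ B := by
  set P : Seminorm ℂ (SchwartzMap ℝ ℂ) :=
    (Finset.Iic ((6:ℕ),(0:ℕ))).sup (fun m => SchwartzMap.seminorm ℂ m.1 m.2) with hP
  have hPc : Continuous P := by
    apply Seminorm.continuous_finsetSup
    intro i _
    exact (schwartz_withSeminorms ℂ ℝ ℂ).continuous_seminorm i
  have h1 : ContinuousOn (fun s => P (FourierTransform.fourier (G (Set.projIcc 0 T hT.le s)))) (Set.Icc 0 T) :=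
    (hPc.comp (fs_cont hT hG)).continuousOn
  obtain ⟨B, hB⟩ := isCompact_Icc.exists_bound_of_continuousOn h1
  refine ⟨2 ^ 6 * B, ?_, fun s y => ?_⟩
  · have := (norm_nonneg _).trans (hB 0 ⟨le_rfl, hT.le⟩)
    positivity
  · have h2 := SchwartzMap.one_add_le_sup_seminorm_apply (𝕜 := ℂ) (m := (6,0)) (k := 6) (n := 0) le_rfl le_rfl
      (FourierTransform.fourier (G (Set.projIcc 0 T hT.le s)) : SchwartzMap ℝ ℂ) y
    rw [norm_iteratedFDeriv_zero, Real.norm_eq_abs] at h2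
    refine h2.trans ?_
    have h3 := hB (Set.projIcc 0 T hT.le s) (Set.projIcc 0 T hT.le s).2
    rw [Set.projIcc_val] at h3
    have h4 := (Real.le_norm_self _).trans h3
    exact mul_le_mul_of_nonneg_left h4 (by norm_num)

lemma fs_joint {T : ℝ} (hT : 0 < T) {G : ℝ → SchwartzMap ℝ ℂ} (hG : ContinuousOn G (Set.Icc 0 T)) :
    Continuous (fun q : ℝ × ℝ => ft1 (G (Set.projIcc 0 T hT.le q.1)) q.2) := by
  simp_rw [ft1_eq]
  have h1 := ((SchwartzMap.toBoundedContinuousFunctionCLM ℂ ℝ ℂ).continuous.comp (fs_cont hT hG))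
  have h2 : Continuous (fun q : ℝ × ℝ => (SchwartzMap.toBoundedContinuousFunctionCLM ℂ ℝ ℂ
      (FourierTransform.fourier (G (Set.projIcc 0 T hT.le q.1)) : SchwartzMap ℝ ℂ)) ((2 * π)⁻¹ * q.2)) :=
    (h1.comp continuous_fst).eval (by fun_prop)
  exact continuous_const.mul h2

lemma fs_adm {T : ℝ} (hT : 0 < T) {G : ℝ → SchwartzMap ℝ ℂ} (hG : ContinuousOn G (Set.Icc 0 T))
    {n : ℝ → ℂ} (hn : Continuous n) {K : ℝ} (hnb : ∀ ξ, ‖n ξ‖ ≤ K * (1 + ξ ^ 2) ^ 2) :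
    Adm (fun s ξ => n ξ * ft1 (G (Set.projIcc 0 T hT.le s)) ξ) := by
  constructor
  · exact (hn.comp continuous_snd).mul (fs_joint hT hG)
  · obtain ⟨B, hB0, hB⟩ := fs_bound hT hG
    refine ⟨K * ((2 * π) ^ 6 * (kc * B)), fun s ξ => ?_⟩
    have hK : 0 ≤ K := by
      have := (norm_nonneg _).trans (hnb 0)
      simpa using this
    rw [norm_mul, ← div_eq_mul_inv, le_div_iff₀ (by positivity), ft1_eq, norm_mul, Complex.norm_real,
      Real.norm_of_nonneg kc_pos.le]
    set y := (2 * π)⁻¹ * ξ with hy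
    have hξ : ξ = 2 * π * y := by rw [hy]; field_simp
    have h1 := hB s y
    set X := ‖(FourierTransform.fourier (G (Set.projIcc 0 T hT.le s)) : SchwartzMap ℝ ℂ) y‖ with hX
    have hpi : 1 ≤ (2 * π) ^ 2 := by nlinarith [Real.pi_gt_three]
    have h3 : 1 + ξ ^ 2 ≤ (2 * π) ^ 2 * (1 + |y|) ^ 2 := by
      rw [hξ, mul_pow, ← sq_abs y]
      have := abs_nonneg y
      have : 0 ≤ (2 * π) ^ 2 * (2 * |y|) := by positivity
      nlinarith
    have h4 : (1 + ξ ^ 2) ^ 3 ≤ (2 * π) ^ 6 * (1 + |y|) ^ 6 := by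
      calc _ ≤ ((2 * π) ^ 2 * (1 + |y|) ^ 2) ^ 3 := by gcongr
        _ = _ := by ring
    have hk := kc_pos
    calc ‖n ξ‖ * (kc * X) * (1 + ξ ^ 2) ≤ (K * (1 + ξ ^ 2) ^ 2) * (kc * X) * (1 + ξ ^ 2) := by
          gcongr; exact hnb ξ
      _ = K * (kc * X) * (1 + ξ ^ 2) ^ 3 := by ring
      _ ≤ K * (kc * X) * ((2 * π) ^ 6 * (1 + |y|) ^ 6) := by gcongr
      _ = K * ((2 * π) ^ 6 * (kc * ((1 + |y|) ^ 6 * X))) := by ring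
      _ ≤ _ := by gcongr

/-- the phase function -/
noncomputable def ph (μ ξ : ℝ) : ℝ := ξ / √(1 + μ * ξ ^ 2 / 3)

lemma ph_cont {μ : ℝ} (hμ : 0 < μ) : Continuous (ph μ) := by
  unfold ph
  apply continuous_id.div (by fun_prop)
  intro ξ
  have : 0 < 1 + μ * ξ ^ 2 / 3 := by positivity
  exact (Real.sqrt_pos.2 this).ne'

lemma prop1_eq (σ τ μ ξ : ℝ) : prop1 σ τ μ ξ = Eo (ph μ) (σ * τ) ξ := by
  unfold prop1 Eo ph
  rw [mul_div_assoc]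

lemma fmult1_eq (m f : ℝ → ℂ) (x : ℝ) : fmult1 m f x = (kc : ℂ) * ift (fun ξ => m ξ * ft1 f ξ) x := by
  unfold fmult1 kc ift
  congr 2; ext ξ; rw [mul_assoc]

lemma KB_of {μ D : ℝ} {a : ℝ → ℂ} (ha : Integrable a) (hD : 0 < D)
    (h : ∀ θ y : ℝ, θ ≠ 0 → ‖∫ ξ : ℝ, cexp (I * ((θ * (ξ / √(1 + μ * ξ ^ 2 / 3)) + y * ξ : ℝ) : ℂ)) * a ξ‖ ≤
      D / √|θ|) : KB (ph μ) a D := by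
  refine ⟨ha, hD, fun θ hθ y => ?_⟩
  refine le_of_eq_of_le ?_ (h θ y hθ)
  congr 1
  unfold ift Eo ph
  congr 1; ext ξ
  rw [← mul_assoc, ← Complex.exp_add]
  congr 2
  push_cast; ring

lemma KB.const_mul {p : ℝ → ℝ} {a : ℝ → ℂ} {D : ℝ} (h : KB p a D) {z : ℂ} (hz : ‖z‖ = 1) :
    KB p (fun ξ => z * a ξ) D := by
  refine ⟨h.1.const_mul z, h.2.1, fun θ hθ y => ?_⟩
  have e : ift (fun ξ => Eo p θ ξ * (z * a ξ)) y = z * ift (fun ξ => Eo p θ ξ * a ξ) y := by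
    unfold ift
    rw [← integral_const_mul]
    congr 1; ext ξ; ring
  rw [e, norm_mul, hz, one_mul]
  exact h.2.2 θ hθ y

lemma KB.mono {p : ℝ → ℝ} {a : ℝ → ℂ} {D D' : ℝ} (h : KB p a D) (hD : D ≤ D') : KB p a D' := by
  refine ⟨h.1, h.2.1.trans_le hD, fun θ hθ y => (h.2.2 θ hθ y).trans ?_⟩
  gcongr

lemma timeLp_43 (T : ℝ) (F : ℝ → ℝ≥0∞) : timeLp (4 / 3 : ℝ≥0∞) T F = N43 T F := by
  unfold timeLp N43
  rw [if_neg (ENNReal.div_ne_top (by norm_num) (by norm_num))]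
  have : (4 / 3 : ℝ≥0∞).toReal = 4 / 3 := by rw [ENNReal.toReal_div]; norm_num
  rw [this]; norm_num

lemma timeLp_4 (T : ℝ) (F : ℝ → ℝ≥0∞) : timeLp 4 T F = (∫⁻ t in Set.Ioo 0 T, (F t) ^ (4:ℝ)) ^ (1/4 : ℝ) := by
  unfold timeLp
  rw [if_neg (by norm_num)]
  have : (4 : ℝ≥0∞).toReal = 4 := by norm_num
  rw [this]

lemma timeLp_top_le (T : ℝ) (F : ℝ → ℝ≥0∞) (M : ℝ≥0∞) (h : ∀ t ∈ Set.Ioo 0 T, F t ≤ M) : timeLp ⊤ T F ≤ M := by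
  unfold timeLp
  rw [if_pos rfl]
  refine essSup_le_of_ae_le _ ?_
  filter_upwards [ae_restrict_mem measurableSet_Ioo] with t ht using h t ht

lemma N43_congr {T : ℝ} {F F' : ℝ → ℝ≥0∞} (h : ∀ t ∈ Set.Ioo 0 T, F t = F' t) : N43 T F = N43 T F' := by
  unfold N43
  congr 1
  apply setLIntegral_congr_fun measurableSet_Ioo
  intro t ht
  simp only [h t ht]

lemma chi_data (χ : ℝ → ℝ) (hχ : ContDiff ℝ (⊤ : ℕ∞) χ) (hχc : HasCompactSupport χ)
    (hχ1 : ∀ᶠ y in nhds (0 : ℝ), χ y = 1) :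
    ∃ b c M : ℝ, 1 ≤ b ∧ 0 < c ∧ c ≤ 1 ∧ 0 ≤ M ∧ (∀ y, b < |y| → χ y = 0) ∧ (∀ y, |y| ≤ c → χ y = 1) ∧
      ∀ y, |χ y| ≤ M := by
  obtain ⟨M, hM⟩ := hχc.exists_bound_of_continuous hχ.continuous
  obtain ⟨R, hR⟩ := hχc.isCompact.isBounded.subset_closedBall 0
  obtain ⟨δ, hδ, hδ1⟩ := Metric.eventually_nhds_iff.1 hχ1
  refine ⟨max 1 R, min (δ / 2) 1, M, le_max_left _ _, by positivity, min_le_right _ _,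
    (norm_nonneg _).trans (hM 0), fun y hy => ?_, fun y hy => ?_, fun y => hM y⟩
  · by_contra h
    have := hR (subset_tsupport _ h)
    rw [mem_closedBall_zero_iff, Real.norm_eq_abs] at this
    exact absurd (this.trans (le_max_right 1 R)) (not_le.2 hy)
  · apply hδ1
    rw [dist_zero_right, Real.norm_eq_abs]
    have := hy.trans (min_le_left _ _)
    linarith

lemma rpow_le_quad {x e : ℝ} (hx : 0 ≤ x) (he : 0 ≤ e) (he2 : e ≤ 2) : x ^ e ≤ 1 + x ^ 2 := by
  rcases le_total x 1 with h | h
  · have := Real.rpow_le_one hx h he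
    nlinarith [sq_nonneg x]
  · have := Real.rpow_le_rpow_of_exponent_le h he2
    rw [Real.rpow_two] at this
    linarith

lemma adm1 {T : ℝ} (hT : 0 < T) {G : ℝ → SchwartzMap ℝ ℂ} (hG : ContinuousOn G (Set.Icc 0 T))
    {χ : ℝ → ℝ} (hχ : Continuous χ) {M : ℝ} (hM : ∀ y, |χ y| ≤ M) (μ : ℝ) {e : ℝ} (he : 0 ≤ e) (he2 : e ≤ 2) :
    Adm (fun s ξ => ((|ξ| ^ e * χ (√μ * |ξ|) : ℝ) : ℂ) * ft1 (G (Set.projIcc 0 T hT.le s)) ξ) := by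
  have hM0 : 0 ≤ M := (abs_nonneg _).trans (hM 0)
  apply fs_adm hT hG (K := M)
  · have : Continuous fun ξ : ℝ => |ξ| ^ e := continuous_abs.rpow_const (fun _ => Or.inr he)
    fun_prop
  · intro ξ
    rw [Complex.norm_real, Real.norm_eq_abs, abs_mul, abs_of_nonneg (by positivity : 0 ≤ |ξ| ^ e)]
    have h1 := rpow_le_quad (abs_nonneg ξ) he he2
    rw [sq_abs] at h1
    calc |ξ| ^ e * |χ (√μ * |ξ|)| ≤ (1 + ξ ^ 2) * M := by gcongr; exact hM _
      _ = M * (1 + ξ ^ 2) ^ 1 := by ring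
      _ ≤ M * (1 + ξ ^ 2) ^ 2 := by
        gcongr
        · nlinarith [sq_nonneg ξ]
        · norm_num

lemma adm2 {T : ℝ} (hT : 0 < T) {G : ℝ → SchwartzMap ℝ ℂ} (hG : ContinuousOn G (Set.Icc 0 T))
    {χ : ℝ → ℝ} (hχ : Continuous χ) {M : ℝ} (hM : ∀ y, |χ y| ≤ M) {μ : ℝ} (hμ1 : μ ≤ 1)
    {e : ℝ} (he : 0 ≤ e) (he2 : e ≤ 2) :
    Adm (fun s ξ => (((1 - χ (√μ * |ξ|)) * (√μ * |ξ|) ^ e : ℝ) : ℂ) * (I * (ξ : ℂ)) *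
      ft1 (G (Set.projIcc 0 T hT.le s)) ξ) := by
  have hM0 : 0 ≤ M := (abs_nonneg _).trans (hM 0)
  apply fs_adm hT hG (K := 1 + M)
  · have : Continuous fun ξ : ℝ => (√μ * |ξ|) ^ e :=
      (by fun_prop : Continuous fun ξ : ℝ => √μ * |ξ|).rpow_const (fun _ => Or.inr he)
    fun_prop
  · intro ξ
    rw [norm_mul, Complex.norm_real, Real.norm_eq_abs, abs_mul,
      abs_of_nonneg (by positivity : 0 ≤ (√μ * |ξ|) ^ e), norm_mul, Complex.norm_I, one_mul,
      Complex.norm_real, Real.norm_eq_abs]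
    have hs : √μ ≤ 1 := Real.sqrt_le_one.2 hμ1
    have hs2 : √μ * |ξ| ≤ |ξ| := by nlinarith [abs_nonneg ξ]
    have h1 := rpow_le_quad (abs_nonneg ξ) he he2
    rw [sq_abs] at h1
    have h2 : (√μ * |ξ|) ^ e ≤ |ξ| ^ e := by gcongr
    have h3 : |ξ| ≤ 1 + ξ ^ 2 := by rw [← sq_abs]; nlinarith [sq_nonneg (|ξ| - 1), sq_nonneg |ξ|]
    have h4 : |1 - χ (√μ * |ξ|)| ≤ 1 + M := (abs_sub _ _).trans (by rw [abs_one]; gcongr; exact hM _)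
    calc |1 - χ (√μ * |ξ|)| * (√μ * |ξ|) ^ e * |ξ| ≤ (1 + M) * (1 + ξ ^ 2) * (1 + ξ ^ 2) := by
          gcongr; exact h2.trans h1
      _ = _ := by ring

lemma adm0 {T : ℝ} (hT : 0 < T) {G : ℝ → SchwartzMap ℝ ℂ} (hG : ContinuousOn G (Set.Icc 0 T)) :
    Adm (fun s ξ => (I * (ξ : ℂ)) * ft1 (G (Set.projIcc 0 T hT.le s)) ξ) := by
  apply fs_adm hT hG (K := 1) (by fun_prop)
  intro ξ
  rw [norm_mul, Complex.norm_I, one_mul, Complex.norm_real, Real.norm_eq_abs]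
  have h3 : |ξ| ≤ 1 + ξ ^ 2 := by rw [← sq_abs]; nlinarith [sq_nonneg (|ξ| - 1), sq_nonneg |ξ|]
  nlinarith [sq_nonneg ξ]

lemma alg_low {χ : ℝ → ℝ} {b : ℝ} (hb : ∀ y, b < |y| → χ y = 0) (μ ξ : ℝ) {k e : ℝ} (hk : 0 < k) (he : 0 < e)
    (hke : k + e = 1) :
    ξ * χ (√μ * |ξ|) = (if √μ * |ξ| ≤ b then |ξ| ^ k else 0) * (if 0 < ξ then 1 else -1) *
      (|ξ| ^ e * χ (√μ * |ξ|)) := by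
  split_ifs with h1 h2 h2
  · have : |ξ| ^ k * |ξ| ^ e = |ξ| := by
      rw [← Real.rpow_add_of_nonneg (abs_nonneg _) hk.le he.le, hke, Real.rpow_one]
    rw [abs_of_pos h2] at *
    linear_combination (-χ (√μ * ξ)) * this
  · have : |ξ| ^ k * |ξ| ^ e = |ξ| := by
      rw [← Real.rpow_add_of_nonneg (abs_nonneg _) hk.le he.le, hke, Real.rpow_one]
    have h3 : ξ = -|ξ| := by rw [abs_of_nonpos (not_lt.1 h2)]; ring
    linear_combination (χ (√μ * |ξ|)) * this + χ (√μ * |ξ|) * h3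
  all_goals
    rw [hb _ (by rw [abs_of_nonneg (by positivity)]; exact not_le.1 h1)]
    simp

lemma alg_high {χ : ℝ → ℝ} {c : ℝ} (hc0 : 0 < c) (hc : ∀ y, |y| ≤ c → χ y = 1) (μ ξ : ℝ) (n : ℕ) {e : ℝ} (he : e = n) :
    1 - χ (√μ * |ξ|) = (if c < √μ * |ξ| then 1 / (√μ * |ξ|) ^ n else 0) *
      ((1 - χ (√μ * |ξ|)) * (√μ * |ξ|) ^ e) := by
  subst he
  rw [Real.rpow_natCast]
  split_ifs with h
  · have : 0 < √μ * |ξ| := hc0.trans h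
    field_simp
  · rw [hc _ (by rw [abs_of_nonneg (by positivity)]; exact not_lt.1 h)]
    simp

lemma u_rw {T : ℝ} (hT : 0 < T) (G : ℝ → SchwartzMap ℝ ℂ) (σ ε μ : ℝ) {t : ℝ} (ht : t ∈ Set.Ioo 0 T) :
    (fun x => ∫ s in (0 : ℝ)..t,
        fmult1 (fun ξ => prop1 σ ((t - s) / ε) μ ξ * (Complex.I * (ξ : ℂ))) (⇑(G s)) x) =
      fun x => ∫ s in (0:ℝ)..t, (kc : ℂ) * ift (fun ξ => Eo (ph μ) (σ * ((t - s) / ε)) ξ *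
        ((I * (ξ : ℂ)) * ft1 (G (Set.projIcc 0 T hT.le s)) ξ)) x := by
  ext x
  apply intervalIntegral.integral_congr
  intro s hs
  rw [Set.uIcc_of_le ht.1.le] at hs
  have : ((Set.projIcc 0 T hT.le s : Set.Icc 0 T) : ℝ) = s := by
    rw [Set.projIcc_of_mem hT.le ⟨hs.1, hs.2.trans ht.2.le⟩]
  simp only [this, fmult1_eq, prop1_eq, mul_assoc]

lemma N43_rw {T : ℝ} (hT : 0 < T) (G : ℝ → SchwartzMap ℝ ℂ) (m : ℝ → ℂ) :
    timeLp (4 / 3 : ℝ≥0∞) T (fun s => eLpNorm (fmult1 m (⇑(G s))) 1 volume) =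
      N43 T (fun s => nL (fun ξ => m ξ * ft1 (G (Set.projIcc 0 T hT.le s)) ξ)) := by
  rw [timeLp_43]
  apply N43_congr
  intro s hs
  have : ((Set.projIcc 0 T hT.le s : Set.Icc 0 T) : ℝ) = s := by
    rw [Set.projIcc_of_mem hT.le ⟨hs.1.le, hs.2.le⟩]
  unfold nL
  rw [this]
  congr 1; ext x; exact fmult1_eq _ _ _

lemma Adm.int_mul {h : ℝ → ℝ → ℂ} (hh : Adm h) {a : ℝ → ℂ} (ha : Integrable a) (s : ℝ) :
    Integrable fun ξ => a ξ * h s ξ := by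
  obtain ⟨B, hB⟩ := hh.2
  have hB0 : 0 ≤ B := by
    have := (norm_nonneg _).trans (hB 0 0)
    simpa using this
  refine (ha.bdd_mul (f := h s) (c := B) (hh.cont s).aestronglyMeasurable
    (Filter.Eventually.of_forall fun ξ => (hB s ξ).trans ?_)).congr
    (Filter.Eventually.of_forall fun ξ => mul_comm _ _)
  calc B * (1 + ξ ^ 2)⁻¹ ≤ B * 1 := by gcongr; exact inv_one_add_sq_le_one ξ
      _ = B := mul_one B

lemma sgn_meas (α : ℝ) : Measurable fun ξ : ℝ => (if 0 < ξ then (1:ℝ) else α) :=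
  Measurable.ite measurableSet_Ioi measurable_const measurable_const

lemma aL_sgn_int {b μ α : ℝ} (hμ : 0 < μ) (hα : |α| ≤ 1) :
    Integrable fun ξ => ((aL b μ ξ * (if 0 < ξ then 1 else α) : ℝ) : ℂ) := by
  refine Integrable.ofReal ?_
  refine ((aL_integrable b hμ).bdd_mul (f := fun ξ : ℝ => (if 0 < ξ then (1:ℝ) else α)) (c := 1)
    (sgn_meas α).aestronglyMeasurable (Filter.Eventually.of_forall fun ξ => ?_)).congr
    (Filter.Eventually.of_forall fun ξ => mul_comm _ _)
  split_ifs
  · simp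
  · exact hα

lemma stmt_inf {χ : ℝ → ℝ} (hχ : Continuous χ) {b c M : ℝ} (hc0 : 0 < c)
    (hb : ∀ y, b < |y| → χ y = 0) (hc : ∀ y, |y| ≤ c → χ y = 1) (hM : ∀ y, |χ y| ≤ M)
    {C : ℝ} (hC : 0 < C) {μ : ℝ} (hμ : 0 < μ) (hμ1 : μ ≤ 1)
    (hlow : KB (ph μ) (fun ξ => ((aL b μ ξ * (if 0 < ξ then 1 else -1) : ℝ) : ℂ)) (C / √μ))
    (hhigh : KB (ph μ) (fun ξ => ((aH c μ ξ : ℝ) : ℂ)) (C / √μ))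
    {T : ℝ} (hT : 0 < T) {ε σ : ℝ} (hε : 0 < ε) (hσ : |σ| = 1)
    {G : ℝ → SchwartzMap ℝ ℂ} (hG : ContinuousOn G (Set.Icc 0 T)) :
    timeLp 4 T (fun t => eLpNorm (fun x => ∫ s in (0 : ℝ)..t,
        fmult1 (fun ξ => prop1 σ ((t - s) / ε) μ ξ * (Complex.I * (ξ : ℂ))) (⇑(G s)) x) ⊤ volume) ≤
      ENNReal.ofReal (12 * C * (ε / μ) ^ (1 / 2 : ℝ)) *
        (timeLp (4 / 3 : ℝ≥0∞) T (fun s => eLpNorm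
          (fmult1 (fun ξ => ((|ξ| ^ (1 / 2 : ℝ) * χ (√μ * |ξ|) : ℝ) : ℂ)) (⇑(G s))) 1 volume) +
        timeLp (4 / 3 : ℝ≥0∞) T (fun s => eLpNorm
          (fmult1 (fun ξ => (((1 - χ (√μ * |ξ|)) * (√μ * |ξ|) ^ (2 : ℝ) : ℝ) : ℂ) * (Complex.I * (ξ : ℂ)))
            (⇑(G s))) 1 volume)) := by
  rw [N43_rw hT, N43_rw hT, timeLp_4]
  have e0 : ∫⁻ t in Set.Ioo 0 T, (eLpNorm (fun x => ∫ s in (0 : ℝ)..t,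
        fmult1 (fun ξ => prop1 σ ((t - s) / ε) μ ξ * (Complex.I * (ξ : ℂ))) (⇑(G s)) x) ⊤ volume) ^ (4:ℝ) =
      ∫⁻ t in Set.Ioo 0 T, (eLpNorm (fun x => ∫ s in (0:ℝ)..t, (kc : ℂ) *
        ift (fun ξ => Eo (ph μ) (σ * ((t - s) / ε)) ξ *
        ((I * (ξ : ℂ)) * ft1 (G (Set.projIcc 0 T hT.le s)) ξ)) x) ⊤ volume) ^ (4:ℝ) := by
    apply setLIntegral_congr_fun measurableSet_Ioo
    intro t ht
    simp only [u_rw hT G σ ε μ ht]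
  rw [e0]
  have a1 := adm1 hT hG hχ hM μ (e := 1 / 2) (by norm_num) (by norm_num)
  have a2 := adm2 hT hG hχ hM hμ1 (e := 2) (by norm_num) (by norm_num)
  have k1 := hlow.const_mul (z := I) Complex.norm_I
  have := est_inf (ph_cont hμ) k1 hhigh a1 a2 (fun s => a1.int_mul k1.1 s) (fun s => a2.int_mul hhigh.1 s)
    (g := fun s ξ => (I * (ξ : ℂ)) * ft1 (G (Set.projIcc 0 T hT.le s)) ξ) (T := T) ?_ hε hσ
  · refine this.trans (le_of_eq ?_)
    congr 2
    rw [← Real.sqrt_eq_rpow, Real.sqrt_div hε.le]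
    ring
  · intro s ξ
    have l1 := alg_low hb μ ξ (k := 1 / 2) (e := 1 / 2) (by norm_num) (by norm_num) (by norm_num)
    have l2 := alg_high hc0 hc μ ξ 2 (e := 2) (by norm_num)
    rw [← Real.sqrt_eq_rpow, ← aL] at l1
    rw [← aH] at l2
    have l3 : (ξ : ℂ) = ((ξ * χ (√μ * |ξ|) : ℝ) : ℂ) + ((1 - χ (√μ * |ξ|) : ℝ) : ℂ) * ξ := by push_cast; ring
    have llc := congrArg (fun r : ℝ => (r : ℂ)) l1
    have lhc := congrArg (fun r : ℝ => (r : ℂ)) l2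
    simp only [Complex.ofReal_mul] at llc lhc l3 ⊢
    rw [← Real.sqrt_eq_rpow]
    linear_combination (I * ft1 (G (Set.projIcc 0 T hT.le s)) ξ) * (l3 + llc + ξ * lhc)

lemma stmt_two {χ : ℝ → ℝ} (hχ : Continuous χ) {b c M : ℝ} (hc0 : 0 < c)
    (hb : ∀ y, b < |y| → χ y = 0) (hc : ∀ y, |y| ≤ c → χ y = 1) (hM : ∀ y, |χ y| ≤ M)
    {C : ℝ} (hC : 0 < C) {μ : ℝ} (hμ : 0 < μ) (hμ1 : μ ≤ 1)
    (hlow : KB (ph μ) (fun ξ => ((aL b μ ξ * (if 0 < ξ then 1 else 1) : ℝ) : ℂ)) (C / √μ))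
    (hhigh : KB (ph μ) (fun ξ => ((aH c μ ξ : ℝ) : ℂ)) (C / √μ))
    {T : ℝ} (hT : 0 < T) {ε σ : ℝ} (hε : 0 < ε) (hσ : |σ| = 1)
    {G : ℝ → SchwartzMap ℝ ℂ} (hG : ContinuousOn G (Set.Icc 0 T)) :
    timeLp ⊤ T (fun t => eLpNorm (fun x => ∫ s in (0 : ℝ)..t,
        fmult1 (fun ξ => prop1 σ ((t - s) / ε) μ ξ * (Complex.I * (ξ : ℂ))) (⇑(G s)) x) 2 volume) ≤
      ENNReal.ofReal ((12 * C) ^ (1 / 2 : ℝ) * (ε / μ) ^ (1 / 4 : ℝ)) *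
        (timeLp (4 / 3 : ℝ≥0∞) T (fun s => eLpNorm
          (fmult1 (fun ξ => ((|ξ| ^ (3 / 4 : ℝ) * χ (√μ * |ξ|) : ℝ) : ℂ)) (⇑(G s))) 1 volume) +
        timeLp (4 / 3 : ℝ≥0∞) T (fun s => eLpNorm
          (fmult1 (fun ξ => (((1 - χ (√μ * |ξ|)) * (√μ * |ξ|) ^ (1 : ℝ) : ℝ) : ℂ) * (Complex.I * (ξ : ℂ)))
            (⇑(G s))) 1 volume)) := by
  rw [N43_rw hT, N43_rw hT]
  apply timeLp_top_le
  intro t ht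
  rw [u_rw hT G σ ε μ ht]
  have a1 := adm1 hT hG hχ hM μ (e := 3 / 4) (by norm_num) (by norm_num)
  have a2 := adm2 hT hG hχ hM hμ1 (e := 1) (by norm_num) (by norm_num)
  set c1 : ℝ → ℂ := fun ξ => I * (((if √μ * |ξ| ≤ b then |ξ| ^ (1 / 4 : ℝ) else 0) *
    (if 0 < ξ then 1 else -1) : ℝ) : ℂ) with hc1
  set c2 : ℝ → ℂ := fun ξ => ((if c < √μ * |ξ| then 1 / (√μ * |ξ|) ^ 1 else 0 : ℝ) : ℂ) with hc2
  have m1 : Measurable c1 := by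
    refine measurable_const.mul (Complex.measurable_ofReal.comp (Measurable.mul ?_ (sgn_meas (-1))))
    exact Measurable.ite (measurableSet_le (by fun_prop) (by fun_prop)) (by fun_prop) measurable_const
  have m2 : Measurable c2 := by
    refine Complex.measurable_ofReal.comp ?_
    exact Measurable.ite (measurableSet_lt (by fun_prop) (by fun_prop)) (by fun_prop) measurable_const
  have n1 : ∀ ξ, ‖c1 ξ‖ ^ 2 = aL b μ ξ * (if 0 < ξ then 1 else 1) := by
    intro ξ
    rw [hc1]
    simp only
    rw [norm_mul, Complex.norm_I, one_mul, Complex.norm_real, Real.norm_eq_abs, sq_abs, mul_pow]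
    have : (|ξ| ^ (1 / 4 : ℝ)) ^ 2 = √|ξ| := by
      rw [← Real.rpow_natCast, ← Real.rpow_mul (abs_nonneg _), Real.sqrt_eq_rpow]; norm_num
    unfold aL
    split_ifs <;> first | (rw [this]; norm_num) | norm_num
  have n2 : ∀ ξ, ‖c2 ξ‖ ^ 2 = aH c μ ξ := by
    intro ξ
    rw [hc2]
    simp only
    rw [Complex.norm_real, Real.norm_eq_abs, sq_abs]
    unfold aH
    split_ifs
    · rw [pow_one, div_pow, one_pow]
    · simp
  have k1 : KB (ph μ) (fun ξ => ((‖c1 ξ‖ ^ 2 : ℝ) : ℂ)) (C / √μ) := by simp only [n1]; exact hlow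
  have k2 : KB (ph μ) (fun ξ => ((‖c2 ξ‖ ^ 2 : ℝ) : ℂ)) (C / √μ) := by simp only [n2]; exact hhigh
  have := est_two (ph_cont hμ) m1 m2 k1 k2 a1 a2 (adm0 hT hG) ?_ hε hσ ht
  · refine this.trans (le_of_eq ?_)
    congr 2
    have e : 12 * (C / √μ * √ε) = 12 * C * (ε / μ) ^ (1 / 2 : ℝ) := by
      rw [← Real.sqrt_eq_rpow, Real.sqrt_div hε.le]
      ring
    rw [e, Real.mul_rpow (by positivity) (by positivity), ← Real.rpow_mul (by positivity)]
    norm_num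
  · intro s ξ
    have l1 := alg_low hb μ ξ (k := 1 / 4) (e := 3 / 4) (by norm_num) (by norm_num) (by norm_num)
    have l2 := alg_high hc0 hc μ ξ 1 (e := 1) (by norm_num)
    have l3 : (ξ : ℂ) = ((ξ * χ (√μ * |ξ|) : ℝ) : ℂ) + ((1 - χ (√μ * |ξ|) : ℝ) : ℂ) * ξ := by push_cast; ring
    have llc := congrArg (fun r : ℝ => (r : ℂ)) l1
    have lhc := congrArg (fun r : ℝ => (r : ℂ)) l2
    simp only [hc1, hc2]
    rw [Complex.ofReal_mul (_ * _) (_ * _)] at llc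
    rw [Complex.ofReal_mul _ (_ * _)] at lhc
    linear_combination (I * ft1 (G (Set.projIcc 0 T hT.le s)) ξ) * (l3 + llc + ξ * lhc)

/-- Retarded Strichartz estimate (4.8) for derivative source terms: for
`(q,r) ∈ {(4,∞),(∞,2)}`, `u(t) = ∫₀ᵗ e^{±((t−s)/ε)∂ₓ/√(1+μD²/3)} ∂ₓ G(s) ds` satisfies
`‖u‖_{L^{q}(0,T;L^{r})} ≤ C (ε/μ)^{(1/2)(1−1/r)} (‖|D|^{1/2+1/(2r)} χ(√μ|D|) G‖_{L^{4/3}(0,T;L¹)}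
+ ‖(1−χ(√μ|D|)) (√μ|D|)^{2(1−1/r)} ∂ₓ G‖_{L^{4/3}(0,T;L¹)})`. -/
theorem stmt15 (χ : ℝ → ℝ) (hχ : ContDiff ℝ (⊤ : ℕ∞) χ) (hχc : HasCompactSupport χ)
    (hχ1 : ∀ᶠ y in nhds (0 : ℝ), χ y = 1) (σ : ℝ) (hσ : σ = 1 ∨ σ = -1) :
    ∃ C : ℝ, 0 < C ∧
      ∀ qr ∈ ({((4 : ℝ≥0∞), (⊤ : ℝ≥0∞)), ((⊤ : ℝ≥0∞), (2 : ℝ≥0∞))} : Set (ℝ≥0∞ × ℝ≥0∞)),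
        ∀ T : ℝ, 0 < T → ∀ μ ∈ Set.Ioc (0 : ℝ) 1, ∀ ε ∈ Set.Ioc (0 : ℝ) 1,
          ∀ G : ℝ → SchwartzMap ℝ ℂ, ContinuousOn G (Set.Icc 0 T) →
            timeLp qr.1 T
                (fun t => eLpNorm
                  (fun x => ∫ s in (0 : ℝ)..t,
                    fmult1 (fun ξ => prop1 σ ((t - s) / ε) μ ξ * (Complex.I * (ξ : ℂ)))
                      (⇑(G s)) x) qr.2 volume) ≤
              ENNReal.ofReal (C * (ε / μ) ^ ((1 / 2) * (1 - (qr.2⁻¹).toReal))) *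
                (timeLp (4 / 3 : ℝ≥0∞) T
                    (fun s => eLpNorm
                      (fmult1 (fun ξ =>
                        ((|ξ| ^ (1 / 2 + (1 / 2) * (qr.2⁻¹).toReal) *
                          χ (Real.sqrt μ * |ξ|) : ℝ) : ℂ)) (⇑(G s))) 1 volume) +
                  timeLp (4 / 3 : ℝ≥0∞) T
                    (fun s => eLpNorm
                      (fmult1 (fun ξ =>
                        (((1 - χ (Real.sqrt μ * |ξ|)) *
                          (Real.sqrt μ * |ξ|) ^ (2 * (1 - (qr.2⁻¹).toReal)) : ℝ) : ℂ) *
                          (Complex.I * (ξ : ℂ))) (⇑(G s))) 1 volume)) := by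
  obtain ⟨b, c, M, hb1, hc0, hc1, hM0, hb, hc, hM⟩ := chi_data χ hχ hχc hχ1
  obtain ⟨C1, hC1, hlow⟩ := disp_low hb1
  obtain ⟨C2, hC2, hhigh⟩ := disp_high hc0 (by linarith : c ≤ 3)
  have hσ1 : |σ| = 1 := by rcases hσ with rfl | rfl <;> simp
  set C0 := C1 + C2 with hC0
  have hC0p : 0 < C0 := by positivity
  refine ⟨12 * C0 + (12 * C0) ^ (1 / 2 : ℝ), by positivity, ?_⟩
  intro qr hqr T hT μ hμ ε hε G hG
  have hμ0 : 0 < μ := hμ.1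
  have hsμ : 0 < √μ := Real.sqrt_pos.2 hμ0
  have hε0 : 0 < ε := hε.1
  have kl : ∀ α : ℝ, |α| ≤ 1 →
      KB (ph μ) (fun ξ => ((aL b μ ξ * (if 0 < ξ then 1 else α) : ℝ) : ℂ)) (C0 / √μ) := by
    intro α hα
    refine KB_of (aL_sgn_int hμ0 hα) (by positivity) (fun θ y hθ => ?_)
    refine (hlow α hα μ hμ0 θ y hθ).trans ?_
    rw [div_div]
    gcongr
    linarith
  have kh : KB (ph μ) (fun ξ => ((aH c μ ξ : ℝ) : ℂ)) (C0 / √μ) := by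
    refine KB_of (aH_integrable hc0 hμ0).ofReal (by positivity) (fun θ y hθ => ?_)
    refine (hhigh μ hμ0 hμ.2 θ y hθ).trans ?_
    rw [div_div]
    gcongr
    linarith
  rcases hqr with rfl | hqr
  · have e1 : ((⊤ : ℝ≥0∞)⁻¹).toReal = 0 := by simp
    simp only [e1, mul_zero, add_zero, sub_zero, mul_one]
    refine (stmt_inf hχ.continuous hc0 hb hc hM hC0p hμ0 hμ.2 (kl (-1) (by simp)) kh hT hε0 hσ1 hG).trans ?_
    gcongr
    have : 0 ≤ (12 * C0) ^ (1 / 2 : ℝ) := by positivity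
    linarith
  · rw [Set.mem_singleton_iff] at hqr
    subst hqr
    have e1 : ((2 : ℝ≥0∞)⁻¹).toReal = 1 / 2 := by rw [ENNReal.toReal_inv]; norm_num
    have e2 : (1 / 2 + 1 / 2 * (1 / 2) : ℝ) = 3 / 4 := by norm_num
    have e3 : (2 * (1 - 1 / 2) : ℝ) = 1 := by norm_num
    have e4 : (1 / 2 * (1 - 1 / 2) : ℝ) = 1 / 4 := by norm_num
    simp only [e1, e2, e3, e4]
    refine (stmt_two hχ.continuous hc0 hb hc hM hC0p hμ0 hμ.2 (kl 1 (by simp)) kh hT hε0 hσ1 hG).trans ?_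
    gcongr
    linarith
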